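/- Polynomial interior growth bound via chains of Harnack cubes (claim in the proof of Lemma 2.6): Let K>0. There exist constants C>0 and C'>0 depending only on n, λ, Λ and K such that the following holds. Assume [g]_{C^{1,1/2}} ≤ K, and let u be a positive solution of u_t = Lu in 𝒞₁ with u(Ē)=1. Then for every (x₀,t₀) ∈ 𝒞_{12/17}, u(x₀,t₀) ≤ C·d₀^{−C'}, where d₀ = inf over (y,s)∈Γ of (|x₀−y| + |t₀−s|^{1/2}) is the parabolic distance from (x₀,t₀) to Γ. -/

import Mathlib

noncomputable section
open scoped BigOperators
open Classical

abbrev Spc (m : ℕ) := EuclideanSpace ℝ (Fin (m + 1))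
abbrev Spc' (m : ℕ) := EuclideanSpace ℝ (Fin m)

/-- The horizontal coordinates `x' ∈ ℝ^{n-1}` of a point `x ∈ ℝⁿ`. -/
def xprime {m : ℕ} (x : Spc m) : Spc' m :=
  (WithLp.equiv 2 _).symm fun i => x i.castSucc

/-- The last (vertical) coordinate `x_n` of a point `x ∈ ℝⁿ`. -/
def xlast {m : ℕ} (x : Spc m) : ℝ := x (Fin.last m)

/-- Build a point of `ℝⁿ` from `x' ∈ ℝ^{n-1}` and the vertical coordinate. -/
def mkPt {m : ℕ} (x' : Spc' m) (xn : ℝ) : Spc m :=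
  (WithLp.equiv 2 _).symm fun i => if h : i = Fin.last m then xn else x' (i.castPred h)

/-- The `i`-th standard basis vector. -/
def eVec (m : ℕ) (i : Fin (m + 1)) : Spc m := EuclideanSpace.single i 1

/-- The entry `∂²u/∂xᵢ∂xⱼ` of the spatial Hessian of `u(x,t)` at `p = (x,t)`. -/
def sHess {m : ℕ} (u : Spc m × ℝ → ℝ) (p : Spc m × ℝ) (i j : Fin (m + 1)) : ℝ :=
  fderiv ℝ (fun y => fderiv ℝ (fun z => u (z, p.2)) y (eVec m j)) p.1 (eVec m i)

/-- The operator `Lu = tr(A(x) D²ₓu)` at the point `p = (x,t)`. -/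
def Lop {m : ℕ} (A : Spc m → Matrix (Fin (m + 1)) (Fin (m + 1)) ℝ)
    (u : Spc m × ℝ → ℝ) (p : Spc m × ℝ) : ℝ :=
  ∑ i, ∑ j, A p.1 i j * sHess u p j i

/-- Uniform ellipticity with symmetric coefficients: `λ|ξ|² ≤ ξ·A(x)ξ ≤ Λ|ξ|²`. -/
def IsElliptic {m : ℕ} (lam Lam : ℝ)
    (A : Spc m → Matrix (Fin (m + 1)) (Fin (m + 1)) ℝ) : Prop :=
  (∀ x, (A x).IsSymm) ∧
  ∀ (x ξ : Spc m),
    lam * ‖ξ‖ ^ 2 ≤ ∑ i, ∑ j, ξ i * A x i j * ξ j ∧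
      ∑ i, ∑ j, ξ i * A x i j * ξ j ≤ Lam * ‖ξ‖ ^ 2

/-- `u` is (pointwise) a solution of `u_t = Lu` on `Ω`: twice continuously
differentiable in `x`, differentiable in `t`, with `∂ₜu = tr(A(x)D²ₓu)`. -/
def SolvesL {m : ℕ} (A : Spc m → Matrix (Fin (m + 1)) (Fin (m + 1)) ℝ)
    (u : Spc m × ℝ → ℝ) (Ω : Set (Spc m × ℝ)) : Prop :=
  ∀ p ∈ Ω, ContDiffAt ℝ 2 (fun y => u (y, p.2)) p.1 ∧
    HasDerivAt (fun s => u (p.1, s)) (Lop A u p) p.2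

/-- `u` is a pointwise subsolution: `u_t ≤ Lu` on `Ω`. -/
def SubSolvesL {m : ℕ} (A : Spc m → Matrix (Fin (m + 1)) (Fin (m + 1)) ℝ)
    (u : Spc m × ℝ → ℝ) (Ω : Set (Spc m × ℝ)) : Prop :=
  ∀ p ∈ Ω, ContDiffAt ℝ 2 (fun y => u (y, p.2)) p.1 ∧
    DifferentiableAt ℝ (fun s => u (p.1, s)) p.2 ∧
    deriv (fun s => u (p.1, s)) p.2 ≤ Lop A u p

/-- `u` solves the heat equation `∂ₜu = Δu` on `Ω`. -/
def SolvesHeat {m : ℕ} (u : Spc m × ℝ → ℝ) (Ω : Set (Spc m × ℝ)) : Prop :=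
  ∀ p ∈ Ω, ContDiffAt ℝ 2 (fun y => u (y, p.2)) p.1 ∧
    HasDerivAt (fun s => u (p.1, s)) (∑ i, sHess u p i i) p.2

/-- The graph `Γ = {x_n = g(x',t)}`. -/
def graphSet {m : ℕ} (g : Spc' m → ℝ → ℝ) : Set (Spc m × ℝ) :=
  {p | xlast p.1 = g (xprime p.1) p.2}

/-- The cylinder `𝒞_r` of size `r` on top of the graph of `g`. -/
def Cyl {m : ℕ} (g : Spc' m → ℝ → ℝ) (r : ℝ) : Set (Spc m × ℝ) :=
  {p | ‖xprime p.1‖ < r ∧ -r ^ 2 < p.2 ∧ p.2 < r ^ 2 ∧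
    g (xprime p.1) p.2 < xlast p.1 ∧ xlast p.1 < g (xprime p.1) p.2 + r}

/-- The point `Ē = ((0', g(0',1/2) + 1/2), 1/2)`. -/
def Ebar {m : ℕ} (g : Spc' m → ℝ → ℝ) : Spc m × ℝ := (mkPt 0 (g 0 (1 / 2) + 1 / 2), 1 / 2)

/-- The point `E̲ = ((0', g(0',−1/2) + 1/2), −1/2)`. -/
def Eund {m : ℕ} (g : Spc' m → ℝ → ℝ) : Spc m × ℝ := (mkPt 0 (g 0 (-(1 / 2)) + 1 / 2), -(1 / 2))

/-- `u` vanishes continuously on `Γ`: `u(Q) → 0` as `Q → P` within `Ω`,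
for every `P ∈ Γ` in the closure of `Ω`. -/
def VanishesOn {m : ℕ} (u : Spc m × ℝ → ℝ) (Ω Γ : Set (Spc m × ℝ)) : Prop :=
  ∀ P ∈ Γ ∩ closure Ω, Filter.Tendsto u (nhdsWithin P Ω) (nhds 0)

/-- `[g]_{C^{α,β}} ≤ K`. -/
def HolderSemi {m : ℕ} (α β K : ℝ) (g : Spc' m → ℝ → ℝ) : Prop :=
  ∀ x' y' t s, |g x' t - g y' s| ≤ K * (‖x' - y'‖ ^ α + |t - s| ^ β)

/-- The backward-in-time cylinder `𝒞_r^−` (Lipschitz setting, parabolic scaling). -/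
def CylB {m : ℕ} (g : Spc' m → ℝ → ℝ) (r : ℝ) : Set (Spc m × ℝ) :=
  {p | (∀ i : Fin m, -r < xprime p.1 i ∧ xprime p.1 i < r) ∧ -r ^ 2 < p.2 ∧ p.2 ≤ 0 ∧
    g (xprime p.1) p.2 < xlast p.1 ∧ xlast p.1 < g (xprime p.1) p.2 + r}

/-- The set `𝒜_r` of points of `𝒞_r^−` at height at least `δr` above `Γ`. -/
def ASet {m : ℕ} (g : Spc' m → ℝ → ℝ) (δ r : ℝ) : Set (Spc m × ℝ) :=
  {p ∈ CylB g r | g (xprime p.1) p.2 + δ * r ≤ xlast p.1}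

/-- The backward-in-time cylinder `𝒞_r^−` (Hölder setting, time interval `(−r,0]`). -/
def CylBH {m : ℕ} (g : Spc' m → ℝ → ℝ) (r : ℝ) : Set (Spc m × ℝ) :=
  {p | (∀ i : Fin m, -r < xprime p.1 i ∧ xprime p.1 i < r) ∧ -r < p.2 ∧ p.2 ≤ 0 ∧
    g (xprime p.1) p.2 < xlast p.1 ∧ xlast p.1 < g (xprime p.1) p.2 + r}

/-- The set `𝒜_r` of points of the Hölder cylinder `𝒞_r^−` at height at least `r^β` above `Γ`. -/
def ASetH {m : ℕ} (g : Spc' m → ℝ → ℝ) (β r : ℝ) : Set (Spc m × ℝ) :=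
  {p ∈ CylBH g r | g (xprime p.1) p.2 + r ^ β ≤ xlast p.1}

/-- The height `h_Γ(x,t) = x_n − g(x',t)` above the graph. -/
def hGamma {m : ℕ} (g : Spc' m → ℝ → ℝ) (p : Spc m × ℝ) : ℝ :=
  xlast p.1 - g (xprime p.1) p.2
/-- The parabolic distance `|x₀ − y| + |t₀ − s|^{1/2}`-type gauge between two
space-time points. -/
def pdist {m : ℕ} (p q : Spc m × ℝ) : ℝ := ‖p.1 - q.1‖ + |p.2 - q.2| ^ ((1 : ℝ) / 2)

/-! ### Second-order calculus -/

theorem ContDiffAt.eventually_second_difference {E : Type*} [NormedAddCommGroup E]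
    [NormedSpace ℝ E] {f : E → ℝ} {x : E} (hf : ContDiffAt ℝ 2 f x) {ε : ℝ} (hε : 0 < ε) :
    ∀ᶠ v in nhds (0 : E),
      |f (x + v) + f (x - v) - 2 * f x - fderiv ℝ (fderiv ℝ f) x v v| ≤ ε * ‖v‖ ^ 2 := by
  have h1 : ContDiffAt ℝ 1 (fderiv ℝ f) x := hf.fderiv_right (by norm_num)
  have h2 : HasFDerivAt (fderiv ℝ f) (fderiv ℝ (fderiv ℝ f) x) x :=
    (h1.differentiableAt (by norm_num)).hasFDerivAt
  have h3 : ∀ᶠ y in nhds x, DifferentiableAt ℝ f y := by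
    filter_upwards [hf.eventually (by simp)] with y hy
    exact hy.differentiableAt (by norm_num)
  have h4 := h2.isLittleO.def (half_pos hε)
  obtain ⟨r, hr, hball⟩ := Metric.eventually_nhds_iff.1 (h3.and h4)
  set H := fderiv ℝ (fderiv ℝ f) x with hH
  have hd : ∀ w : E, ‖w‖ < r → DifferentiableAt ℝ f (x + w) ∧
      ‖fderiv ℝ f (x + w) - fderiv ℝ f x - H w‖ ≤ ε / 2 * ‖w‖ := by
    intro w hw
    have := @hball (x + w) (by simpa [dist_eq_norm] using hw)
    simpa using this
  refine Metric.eventually_nhds_iff.2 ⟨r, hr, fun v hv => ?_⟩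
  have hv' : ‖v‖ < r := by simpa using hv
  have hder : ∀ s ∈ Set.Icc (0 : ℝ) 1, HasDerivWithinAt
      (fun s : ℝ => f (x + s • v) + f (x - s • v) - s ^ 2 * H v v)
      (fderiv ℝ f (x + s • v) v - fderiv ℝ f (x - s • v) v - 2 * s * H v v) (Set.Icc 0 1) s := by
    intro s hs
    have hsv : ‖s • v‖ < r := by
      rw [norm_smul, Real.norm_eq_abs, abs_of_nonneg hs.1]
      nlinarith [hs.2, norm_nonneg v]
    have a1 : HasDerivAt (fun s : ℝ => x + s • v) v s := by
      simpa using ((hasDerivAt_id s).smul_const v).const_add x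
    have a2 : HasDerivAt (fun s : ℝ => x - s • v) (-v) s := by
      simpa using ((hasDerivAt_id s).smul_const v).const_sub x
    have b1 := (hd _ hsv).1.hasFDerivAt.comp_hasDerivAt s a1
    have b2 := (show HasFDerivAt f (fderiv ℝ f (x - s • v)) (x - s • v) by
      have := (hd (-(s • v)) (by simpa using hsv)).1.hasFDerivAt
      simpa [sub_eq_add_neg] using this).comp_hasDerivAt s a2
    have b3 : HasDerivAt (fun s : ℝ => s ^ 2 * H v v) (2 * s * H v v) s := by
      simpa using (hasDerivAt_pow 2 s).mul_const (H v v)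
    have := (b1.add b2).sub b3
    refine (this.congr_deriv ?_).hasDerivWithinAt
    simp [sub_eq_add_neg]
  have hbound : ∀ s ∈ Set.Ico (0 : ℝ) 1,
      ‖fderiv ℝ f (x + s • v) v - fderiv ℝ f (x - s • v) v - 2 * s * H v v‖ ≤ ε * ‖v‖ ^ 2 := by
    intro s hs
    have hs1 : ‖s • v‖ ≤ ‖v‖ := by
      rw [norm_smul, Real.norm_eq_abs, abs_of_nonneg hs.1]
      nlinarith [hs.2, norm_nonneg v]
    have c1 := (hd (s • v) (hs1.trans_lt hv')).2
    have c2 := (hd (-(s • v)) (by simpa using hs1.trans_lt hv')).2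
    rw [norm_neg] at c2
    have d1 := (fderiv ℝ f (x + s • v) - fderiv ℝ f x - H (s • v)).le_opNorm v
    have d2 := (fderiv ℝ f (x + -(s • v)) - fderiv ℝ f x - H (-(s • v))).le_opNorm v
    have e : fderiv ℝ f (x + s • v) v - fderiv ℝ f (x - s • v) v - 2 * s * H v v
        = (fderiv ℝ f (x + s • v) - fderiv ℝ f x - H (s • v)) v
          - (fderiv ℝ f (x + -(s • v)) - fderiv ℝ f x - H (-(s • v))) v := by
      simp [sub_eq_add_neg]; ring
    rw [e]
    refine (norm_sub_le _ _).trans ?_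
    have f1 : ε / 2 * ‖s • v‖ * ‖v‖ ≤ ε / 2 * ‖v‖ * ‖v‖ := by gcongr
    nlinarith [mul_le_mul_of_nonneg_right c1 (norm_nonneg v),
      mul_le_mul_of_nonneg_right c2 (norm_nonneg v)]
  have := norm_image_sub_le_of_norm_deriv_le_segment' hder hbound 1 (by simp)
  simp only [Real.norm_eq_abs, one_smul, zero_smul, add_zero, sub_zero] at this
  refine le_trans (le_of_eq ?_) (this.trans (by simp))
  congr 1; ring

/-! ### Nonnegative quadratic forms -/

theorem Matrix.IsSymm.sum_mul_nonneg {ι : Type*} [Fintype ι] {A M : Matrix ι ι ℝ}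
    (hA : A.IsSymm) (hA0 : ∀ v : ι → ℝ, 0 ≤ ∑ i, ∑ j, v i * A i j * v j)
    (hM : ∀ v : ι → ℝ, 0 ≤ ∑ i, ∑ j, v i * M i j * v j) :
    0 ≤ ∑ i, ∑ j, A i j * M j i := by
  have hpsd : A.PosSemidef := by
    refine Matrix.PosSemidef.of_dotProduct_mulVec_nonneg ?_ fun v => ?_
    · rw [Matrix.IsHermitian, Matrix.conjTranspose_eq_transpose_of_trivial]
      exact hA
    · refine (hA0 v).trans (le_of_eq ?_)
      simp [dotProduct, Matrix.mulVec, Finset.mul_sum, mul_assoc]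
  obtain ⟨k, B, rfl⟩ := Matrix.posSemidef_iff_eq_sum_vecMulVec.1 hpsd
  have : ∑ i, ∑ j, (∑ l, Matrix.vecMulVec (B l) (star (B l))) i j * M j i
      = ∑ l, ∑ j, ∑ i, B l j * M j i * B l i := by
    simp only [Matrix.sum_apply, Matrix.vecMulVec_apply, star_trivial, Finset.sum_mul]
    have h1 : ∀ i, ∑ j, ∑ l, B l i * B l j * M j i = ∑ l, ∑ j, B l i * B l j * M j i :=
      fun i => Finset.sum_comm
    simp only [h1]
    rw [Finset.sum_comm]
    refine Finset.sum_congr rfl fun l _ => ?_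
    rw [Finset.sum_comm]
    exact Finset.sum_congr rfl fun j _ => Finset.sum_congr rfl fun i _ => by ring
  rw [this]
  exact Finset.sum_nonneg fun l _ => hM (B l)

section TraceInequalities
variable {m : ℕ} {lam Lam : ℝ} {A : Spc m → Matrix (Fin (m + 1)) (Fin (m + 1)) ℝ}
  {u : Spc m × ℝ → ℝ} {Ω : Set (Spc m × ℝ)}

theorem IsElliptic.quadForm_nonneg (hA : IsElliptic lam Lam A) (hlam : 0 < lam) (x : Spc m)
    (v : Fin (m + 1) → ℝ) : 0 ≤ ∑ i, ∑ j, v i * A x i j * v j :=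
  (by positivity : 0 ≤ lam * ‖WithLp.toLp 2 v‖ ^ 2).trans (hA.2 x (WithLp.toLp 2 v)).1

theorem IsElliptic.diag_mem (hA : IsElliptic lam Lam A) (x : Spc m) (i : Fin (m + 1)) :
    lam ≤ A x i i ∧ A x i i ≤ Lam := by
  have := hA.2 x (EuclideanSpace.single i 1)
  simpa [Pi.single_apply] using this

theorem IsElliptic.trace_nonneg (hA : IsElliptic lam Lam A) (hlam : 0 < lam) (x : Spc m) :
    0 ≤ ∑ i, A x i i :=
  Finset.sum_nonneg fun i _ => hlam.le.trans (hA.diag_mem x i).1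

theorem IsElliptic.trace_le (hA : IsElliptic lam Lam A) (x : Spc m) :
    ∑ i, A x i i ≤ (m + 1) * Lam := by
  refine (Finset.sum_le_sum fun i _ => (hA.diag_mem x i).2).trans (le_of_eq ?_)
  simp

theorem sHess_quadForm {p : Spc m × ℝ} (hu : ContDiffAt ℝ 2 (fun y => u (y, p.2)) p.1)
    (v : Spc m) : ∑ i, ∑ j, v i * sHess u p i j * v j
      = fderiv ℝ (fderiv ℝ fun y => u (y, p.2)) p.1 v v := by
  set f := fun y => u (y, p.2)
  have h1 : DifferentiableAt ℝ (fderiv ℝ f) p.1 :=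
    (hu.fderiv_right (m := 1) (by norm_num)).differentiableAt (by norm_num)
  have h2 : ∀ i j, sHess u p i j = fderiv ℝ (fderiv ℝ f) p.1 (eVec m i) (eVec m j) := by
    intro i j
    have := (h1.hasFDerivAt.clm_apply (hasFDerivAt_const (eVec m j) p.1)).fderiv
    simp only [sHess]
    change fderiv ℝ (fun y => fderiv ℝ f y (eVec m j)) p.1 (eVec m i) = _
    rw [this]
    simp
  have hv : v = ∑ i, v i • eVec m i := by
    ext k
    simp [eVec, Pi.single_apply]
  conv_rhs => rw [hv]
  simp only [map_sum, map_smul, _root_.sum_apply, _root_.smul_apply,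
    smul_eq_mul, Finset.mul_sum, h2]
  rw [Finset.sum_comm]
  exact Finset.sum_congr rfl fun i _ => Finset.sum_congr rfl fun j _ => by ring

theorem le_of_eventually_second_difference {E : Type*} [NormedAddCommGroup E]
    [NormedSpace ℝ E] {f q : E → ℝ} {x : E} (hf : ContDiffAt ℝ 2 f x)
    (hq : ∀ (s : ℝ) v, q (s • v) = s ^ 2 * q v)
    (h : ∀ ε > 0, ∀ᶠ v in nhds (0 : E),
      q v - ε * ‖v‖ ^ 2 ≤ f (x + v) + f (x - v) - 2 * f x) (v : E) :
    q v ≤ fderiv ℝ (fderiv ℝ f) x v v := by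
  refine le_of_forall_pos_le_add fun δ hδ => ?_
  set ε := δ / (2 * (‖v‖ ^ 2 + 1)) with hε
  have hε0 : 0 < ε := by positivity
  have hev := (hf.eventually_second_difference hε0).and (h ε hε0)
  have ht : Filter.Tendsto (fun s : ℝ => s • v) (nhdsWithin 0 (Set.Ioi 0)) (nhds 0) := by
    have : Filter.Tendsto (fun s : ℝ => s • v) (nhds 0) (nhds ((0 : ℝ) • v)) :=
      (continuous_id.smul continuous_const).tendsto 0
    rw [zero_smul] at this
    exact this.mono_left nhdsWithin_le_nhds
  obtain ⟨s, ⟨h1, h2⟩, hs⟩ := ((ht.eventually hev).and self_mem_nhdsWithin).exists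
  have hs : 0 < s := hs
  rw [hq] at h2
  simp only [map_smul, _root_.smul_apply, smul_eq_mul, norm_smul, Real.norm_eq_abs,
    mul_pow, sq_abs] at h1 h2
  have h3 := (abs_le.1 h1).2
  have h4 : s ^ 2 * q v ≤ s ^ 2 * (fderiv ℝ (fderiv ℝ f) x v v + 2 * ε * ‖v‖ ^ 2) := by
    nlinarith
  have h5 := le_of_mul_le_mul_left h4 (by positivity)
  have h6 : 2 * ε * ‖v‖ ^ 2 ≤ δ := by
    have : 2 * ε * (‖v‖ ^ 2 + 1) = δ := by rw [hε]; field_simp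
    nlinarith
  linarith

theorem Lop_ge_of_eventually (hA : IsElliptic lam Lam A) (hlam : 0 < lam) {p : Spc m × ℝ}
    (hu : ContDiffAt ℝ 2 (fun y => u (y, p.2)) p.1) {α β : ℝ} {w : Spc m}
    (h : ∀ ε > 0, ∀ᶠ v in nhds (0 : Spc m),
      α * ‖v‖ ^ 2 + β * inner ℝ w v ^ 2 - ε * ‖v‖ ^ 2
        ≤ u (p.1 + v, p.2) + u (p.1 - v, p.2) - 2 * u p) :
    α * ∑ i, A p.1 i i + β * ∑ i, ∑ j, w i * A p.1 i j * w j ≤ Lop A u p := by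
  have hq := le_of_eventually_second_difference (f := fun y => u (y, p.2))
    (q := fun v => α * ‖v‖ ^ 2 + β * inner ℝ w v ^ 2) hu (fun s v => by
      simp only [norm_smul, Real.norm_eq_abs, mul_pow, sq_abs, inner_smul_right]; ring)
    (fun ε hε => h ε hε)
  set M : Matrix (Fin (m + 1)) (Fin (m + 1)) ℝ :=
    fun i j => sHess u p i j - ((if i = j then α else 0) + β * w i * w j) with hM
  have h1 := Matrix.IsSymm.sum_mul_nonneg (A := A p.1) (M := M) (hA.1 p.1)
    (hA.quadForm_nonneg hlam p.1) (fun v => by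
      have h2 := hq (WithLp.toLp 2 v)
      rw [← sHess_quadForm hu] at h2
      have h3 : ∑ i, ∑ j, v i * M i j * v j
          = ∑ i, ∑ j, v i * sHess u p i j * v j -
            (α * ‖WithLp.toLp 2 v‖ ^ 2 + β * inner ℝ w (WithLp.toLp 2 v) ^ 2) := by
        rw [EuclideanSpace.real_norm_sq_eq, PiLp.inner_apply, sq (∑ i, _), Finset.sum_mul_sum,
          Finset.mul_sum, Finset.mul_sum, ← Finset.sum_add_distrib, ← Finset.sum_sub_distrib]
        refine Finset.sum_congr rfl fun i _ => ?_
        have h4 : α * v i ^ 2 = ∑ j, v i * (if i = j then α else 0) * v j := by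
          simp; ring
        change _ = _ - (α * v i ^ 2 + _)
        rw [h4, Finset.mul_sum, ← Finset.sum_add_distrib, ← Finset.sum_sub_distrib]
        refine Finset.sum_congr rfl fun j _ => ?_
        simp only [hM, RCLike.inner_apply, conj_trivial]; split_ifs <;> ring
      rw [h3]; exact sub_nonneg.2 h2)
  have h5 : ∑ i, ∑ j, A p.1 i j * M j i
      = Lop A u p - (α * ∑ i, A p.1 i i + β * ∑ i, ∑ j, w i * A p.1 i j * w j) := by
    rw [Lop, Finset.mul_sum, Finset.mul_sum, ← Finset.sum_add_distrib, ← Finset.sum_sub_distrib]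
    refine Finset.sum_congr rfl fun i _ => ?_
    have h4 : α * A p.1 i i = ∑ j, A p.1 i j * (if j = i then α else 0) := by
      simp; ring
    rw [h4, Finset.mul_sum, ← Finset.sum_add_distrib, ← Finset.sum_sub_distrib]
    refine Finset.sum_congr rfl fun j _ => ?_
    simp only [hM]; split_ifs <;> ring
  linarith

/-- A solution touched from below by a paraboloid of opening `α` has bounded second differences
at the contact point. -/
theorem second_difference_le_of_touched (hA : IsElliptic lam Lam A) (hlam : 0 < lam)
    {p : Spc m × ℝ} (hu : ContDiffAt ℝ 2 (fun y => u (y, p.2)) p.1) {α L : ℝ} (hα : 0 ≤ α)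
    (h : ∀ᶠ v in nhds (0 : Spc m),
      -α * ‖v‖ ^ 2 ≤ u (p.1 + v, p.2) + u (p.1 - v, p.2) - 2 * u p)
    (hL : Lop A u p ≤ L) {ε : ℝ} (hε : 0 < ε) :
    ∀ᶠ v in nhds (0 : Spc m), u (p.1 + v, p.2) + u (p.1 - v, p.2) - 2 * u p
      ≤ ((L + α * ((m + 1) * Lam)) / lam - α + ε) * ‖v‖ ^ 2 := by
  have hq := le_of_eventually_second_difference (f := fun y => u (y, p.2))
    (q := fun v => -α * ‖v‖ ^ 2) hu (fun s v => by
      simp only [norm_smul, Real.norm_eq_abs, mul_pow, sq_abs]; ring)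
    (fun ε hε => h.mono fun v hv => by
      have : 0 ≤ ε * ‖v‖ ^ 2 := by positivity
      have hv' : -α * ‖v‖ ^ 2 ≤ u (p.1 + v, p.2) + u (p.1 - v, p.2) - 2 * u (p.1, p.2) := hv
      linarith)
  have key : ∀ v : Spc m, lam * (∑ i, ∑ j, v i * sHess u p i j * v j + α * ‖v‖ ^ 2)
      ≤ ‖v‖ ^ 2 * (L + α * ((m + 1) * Lam)) := by
    intro v
    set M : Matrix (Fin (m + 1)) (Fin (m + 1)) ℝ :=
      fun i j => sHess u p i j + (if i = j then α else 0) with hM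
    set B : Matrix (Fin (m + 1)) (Fin (m + 1)) ℝ :=
      fun i j => ‖v‖ ^ 2 * A p.1 i j - lam * (v i * v j) with hB
    have hMv : ∀ w : Fin (m + 1) → ℝ, ∑ i, ∑ j, w i * M i j * w j
        = ∑ i, ∑ j, w i * sHess u p i j * w j + α * ‖WithLp.toLp 2 w‖ ^ 2 := by
      intro w
      rw [EuclideanSpace.real_norm_sq_eq, Finset.mul_sum, ← Finset.sum_add_distrib]
      refine Finset.sum_congr rfl fun i _ => ?_
      have h4 : α * w i ^ 2 = ∑ j, w i * (if i = j then α else 0) * w j := by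
        simp; ring
      change _ = _ + (α * w i ^ 2)
      rw [h4, ← Finset.sum_add_distrib]
      refine Finset.sum_congr rfl fun j _ => ?_
      simp only [hM]; split_ifs <;> ring
    have h1 := Matrix.IsSymm.sum_mul_nonneg (A := B) (M := M)
      (by
        ext i j
        have := congrFun (congrFun (hA.1 p.1) i) j
        simp only [Matrix.transpose_apply] at this
        change ‖v‖ ^ 2 * A p.1 j i - lam * (v j * v i) = ‖v‖ ^ 2 * A p.1 i j - lam * (v i * v j)
        rw [this, mul_comm (v j)])
      (fun w => by
        have h2 := (hA.2 p.1 (WithLp.toLp 2 w)).1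
        have h3 : ∑ i, ∑ j, w i * B i j * w j = ‖v‖ ^ 2 * ∑ i, ∑ j, w i * A p.1 i j * w j
            - lam * inner ℝ v (WithLp.toLp 2 w) ^ 2 := by
          rw [PiLp.inner_apply, sq (∑ i, _), Finset.sum_mul_sum,
            Finset.mul_sum, Finset.mul_sum, ← Finset.sum_sub_distrib]
          refine Finset.sum_congr rfl fun i _ => ?_
          rw [Finset.mul_sum, Finset.mul_sum, ← Finset.sum_sub_distrib]
          refine Finset.sum_congr rfl fun j _ => ?_
          simp only [hB, RCLike.inner_apply, conj_trivial]; ring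
        have h4 := abs_real_inner_le_norm v (WithLp.toLp 2 w)
        have h5 : inner ℝ v (WithLp.toLp 2 w) ^ 2 ≤ (‖v‖ * ‖WithLp.toLp 2 w‖) ^ 2 := by
          rw [← sq_abs]; gcongr
        rw [h3]
        have h6 := mul_le_mul_of_nonneg_left h2 (sq_nonneg ‖v‖)
        have h7 := mul_le_mul_of_nonneg_left h5 hlam.le
        simp only at h6
        nlinarith)
      (fun w => by
        have h2 := hq (WithLp.toLp 2 w)
        rw [← sHess_quadForm hu] at h2
        rw [hMv]
        simp only at h2
        linarith)
    have h2 : ∑ i, ∑ j, B i j * M j i = ‖v‖ ^ 2 * (Lop A u p + α * ∑ i, A p.1 i i)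
        - lam * ∑ i, ∑ j, v i * M i j * v j := by
      have h3 : Lop A u p + α * ∑ i, A p.1 i i = ∑ i, ∑ j, A p.1 i j * M j i := by
        rw [Lop, Finset.mul_sum, ← Finset.sum_add_distrib]
        refine Finset.sum_congr rfl fun i _ => ?_
        have h4 : α * A p.1 i i = ∑ j, A p.1 i j * (if j = i then α else 0) := by
          simp; ring
        rw [h4, ← Finset.sum_add_distrib]
        exact Finset.sum_congr rfl fun j _ => by simp only [hM]; split_ifs <;> ring
      rw [h3, Finset.sum_comm (f := fun i j => v i * M i j * v j), Finset.mul_sum, Finset.mul_sum,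
        ← Finset.sum_sub_distrib]
      refine Finset.sum_congr rfl fun i _ => ?_
      rw [Finset.mul_sum, Finset.mul_sum, ← Finset.sum_sub_distrib]
      exact Finset.sum_congr rfl fun j _ => by simp only [hB]; ring
    have h3 := hMv v
    have h4 := mul_le_mul_of_nonneg_left (hA.trace_le p.1) hα
    have h5 : ‖v‖ ^ 2 * (Lop A u p + α * ∑ i, A p.1 i i)
        ≤ ‖v‖ ^ 2 * (L + α * ((m + 1) * Lam)) := by gcongr
    have h6 : ‖WithLp.toLp 2 (v : Fin (m + 1) → ℝ)‖ = ‖v‖ := rfl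
    rw [h6] at h3
    rw [← h3]
    linarith
  filter_upwards [hu.eventually_second_difference hε] with v hv
  have h1 := key v
  rw [sHess_quadForm hu] at h1
  have h2 : fderiv ℝ (fderiv ℝ fun y => u (y, p.2)) p.1 v v + α * ‖v‖ ^ 2
      ≤ (L + α * ((m + 1) * Lam)) / lam * ‖v‖ ^ 2 := by
    rw [div_mul_eq_mul_div, le_div_iff₀ hlam]; linarith
  have h3 := (abs_le.1 hv).2
  have h4 : u (p.1 + v, p.2) + u (p.1 - v, p.2) - 2 * u (p.1, p.2)
      - fderiv ℝ (fderiv ℝ fun y => u (y, p.2)) p.1 v v ≤ ε * ‖v‖ ^ 2 := h3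
  have h5 : u (p.1, p.2) = u p := rfl
  rw [h5] at h4
  nlinarith

end TraceInequalities

section MinimumPrinciple
variable {m : ℕ} {lam Lam : ℝ} {A : Spc m → Matrix (Fin (m + 1)) (Fin (m + 1)) ℝ}
  {u : Spc m × ℝ → ℝ} {Ω : Set (Spc m × ℝ)}

theorem SolvesL.mono {D : Set (Spc m × ℝ)} (h : SolvesL A u Ω) (hD : D ⊆ Ω) : SolvesL A u D :=
  fun p hp => h p (hD hp)

/-- A closed space-time cylinder. -/
def boxCyl (x : Spc m) (R t₀ t₁ : ℝ) : Set (Spc m × ℝ) :=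
  Metric.closedBall x R ×ˢ Set.Icc t₀ t₁

theorem mem_boxCyl {x : Spc m} {R t₀ t₁ : ℝ} {p : Spc m × ℝ} :
    p ∈ boxCyl x R t₀ t₁ ↔ ‖p.1 - x‖ ≤ R ∧ t₀ ≤ p.2 ∧ p.2 ≤ t₁ := by
  simp [boxCyl, dist_eq_norm]

theorem isCompact_boxCyl (x : Spc m) (R t₀ t₁ : ℝ) : IsCompact (boxCyl x R t₀ t₁) :=
  (isCompact_closedBall x R).prod isCompact_Icc

theorem boxCyl_subset {x y : Spc m} {R R' t₀ t₁ s₀ s₁ : ℝ} (h : ‖x - y‖ + R ≤ R')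
    (h0 : s₀ ≤ t₀) (h1 : t₁ ≤ s₁) : boxCyl x R t₀ t₁ ⊆ boxCyl y R' s₀ s₁ := by
  intro p hp
  rw [mem_boxCyl] at hp ⊢
  have : ‖p.1 - y‖ ≤ ‖p.1 - x‖ + ‖x - y‖ := norm_sub_le_norm_sub_add_norm_sub _ _ _
  exact ⟨by linarith, by linarith, by linarith⟩

/-- A continuous nonnegative solution on `D`. -/
structure NonnegSol (A : Spc m → Matrix (Fin (m + 1)) (Fin (m + 1)) ℝ)
    (u : Spc m × ℝ → ℝ) (D : Set (Spc m × ℝ)) : Prop where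
  solves : SolvesL A u D
  cont : ContinuousOn u D
  nonneg : ∀ p ∈ D, 0 ≤ u p

theorem NonnegSol.mono {D : Set (Spc m × ℝ)} (h : NonnegSol A u Ω) (hD : D ⊆ Ω) :
    NonnegSol A u D :=
  ⟨h.solves.mono hD, h.cont.mono hD, fun p hp => h.nonneg p (hD hp)⟩

theorem HasDerivAt.le_of_eventually_le_left {f g : ℝ → ℝ} {a b t : ℝ} (hf : HasDerivAt f a t)
    (hg : HasDerivAt g b t) (hfg : f t = g t)
    (h : ∀ᶠ s in nhdsWithin t (Set.Iio t), g s ≤ f s) : a ≤ b := by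
  have hd := (hf.sub hg).hasDerivWithinAt (s := Set.Iio t)
  rw [hasDerivWithinAt_iff_tendsto_slope' (by simp)] at hd
  have : a - b ≤ 0 := by
    refine le_of_tendsto hd ?_
    filter_upwards [h, self_mem_nhdsWithin] with s hs hst
    rw [slope_def_field]
    have hst : s < t := hst
    refine div_nonpos_of_nonneg_of_nonpos ?_ (by linarith)
    simp only [Pi.sub_apply]
    linarith
  linarith

/-- Strict subsolutions lying below a solution on the parabolic boundary stay below it. -/
theorem SolvesL.le_of_strict_subsolution {x₀ : Spc m} {R t₀ t₁ : ℝ}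
    (hA : IsElliptic lam Lam A) (hlam : 0 < lam)
    (hu : SolvesL A u (boxCyl x₀ R t₀ t₁)) (hc : ContinuousOn u (boxCyl x₀ R t₀ t₁))
    {w : Spc m × ℝ → ℝ} (hw : ContinuousOn w (boxCyl x₀ R t₀ t₁))
    (hstart : ∀ x, ‖x - x₀‖ ≤ R → w (x, t₀) ≤ u (x, t₀))
    (hlat : ∀ x t, ‖x - x₀‖ = R → t₀ ≤ t → t ≤ t₁ → w (x, t) ≤ u (x, t))
    (hsub : ∀ x t, ‖x - x₀‖ < R → t₀ < t → t ≤ t₁ → u (x, t) < w (x, t) →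
      ∃ (α β ψ : ℝ) (e : Spc m), HasDerivAt (fun s => w (x, s)) ψ t ∧
        (∀ᶠ v in nhds (0 : Spc m), α * ‖v‖ ^ 2 + β * inner ℝ e v ^ 2
          ≤ w (x + v, t) + w (x - v, t) - 2 * w (x, t)) ∧
        ψ < α * ∑ i, A x i i + β * ∑ i, ∑ j, e i * A x i j * e j) :
    ∀ p ∈ boxCyl x₀ R t₀ t₁, w p ≤ u p := by
  intro p hp
  by_contra hlt
  push Not at hlt
  obtain ⟨z, hz, hmin⟩ := (isCompact_boxCyl x₀ R t₀ t₁).exists_isMinOn ⟨p, hp⟩ (hc.sub hw)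
  have hzneg : u z < w z := by
    have : u z - w z ≤ u p - w p := hmin hp
    linarith
  obtain ⟨x, t⟩ := z
  have hz' := mem_boxCyl.1 hz
  simp only at hz'
  have hx : ‖x - x₀‖ < R := by
    refine lt_of_le_of_ne hz'.1 fun h => ?_
    exact absurd (hlat x t h hz'.2.1 hz'.2.2) (not_le.2 hzneg)
  have ht : t₀ < t := by
    refine lt_of_le_of_ne hz'.2.1 fun h => ?_
    subst h
    exact absurd (hstart x hz'.1) (not_le.2 hzneg)
  obtain ⟨α, β, ψ, e, hψ, hsec, hcon⟩ := hsub x t hx ht hz'.2.2 hzneg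
  obtain ⟨h1, h2⟩ := hu (x, t) hz
  have hmin' : ∀ y s, ‖y - x₀‖ ≤ R → t₀ ≤ s → s ≤ t₁ →
      u (x, t) - w (x, t) ≤ u (y, s) - w (y, s) := fun y s a b c => by
    exact hmin (mem_boxCyl.2 (show ‖(y, s).1 - x₀‖ ≤ R ∧ _ from ⟨a, b, c⟩))
  have htime : Lop A u (x, t) ≤ ψ := by
    refine HasDerivAt.le_of_eventually_le_left (f := fun s => u (x, s))
      (g := fun s => w (x, s) + (u (x, t) - w (x, t))) h2 (hψ.add_const _) (by simp) ?_
    filter_upwards [Ioo_mem_nhdsLT ht] with s hs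
    have := hmin' x s hz'.1 hs.1.le (hs.2.le.trans hz'.2.2)
    linarith
  have hnear : ∀ᶠ v in nhds (0 : Spc m), ‖v‖ < R - ‖x - x₀‖ := by
    have := Metric.ball_mem_nhds (0 : Spc m) (sub_pos.2 hx)
    filter_upwards [this] with v hv
    simpa using hv
  have hspace := Lop_ge_of_eventually hA hlam (p := (x, t)) h1 (α := α) (β := β) (w := e)
    (fun ε hε => by
      filter_upwards [hsec, hnear] with v hv hvn
      have e1 : ‖x + v - x₀‖ ≤ R := by
        have : x + v - x₀ = (x - x₀) + v := by abel
        rw [this]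
        linarith [norm_add_le (x - x₀) v]
      have e2 : ‖x - v - x₀‖ ≤ R := by
        have : x - v - x₀ = (x - x₀) - v := by abel
        rw [this]
        linarith [norm_sub_le (x - x₀) v]
      have f1 := hmin' (x + v) t e1 hz'.2.1 hz'.2.2
      have f2 := hmin' (x - v) t e2 hz'.2.1 hz'.2.2
      have f3 : 0 ≤ ε * ‖v‖ ^ 2 := by positivity
      change _ ≤ u (x + v, t) + u (x - v, t) - 2 * u (x, t)
      linarith)
  simp only at hspace
  linarith

/-- Expansion of positivity: a lower bound on a ball propagates to a widening family of balls. -/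
theorem exists_expansion_of_positivity (m : ℕ) {lam : ℝ} (hlam : 0 < lam) (Lam : ℝ) {κ : ℝ}
    (hκ : 0 < κ) : ∃ q : ℕ, ∀ A : Spc m → Matrix (Fin (m + 1)) (Fin (m + 1)) ℝ,
      IsElliptic lam Lam A → ∀ (u : Spc m × ℝ → ℝ) (x₀ : Spc m) (R t₀ t₁ ρ c : ℝ),
      NonnegSol A u (boxCyl x₀ R t₀ t₁) → 0 < ρ → 0 ≤ R → t₀ ≤ t₁ → 0 ≤ c →
      ρ ^ 2 + κ * (t₁ - t₀) ≤ R ^ 2 → (∀ x, ‖x - x₀‖ ≤ ρ → c ≤ u (x, t₀)) →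
      ∀ x, ‖x - x₀‖ ^ 2 ≤ ρ ^ 2 + κ * (t₁ - t₀) →
        c * ρ ^ (2 * q) * (ρ ^ 2 + κ * (t₁ - t₀) - ‖x - x₀‖ ^ 2) ^ 2
          ≤ u (x, t₁) * (ρ ^ 2 + κ * (t₁ - t₀)) ^ q * ρ ^ 4 := by
  obtain ⟨q, hq⟩ := exists_nat_gt ((8 * lam + 4 * ((m + 1) * Lam) + 2 * κ) ^ 2 / (32 * lam * κ))
  rw [div_lt_iff₀ (by positivity)] at hq
  refine ⟨q, fun A hA u x₀ R t₀ t₁ ρ c hu hρ hR ht hc hRR hstart => ?_⟩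
  set s : ℝ → ℝ := fun t => ρ ^ 2 + κ * (t - t₀) with hs
  have hs0 : ∀ t, t₀ ≤ t → 0 < s t := fun t h => by
    have := mul_nonneg hκ.le (sub_nonneg.2 h)
    simp only [hs]; positivity
  set C := c * ρ ^ (2 * q) / ρ ^ 4 with hC
  have hC0 : 0 ≤ C := by positivity
  have hsc : Continuous s := by fun_prop
  set w : Spc m × ℝ → ℝ := fun p => C * max (s p.2 - ‖p.1 - x₀‖ ^ 2) 0 ^ 2 / s p.2 ^ q with hw
  have hmain : ∀ p ∈ boxCyl x₀ R t₀ t₁, w p ≤ u p := by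
    refine SolvesL.le_of_strict_subsolution hA hlam hu.solves hu.cont ?_ ?_ ?_ ?_
    · refine ContinuousOn.div (by fun_prop) (by fun_prop) fun p hp => ?_
      exact (pow_pos (hs0 _ (mem_boxCyl.1 hp).2.1) q).ne'
    · intro x hx
      have hst : s t₀ = ρ ^ 2 := by simp [hs]
      simp only [hw, hst]
      rcases le_or_gt ‖x - x₀‖ ρ with h | h
      · refine le_trans ?_ (hstart x h)
        rw [div_le_iff₀ (by positivity), hC, div_mul_eq_mul_div, div_le_iff₀ (by positivity),
          ← pow_mul]
        have h1 : max (ρ ^ 2 - ‖x - x₀‖ ^ 2) 0 ^ 2 ≤ ρ ^ 4 := by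
          have : max (ρ ^ 2 - ‖x - x₀‖ ^ 2) 0 ≤ ρ ^ 2 :=
            max_le (by linarith [sq_nonneg ‖x - x₀‖]) (by positivity)
          calc _ ≤ (ρ ^ 2) ^ 2 := by gcongr
            _ = ρ ^ 4 := by ring
        gcongr
      · have h1 : max (ρ ^ 2 - ‖x - x₀‖ ^ 2) 0 = 0 := by
          apply max_eq_right
          have : ρ ^ 2 ≤ ‖x - x₀‖ ^ 2 := by gcongr
          linarith
        rw [h1]
        simp only [ne_eq, OfNat.ofNat_ne_zero, not_false_eq_true, zero_pow, mul_zero, zero_div]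
        exact hu.nonneg _ (mem_boxCyl.2 ⟨hx, le_rfl, ht⟩)
    · intro x t hx h0 h1
      have h2 : max (s t - ‖x - x₀‖ ^ 2) 0 = 0 := by
        apply max_eq_right
        have : s t ≤ s t₁ := by simp only [hs]; gcongr
        have : s t₁ ≤ R ^ 2 := hRR
        rw [hx]; linarith
      simp only [hw, h2]
      simp only [ne_eq, OfNat.ofNat_ne_zero, not_false_eq_true, zero_pow, mul_zero, zero_div]
      exact hu.nonneg _ (mem_boxCyl.2 ⟨hx.le, h0, h1⟩)
    · intro x t hx h0 h1 hlt
      have hst := hs0 t h0.le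
      set S := s t with hS
      have hpos := (hu.nonneg _ (mem_boxCyl.2 (show ‖(x, t).1 - x₀‖ ≤ R ∧ _ from
        ⟨hx.le, h0.le, h1⟩))).trans_lt hlt
      have hg : 0 < S - ‖x - x₀‖ ^ 2 := by
        by_contra hn
        simp only [hw] at hpos
        rw [max_eq_right (not_lt.1 hn)] at hpos
        simp at hpos
      have hCpos : 0 < C := by
        refine lt_of_le_of_ne hC0 fun h => ?_
        simp only [hw, ← h] at hpos
        simp at hpos
      set g := S - ‖x - x₀‖ ^ 2 with hgdef
      have hsq : 0 < S ^ q := pow_pos hst q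
      refine ⟨-(4 * g * (C / S ^ q)), 8 * (C / S ^ q), C / S ^ q * (2 * g * κ - κ * q * g ^ 2 / S),
        x - x₀, ?_, ?_, ?_⟩
      · have hds : HasDerivAt s κ t := by
          have := ((((hasDerivAt_id t).sub_const t₀).const_mul κ).const_add (ρ ^ 2))
          exact this.congr_deriv (mul_one κ)
        have hd : HasDerivAt (fun τ => C * (s τ - ‖x - x₀‖ ^ 2) ^ 2 / s τ ^ q)
            (C / S ^ q * (2 * g * κ - κ * q * g ^ 2 / S)) t := by
          have h2 := (((hds.sub_const (‖x - x₀‖ ^ 2)).pow 2).const_mul C).div (hds.pow q)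
            (by simpa [← hS] using hsq.ne')
          refine h2.congr_deriv ?_
          simp only [Pi.pow_apply]
          rw [← hS, ← hgdef]
          rcases Nat.eq_zero_or_pos q with h3 | h3
          · subst h3; simp
          · have h4 : S ^ q = S ^ (q - 1) * S := by
              rw [← pow_succ, Nat.sub_add_cancel h3]
            rw [h4]
            have h5 : S ^ (q - 1) ≠ 0 := (pow_pos hst _).ne'
            field_simp
            push_cast
            ring
        refine hd.congr_of_eventuallyEq ?_
        have hev : ∀ᶠ τ in nhds t, 0 < s τ - ‖x - x₀‖ ^ 2 :=
          (hsc.sub continuous_const).continuousAt.eventually (lt_mem_nhds hg)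
        filter_upwards [hev] with τ hτ
        simp only [hw, max_eq_left hτ.le]
      · have hcp : Continuous fun v : Spc m => S - ‖x + v - x₀‖ ^ 2 := by fun_prop
        have hcm : Continuous fun v : Spc m => S - ‖x - v - x₀‖ ^ 2 := by fun_prop
        have hev1 : ∀ᶠ v in nhds (0 : Spc m), 0 < S - ‖x + v - x₀‖ ^ 2 :=
          hcp.continuousAt.eventually (lt_mem_nhds (by simpa [hgdef] using hg))
        have hev2 : ∀ᶠ v in nhds (0 : Spc m), 0 < S - ‖x - v - x₀‖ ^ 2 :=
          hcm.continuousAt.eventually (lt_mem_nhds (by simpa [hgdef] using hg))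
        filter_upwards [hev1, hev2] with v h2 h3
        simp only [hw]
        rw [← hS, max_eq_left h2.le, max_eq_left h3.le, max_eq_left hg.le]
        have e1 : ‖x + v - x₀‖ ^ 2 = ‖x - x₀‖ ^ 2 + 2 * inner ℝ (x - x₀) v + ‖v‖ ^ 2 := by
          rw [← norm_add_sq_real]; congr 2; abel
        have e2 : ‖x - v - x₀‖ ^ 2 = ‖x - x₀‖ ^ 2 - 2 * inner ℝ (x - x₀) v + ‖v‖ ^ 2 := by
          rw [← norm_sub_sq_real]; congr 2; abel
        rw [e1, e2]
        have e3 : ‖x - x₀‖ ^ 2 = S - g := by rw [hgdef]; ring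
        rw [e3]
        have e4 : C * (S - (S - g + 2 * inner ℝ (x - x₀) v + ‖v‖ ^ 2)) ^ 2 / S ^ q
            + C * (S - (S - g - 2 * inner ℝ (x - x₀) v + ‖v‖ ^ 2)) ^ 2 / S ^ q
            - 2 * (C * (g) ^ 2 / S ^ q) = -(4 * g * (C / S ^ q)) * ‖v‖ ^ 2
            + 8 * (C / S ^ q) * inner ℝ (x - x₀) v ^ 2 + 2 * (C / S ^ q) * ‖v‖ ^ 4 := by
          ring
        rw [e4]
        have : 0 ≤ 2 * (C / S ^ q) * ‖v‖ ^ 4 := by positivity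
        linarith
      · have hCS : 0 < C / S ^ q := by positivity
        have h2 := hA.trace_le x
        have h3 := (hA.2 x (x - x₀)).1
        have e3 : ‖x - x₀‖ ^ 2 = S - g := by rw [hgdef]; ring
        rw [e3] at h3
        set T := ∑ i, A x i i
        set Q := ∑ i, ∑ j, (x - x₀) i * A x i j * (x - x₀) j
        have key : 2 * g * κ - κ * q * g ^ 2 / S < -(4 * g) * T + 8 * Q := by
          have k1 : 2 * g * κ - κ * q * g ^ 2 / S
              < -(4 * g) * ((m + 1) * Lam) + 8 * (lam * (S - g)) := by
            rw [← sub_pos]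
            have : -(4 * g) * ((m + 1) * Lam) + 8 * (lam * (S - g))
                - (2 * g * κ - κ * q * g ^ 2 / S)
                = ((16 * lam * S - (8 * lam + 4 * ((m + 1) * Lam) + 2 * κ) * g) ^ 2
                  + (q * (32 * lam * κ) - (8 * lam + 4 * ((m + 1) * Lam) + 2 * κ) ^ 2) * g ^ 2)
                  / (32 * lam * S) := by
              field_simp
              ring
            rw [this]
            have h4 : 0 < (q * (32 * lam * κ) - (8 * lam + 4 * ((m + 1) * Lam) + 2 * κ) ^ 2)
              * g ^ 2 := mul_pos (sub_pos.2 hq) (by positivity)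
            positivity
          have k2 : (4 * g) * T ≤ (4 * g) * ((m + 1) * Lam) := by gcongr
          linarith
        calc _ < C / S ^ q * (-(4 * g) * T + 8 * Q) := by gcongr
          _ = _ := by ring
  intro x hx
  have hxR : ‖x - x₀‖ ≤ R := by
    refine abs_le_of_sq_le_sq' (hx.trans hRR) hR |>.2
  have h1 := hmain (x, t₁) (mem_boxCyl.2 ⟨hxR, ht, le_rfl⟩)
  simp only [hw] at h1
  have h2 : 0 ≤ s t₁ - ‖x - x₀‖ ^ 2 := sub_nonneg.2 hx
  rw [max_eq_left h2, div_le_iff₀ (pow_pos (hs0 _ ht) q), hC, div_mul_eq_mul_div,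
    div_le_iff₀ (by positivity)] at h1
  exact h1

end MinimumPrinciple

section Covering
open MeasureTheory
variable {m : ℕ}

/-- The closed two-sided parabolic cylinder of radius `ρ` centred at `z`. -/
def pCyl (z : Spc m × ℝ) (ρ : ℝ) : Set (Spc m × ℝ) :=
  boxCyl z.1 ρ (z.2 - ρ ^ 2) (z.2 + ρ ^ 2)

theorem mem_pCyl {z p : Spc m × ℝ} {ρ : ℝ} :
    p ∈ pCyl z ρ ↔ ‖p.1 - z.1‖ ≤ ρ ∧ |p.2 - z.2| ≤ ρ ^ 2 := by
  rw [pCyl, mem_boxCyl, abs_le]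
  constructor <;> rintro ⟨h1, h2, h3⟩ <;> refine ⟨h1, ?_, ?_⟩ <;> linarith

theorem volume_boxCyl (x : Spc m) {R : ℝ} (hR : 0 ≤ R) (t₀ t₁ : ℝ) :
    volume (boxCyl x R t₀ t₁)
      = ENNReal.ofReal (R ^ (m + 1) * (t₁ - t₀)) * volume (Metric.ball (0 : Spc m) 1) := by
  rw [boxCyl, Measure.volume_eq_prod, Measure.prod_prod, Real.volume_Icc,
    Measure.addHaar_closedBall _ _ hR, ENNReal.ofReal_mul (by positivity)]
  simp only [finrank_euclideanSpace, Fintype.card_fin]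
  ring

theorem volume_pCyl (z : Spc m × ℝ) {ρ : ℝ} (hρ : 0 ≤ ρ) :
    volume (pCyl z ρ)
      = ENNReal.ofReal (2 * ρ ^ (m + 3)) * volume (Metric.ball (0 : Spc m) 1) := by
  rw [pCyl, volume_boxCyl _ hρ]
  congr 2
  ring

theorem measurableSet_boxCyl (x : Spc m) (R t₀ t₁ : ℝ) : MeasurableSet (boxCyl x R t₀ t₁) :=
  (isCompact_boxCyl x R t₀ t₁).measurableSet

/-- A parabolic Vitali covering argument, phrased as a comparison of measures. -/
theorem measure_le_of_parabolic_vitali {ι X : Type*} [MeasurableSpace X] (ν : Measure X)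
    {t : Set ι} {z : ι → Spc m × ℝ} {ρ : ι → ℝ} {Rmax : ℝ} {B : ι → Set (Spc m × ℝ)}
    (hρ : ∀ a ∈ t, 0 < ρ a) (hρ' : ∀ a ∈ t, ρ a ≤ Rmax)
    (hB : ∀ a ∈ t, B a ⊆ pCyl (z a) (ρ a)) (hint : ∀ a ∈ t, (interior (B a)).Nonempty)
    {G : Set (Spc m × ℝ)} (hG : ∀ a ∈ t, MeasurableSet (B a ∩ G)) {S : ι → Set X} {C : ENNReal}
    (hS : ∀ a ∈ t, ν (S a) ≤ C * volume (B a ∩ G)) {E : Set X}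
    (hE : ∀ e ∈ E, ∃ a ∈ t, ∀ b ∈ t, z a ∈ pCyl (z b) (3 * ρ b) → e ∈ S b) :
    ν E ≤ C * volume G := by
  obtain ⟨v, hvt, hdisj, hcov⟩ := Vitali.exists_disjoint_subfamily_covering_enlargement B t ρ 2
    (by norm_num) (fun a ha => (hρ a ha).le) Rmax hρ'
    (fun a ha => (hint a ha).mono interior_subset)
  have hcount : v.Countable :=
    hdisj.countable_of_nonempty_interior fun a ha => hint a (hvt ha)
  have hsub : E ⊆ ⋃ b ∈ v, S b := by
    intro e he
    obtain ⟨a, ha, hab⟩ := hE e he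
    obtain ⟨b, hb, ⟨p, hpa, hpb⟩, hle⟩ := hcov a ha
    refine Set.mem_iUnion₂.2 ⟨b, hb, hab b (hvt hb) ?_⟩
    have h1 := mem_pCyl.1 (hB a ha hpa)
    have h2 := mem_pCyl.1 (hB b (hvt hb) hpb)
    have h3 := hρ a ha
    refine mem_pCyl.2 ⟨?_, ?_⟩
    · have : ‖(z a).1 - (z b).1‖ ≤ ‖(z a).1 - p.1‖ + ‖p.1 - (z b).1‖ :=
        norm_sub_le_norm_sub_add_norm_sub _ _ _
      rw [norm_sub_rev] at h1
      linarith [h1.1, h2.1]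
    · have h4 := abs_le.1 h1.2
      have h5 := abs_le.1 h2.2
      have : ρ a ^ 2 ≤ (2 * ρ b) ^ 2 := by gcongr
      rw [abs_le]
      constructor <;> nlinarith
  calc ν E ≤ ν (⋃ b ∈ v, S b) := measure_mono hsub
    _ ≤ ∑' b : v, ν (S b) := measure_biUnion_le _ hcount _
    _ ≤ ∑' b : v, C * volume (B b ∩ G) := ENNReal.tsum_le_tsum fun b => hS b (hvt b.2)
    _ = C * ∑' b : v, volume (B b ∩ G) := ENNReal.tsum_mul_left
    _ = C * volume (⋃ b ∈ v, B b ∩ G) := by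
      rw [measure_biUnion hcount (hdisj.mono fun _ => Set.inter_subset_left)
        fun b hb => hG b (hvt hb)]
    _ ≤ C * volume G := by
      gcongr
      exact Set.iUnion₂_subset fun b _ => Set.inter_subset_right

end Covering

section Contact
open MeasureTheory
variable {m : ℕ} {lam Lam : ℝ} {A : Spc m → Matrix (Fin (m + 1)) (Fin (m + 1)) ℝ}
  {u : Spc m × ℝ → ℝ}

/-- The family of paraboloids sliding upwards in time. -/
def parab (b p : Spc m × ℝ) : ℝ := b.2 + 8 * inner ℝ p.1 b.1 - 4 * ‖p.1‖ ^ 2 + 4 * p.2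

/-- `z` is a first contact point of the paraboloid `parab b` with `u` in the unit cylinder. -/
def IsContact (u : Spc m × ℝ → ℝ) (b z : Spc m × ℝ) : Prop :=
  ‖z.1‖ < 1 ∧ -1 < z.2 ∧ z.2 ≤ 0 ∧ u z = parab b z ∧
    ∀ x t, ‖x‖ ≤ 1 → -1 ≤ t → t ≤ z.2 → parab b (x, t) ≤ u (x, t)

theorem parab_le {b p : Spc m × ℝ} (hb : ‖b.1‖ ≤ 1 / 8) (hb2 : b.2 ≤ 2) :
    parab b p ≤ 2 + ‖p.1‖ - 4 * ‖p.1‖ ^ 2 + 4 * p.2 := by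
  have h1 := real_inner_le_norm p.1 b.1
  have h2 : ‖p.1‖ * ‖b.1‖ ≤ ‖p.1‖ * (1 / 8) := by gcongr
  simp only [parab]
  linarith

theorem continuous_parab (b : Spc m × ℝ) : Continuous (parab b) := by
  unfold parab; fun_prop

theorem exists_isContact (hc : ContinuousOn u (boxCyl 0 1 (-1) 0))
    (h0 : ∀ p ∈ boxCyl (0 : Spc m) 1 (-1) 0, 0 ≤ u p) (hu : u (0, 0) ≤ 1) {b : Spc m × ℝ}
    (hb : ‖b.1‖ ≤ 1 / 8) (hb1 : 1 < b.2) (hb2 : b.2 ≤ 2) : ∃ z, IsContact u b z := by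
  set D := boxCyl (0 : Spc m) 1 (-1) 0 with hD
  have hmem : ∀ p : Spc m × ℝ, p ∈ D ↔ ‖p.1‖ ≤ 1 ∧ -1 ≤ p.2 ∧ p.2 ≤ 0 := fun p => by
    rw [hD, mem_boxCyl, sub_zero]
  have hcl : IsCompact (D ∩ (fun p => u p - parab b p) ⁻¹' Set.Iic 0) :=
    (isCompact_boxCyl _ _ _ _).of_isClosed_subset
      ((hc.sub (continuous_parab b).continuousOn).preimage_isClosed_of_isClosed
        (isCompact_boxCyl _ _ _ _).isClosed isClosed_Iic) Set.inter_subset_left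
  have hne : (D ∩ (fun p => u p - parab b p) ⁻¹' Set.Iic 0).Nonempty := by
    refine ⟨(0, 0), (hmem _).2 (by simp), ?_⟩
    simp only [Set.mem_preimage, Set.mem_Iic, parab]
    simp
    linarith
  obtain ⟨z, ⟨hzD, hz⟩, hzmin⟩ := hcl.exists_isMinOn hne (continuous_snd.continuousOn)
  simp only [Set.mem_preimage, Set.mem_Iic, sub_nonpos] at hz
  have hz' := (hmem z).1 hzD
  have hpos : 0 ≤ parab b z := (h0 z hzD).trans hz
  have hle := parab_le (p := z) hb hb2
  have hzn : ‖z.1‖ < 1 := by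
    refine lt_of_le_of_ne hz'.1 fun h => ?_
    rw [h] at hle
    linarith [hz'.2.2]
  have hzt : -1 < z.2 := by
    refine lt_of_le_of_ne hz'.2.1 fun h => ?_
    rw [← h] at hle
    nlinarith [sq_nonneg (‖z.1‖ - 1 / 8)]
  have hbefore : ∀ x t, ‖x‖ ≤ 1 → -1 ≤ t → t < z.2 → parab b (x, t) ≤ u (x, t) := by
    intro x t hx ht htz
    by_contra hn
    push Not at hn
    have : z.2 ≤ t := hzmin (show (x, t) ∈ D ∩ _ from
      ⟨(hmem _).2 ⟨hx, ht, htz.le.trans hz'.2.2⟩, by simpa using hn.le⟩)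
    linarith
  have hall : ∀ x t, ‖x‖ ≤ 1 → -1 ≤ t → t ≤ z.2 → parab b (x, t) ≤ u (x, t) := by
    intro x t hx ht htz
    rcases htz.lt_or_eq with h | h
    · exact hbefore x t hx ht h
    · subst h
      have hcu : ContinuousWithinAt (fun s => u (x, s)) (Set.Ico (-1) z.2) z.2 := by
        have h1 := hc (x, z.2) ((hmem _).2 ⟨hx, ht, hz'.2.2⟩)
        refine h1.comp (f := fun s : ℝ => (x, s)) (by fun_prop) fun s hs => ?_
        exact (hmem _).2 ⟨hx, hs.1, hs.2.le.trans hz'.2.2⟩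
      have hcp : ContinuousWithinAt (fun s => parab b (x, s)) (Set.Ico (-1) z.2) z.2 :=
        ((continuous_parab b).comp (by fun_prop : Continuous fun s : ℝ => (x, s)))
          |>.continuousWithinAt
      have : (nhdsWithin z.2 (Set.Ico (-1) z.2)).NeBot := by
        rw [← mem_closure_iff_nhdsWithin_neBot, closure_Ico hzt.ne]
        exact ⟨hzt.le, le_rfl⟩
      refine le_of_tendsto_of_tendsto hcp hcu ?_
      filter_upwards [self_mem_nhdsWithin] with s hs
      exact hbefore x s hx hs.1 hs.2
  exact ⟨z, hzn, hzt, hz'.2.2, le_antisymm hz (hall z.1 z.2 hz'.1 hz'.2.1 le_rfl), hall⟩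

theorem parab_second_difference (b : Spc m × ℝ) (x v : Spc m) (t : ℝ) :
    parab b (x + v, t) + parab b (x - v, t) - 2 * parab b (x, t) = -8 * ‖v‖ ^ 2 := by
  simp only [parab, inner_add_left, inner_sub_left, norm_add_sq_real, norm_sub_sq_real]
  ring

theorem IsContact.upper_bound (hA : IsElliptic lam Lam A) (hlam : 0 < lam)
    (hs : SolvesL A u (boxCyl 0 1 (-1) 0)) {b z : Spc m × ℝ} (hz : IsContact u b z) :
    ∃ ρ > 0, ∀ v : Spc m, ‖v‖ ≤ ρ → ‖z.1 + v‖ ≤ 1 ∧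
      u (z.1 + v, z.2) ≤ parab b (z.1 + v, z.2)
        + ((4 + 8 * ((m + 1) * Lam)) / lam + 1) * ‖v‖ ^ 2 := by
  obtain ⟨h1, h2, h3, h4, h5⟩ := hz
  obtain ⟨c1, c2⟩ := hs z (mem_boxCyl.2 ⟨by simpa using h1.le, h2.le, h3⟩)
  have hL : Lop A u z ≤ 4 := by
    have hd : HasDerivAt (fun s => parab b (z.1, s)) 4 z.2 := by
      have := ((hasDerivAt_id z.2).const_mul (4 : ℝ)).const_add
        (b.2 + 8 * inner ℝ z.1 b.1 - 4 * ‖z.1‖ ^ 2)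
      simpa [parab] using this
    refine HasDerivAt.le_of_eventually_le_left c2 hd h4 ?_
    filter_upwards [Ioo_mem_nhdsLT h2] with s hs
    exact h5 _ _ h1.le hs.1.le hs.2.le
  have hnear : ∀ᶠ v in nhds (0 : Spc m), ‖v‖ < 1 - ‖z.1‖ := by
    filter_upwards [Metric.ball_mem_nhds (0 : Spc m) (sub_pos.2 h1)] with v hv
    simpa using hv
  have hin : ∀ᶠ v in nhds (0 : Spc m), ‖z.1 + v‖ ≤ 1 ∧ ‖z.1 - v‖ ≤ 1 := by
    filter_upwards [hnear] with v hv
    exact ⟨by linarith [norm_add_le z.1 v], by linarith [norm_sub_le z.1 v]⟩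
  have hupper := second_difference_le_of_touched hA hlam c1 (by norm_num : (0 : ℝ) ≤ 8)
    (by
      filter_upwards [hin] with v hv
      have e := parab_second_difference b z.1 v z.2
      have f1 := h5 _ _ hv.1 h2.le le_rfl
      have f2 := h5 _ _ hv.2 h2.le le_rfl
      have : parab b (z.1, z.2) = u z := h4.symm
      linarith) hL one_pos
  obtain ⟨r, hr, hball⟩ := Metric.eventually_nhds_iff.1 (hupper.and hin)
  refine ⟨r / 2, half_pos hr, fun v hv => ?_⟩
  obtain ⟨g1, g2, g3⟩ := @hball v (by rw [dist_zero_right]; linarith)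
  refine ⟨g2, ?_⟩
  have e := parab_second_difference b z.1 v z.2
  have f2 := h5 _ _ g3 h2.le le_rfl
  have : parab b (z.1, z.2) = u z := h4.symm
  nlinarith

theorem IsContact.forward_bound (hA : IsElliptic lam Lam A) (hlam : 0 < lam)
    (hu : NonnegSol A u (boxCyl 0 1 (-1) 0)) {b z : Spc m × ℝ} (hb : ‖b.1‖ ≤ 1 / 8)
    (hb2 : b.2 ≤ 2) (hz : IsContact u b z) {x : Spc m} {t : ℝ} (hx : ‖x‖ ≤ 1) (hzt : z.2 ≤ t)
    (ht : t ≤ 0) : parab b (x, z.2) - (8 * ((m + 1) * Lam) + 1) * (t - z.2) ≤ u (x, t) := by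
  obtain ⟨h1, h2, h3, h4, h5⟩ := hz
  have hLam : 0 ≤ (m + 1) * Lam := (hA.trace_nonneg hlam 0).trans (hA.trace_le 0)
  have hu' := hu.mono (boxCyl_subset (x := 0) (y := 0) (R := 1) (by simp) h2.le le_rfl)
  have := SolvesL.le_of_strict_subsolution hA hlam hu'.solves hu'.cont
    (w := fun p => parab b (p.1, z.2) - (8 * ((m + 1) * Lam) + 1) * (p.2 - z.2))
    (by unfold parab; fun_prop)
    (fun x hx => by simpa using h5 x z.2 (by simpa using hx) h2.le le_rfl)
    (fun x s hx hs hs' => by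
      refine le_trans ?_ (hu'.nonneg _ (mem_boxCyl.2 (show ‖(x, s).1 - 0‖ ≤ 1 ∧ _ from
        ⟨hx.le, hs, hs'⟩)))
      have := parab_le (p := (x, z.2)) hb hb2
      rw [sub_zero] at hx
      simp only at this ⊢
      rw [hx] at this
      have : 0 ≤ (8 * ((m + 1) * Lam) + 1) * (s - z.2) :=
        mul_nonneg (by positivity) (by linarith)
      linarith)
    (fun x s hx hs hs' _ => by
      refine ⟨-8, 0, -(8 * ((m + 1) * Lam) + 1), 0, ?_, ?_, ?_⟩
      · have := (((hasDerivAt_id s).sub_const z.2).const_mul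
          (8 * ((m + 1) * Lam) + 1)).const_sub (parab b (x, z.2))
        simpa using this
      · refine Filter.Eventually.of_forall fun v => ?_
        have := parab_second_difference b x v z.2
        simp only
        linarith
      · have := hA.trace_le x
        simp only [zero_mul, add_zero]
        linarith)
    (x, t) (mem_boxCyl.2 ⟨by simpa using hx, hzt, ht⟩)
  simpa using this

theorem IsContact.param_close_of_le (hA : IsElliptic lam Lam A) (hlam : 0 < lam)
    (hu : NonnegSol A u (boxCyl 0 1 (-1) 0)) {b₀ b₁ z₀ z₁ : Spc m × ℝ} (hb : ‖b₀.1‖ ≤ 1 / 8)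
    (hb2 : b₀.2 ≤ 2) (hz₀ : IsContact u b₀ z₀) (hz₁ : IsContact u b₁ z₁) {C₁ ρ : ℝ}
    (hC₁ : 0 ≤ C₁) (hρ : 0 < ρ)
    (hup : ∀ v : Spc m, ‖v‖ ≤ 2 * ρ → ‖z₀.1 + v‖ ≤ 1 ∧
      u (z₀.1 + v, z₀.2) ≤ parab b₀ (z₀.1 + v, z₀.2) + C₁ * ‖v‖ ^ 2)
    (hle : z₀.2 ≤ z₁.2) (hx : ‖z₁.1 - z₀.1‖ ≤ ρ) (ht : z₁.2 - z₀.2 ≤ ρ ^ 2) {C₂ : ℝ}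
    (hC₂ : C₂ = 8 * ((m + 1) * Lam) + 5) :
    8 * ‖b₁.1 - b₀.1‖ ≤ (4 * C₁ + C₂) * ρ ∧
      |b₁.2 - b₀.2 + 8 * inner ℝ z₀.1 (b₁.1 - b₀.1)| ≤ (5 * C₁ + 2 * C₂) * ρ ^ 2 ∧
      |b₁.2 - b₀.2 + 8 * inner ℝ z₁.1 (b₁.1 - b₀.1)| ≤ (5 * C₁ + 2 * C₂) * ρ ^ 2 := by
  have hLam : 0 ≤ (m + 1) * Lam := (hA.trace_nonneg hlam 0).trans (hA.trace_le 0)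
  have hC₂0 : 0 ≤ C₂ := by rw [hC₂]; positivity
  set d := b₁.1 - b₀.1 with hd
  set l : Spc m → ℝ := fun x => b₁.2 - b₀.2 + 8 * inner ℝ x d with hl
  have hdiff : ∀ x t, parab b₁ (x, t) - parab b₀ (x, t) = l x := fun x t => by
    simp only [parab, hl, hd, inner_sub_right]; ring
  have hlow : -(C₂ * ρ ^ 2) ≤ l z₁.1 := by
    have h1 := hz₀.forward_bound hA hlam hu hb hb2 hz₁.1.le hle hz₁.2.2.1
    have h2 : u (z₁.1, z₁.2) = parab b₁ (z₁.1, z₁.2) := hz₁.2.2.2.1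
    have h3 := hdiff z₁.1 z₁.2
    have h4 : parab b₀ (z₁.1, z₁.2) = parab b₀ (z₁.1, z₀.2) + 4 * (z₁.2 - z₀.2) := by
      simp only [parab]; ring
    have h5 : C₂ * (z₁.2 - z₀.2) ≤ C₂ * ρ ^ 2 := by gcongr
    rw [hC₂] at h5 ⊢
    nlinarith
  have hupp : ∀ v : Spc m, ‖v‖ ≤ 2 * ρ → l (z₀.1 + v) ≤ C₁ * ‖v‖ ^ 2 := by
    intro v hv
    obtain ⟨g1, g2⟩ := hup v hv
    have := hz₁.2.2.2.2 _ _ g1 hz₀.2.1.le hle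
    rw [← hdiff _ z₀.2]
    linarith
  have h1 : l z₁.1 ≤ C₁ * ρ ^ 2 := by
    have := hupp (z₁.1 - z₀.1) (by linarith)
    rw [add_sub_cancel] at this
    refine this.trans ?_
    gcongr
  have h0 : l z₀.1 ≤ 0 := by simpa using hupp 0 (by simp; linarith)
  have hdle : 8 * ‖d‖ ≤ (4 * C₁ + C₂) * ρ := by
    rcases eq_or_ne d 0 with h | h
    · rw [h]; simp; positivity
    · have hdn : 0 < ‖d‖ := norm_pos_iff.2 h
      set e := (ρ / ‖d‖) • d with he
      have hen : ‖e‖ = ρ := by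
        rw [he, norm_smul, Real.norm_eq_abs, abs_of_pos (by positivity)]; field_simp
      have hv : ‖z₁.1 - z₀.1 + e‖ ≤ 2 * ρ := by
        linarith [norm_add_le (z₁.1 - z₀.1) e]
      have h2 := hupp _ hv
      have h3 : z₀.1 + (z₁.1 - z₀.1 + e) = z₁.1 + e := by abel
      rw [h3] at h2
      have h4 : l (z₁.1 + e) = l z₁.1 + 8 * ρ * ‖d‖ := by
        simp only [hl, inner_add_left, he, real_inner_smul_left, real_inner_self_eq_norm_sq]
        field_simp
        ring
      have h5 : C₁ * ‖z₁.1 - z₀.1 + e‖ ^ 2 ≤ C₁ * (2 * ρ) ^ 2 := by gcongr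
      have h6 : ρ * (8 * ‖d‖) ≤ ρ * ((4 * C₁ + C₂) * ρ) := by nlinarith
      exact le_of_mul_le_mul_left h6 hρ
  have hlz : l z₁.1 - 8 * (ρ * ‖d‖) ≤ l z₀.1 := by
    have h2 : l z₁.1 - l z₀.1 = 8 * inner ℝ (z₁.1 - z₀.1) d := by
      simp only [hl, inner_sub_left]; ring
    have h3 := real_inner_le_norm (z₁.1 - z₀.1) d
    have h4 : ‖z₁.1 - z₀.1‖ * ‖d‖ ≤ ρ * ‖d‖ := by gcongr
    linarith
  have h7 : ρ * (8 * ‖d‖) ≤ ρ * ((4 * C₁ + C₂) * ρ) := by gcongr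
  have h8 : 0 ≤ C₁ * ρ ^ 2 := by positivity
  have h9 : 0 ≤ C₂ * ρ ^ 2 := by positivity
  refine ⟨hdle, abs_le.2 ⟨?_, ?_⟩, abs_le.2 ⟨?_, ?_⟩⟩
  · change _ ≤ l z₀.1; nlinarith
  · change l z₀.1 ≤ _; nlinarith
  · change _ ≤ l z₁.1; nlinarith
  · change l z₁.1 ≤ _; nlinarith

end Contact

section ContactMeasure
open MeasureTheory
variable {m : ℕ} {lam Lam : ℝ} {A : Spc m → Matrix (Fin (m + 1)) (Fin (m + 1)) ℝ}
  {u : Spc m × ℝ → ℝ}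

theorem pCyl_mem_nhds (z : Spc m × ℝ) {ρ : ℝ} (hρ : 0 < ρ) : pCyl z ρ ∈ nhds z := by
  have h1 : Metric.closedBall z.1 ρ ∈ nhds z.1 := Metric.closedBall_mem_nhds _ hρ
  have h2 : Set.Icc (z.2 - ρ ^ 2) (z.2 + ρ ^ 2) ∈ nhds z.2 := by
    have : 0 < ρ ^ 2 := by positivity
    exact Icc_mem_nhds (by linarith) (by linarith)
  exact prod_mem_nhds h1 h2

theorem exists_pCyl_subset {O : Set (Spc m × ℝ)} {z : Spc m × ℝ} (hO : O ∈ nhds z)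
    {ε : ℝ} (hε : 0 < ε) : ∃ ρ, 0 < ρ ∧ ρ ≤ ε ∧ pCyl z ρ ⊆ O := by
  obtain ⟨δ, hδ, hball⟩ := Metric.mem_nhds_iff.1 hO
  have h3 : min (min ε 1) (δ / 2) ≤ 1 := (min_le_left _ _).trans (min_le_right _ _)
  have h4 : min (min ε 1) (δ / 2) ≤ δ / 2 := min_le_right _ _
  have h0 : 0 < min (min ε 1) (δ / 2) := by positivity
  refine ⟨min (min ε 1) (δ / 2), h0, (min_le_left _ _).trans (min_le_left _ _), fun p hp => ?_⟩
  obtain ⟨h1, h2⟩ := mem_pCyl.1 hp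
  apply hball
  rw [Metric.mem_ball, Prod.dist_eq, max_lt_iff, dist_eq_norm, Real.dist_eq]
  exact ⟨by linarith, by nlinarith⟩

theorem IsContact.param_close (hA : IsElliptic lam Lam A) (hlam : 0 < lam)
    (hu : NonnegSol A u (boxCyl 0 1 (-1) 0)) {b b' z z' : Spc m × ℝ} (hb : ‖b.1‖ ≤ 1 / 8)
    (hb2 : b.2 ≤ 2) (hb' : ‖b'.1‖ ≤ 1 / 8) (hb2' : b'.2 ≤ 2)
    (hz : IsContact u b z) (hz' : IsContact u b' z') {C₁ ρ : ℝ} (hC₁ : 0 ≤ C₁) (hρ : 0 < ρ)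
    (hup : ∀ v : Spc m, ‖v‖ ≤ 2 * ρ → ‖z.1 + v‖ ≤ 1 ∧
      u (z.1 + v, z.2) ≤ parab b (z.1 + v, z.2) + C₁ * ‖v‖ ^ 2)
    (hup' : ∀ v : Spc m, ‖v‖ ≤ 2 * ρ → ‖z'.1 + v‖ ≤ 1 ∧
      u (z'.1 + v, z'.2) ≤ parab b' (z'.1 + v, z'.2) + C₁ * ‖v‖ ^ 2)
    (hzz : z' ∈ pCyl z ρ) {C₂ : ℝ} (hC₂ : C₂ = 8 * ((m + 1) * Lam) + 5) :
    8 * ‖b'.1 - b.1‖ ≤ (4 * C₁ + C₂) * ρ ∧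
      |b'.2 - b.2 + 8 * inner ℝ z.1 (b'.1 - b.1)| ≤ (5 * C₁ + 2 * C₂) * ρ ^ 2 := by
  obtain ⟨hx, ht⟩ := mem_pCyl.1 hzz
  rw [abs_le] at ht
  rcases le_total z.2 z'.2 with h | h
  · have := hz.param_close_of_le hA hlam hu hb hb2 hz' hC₁ hρ hup h hx ht.2 hC₂
    exact ⟨this.1, this.2.1⟩
  · have := hz'.param_close_of_le hA hlam hu hb' hb2' hz hC₁ hρ hup' h
      (by rwa [norm_sub_rev]) (by linarith) hC₂
    refine ⟨by rw [norm_sub_rev]; exact this.1, ?_⟩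
    rw [← abs_neg]
    refine le_trans (le_of_eq ?_) this.2.2
    congr 1
    simp only [inner_sub_right]
    ring

theorem volume_slab_le (y x : Spc m) (s : ℝ) {r h : ℝ} (hr : 0 ≤ r) :
    volume {b : Spc m × ℝ | ‖b.1 - y‖ ≤ r ∧ |b.2 - s + 8 * inner ℝ x (b.1 - y)| ≤ h}
      ≤ ENNReal.ofReal (r ^ (m + 1) * (2 * h)) * volume (Metric.ball (0 : Spc m) 1) := by
  have hcl : IsClosed {b : Spc m × ℝ | ‖b.1 - y‖ ≤ r ∧ |b.2 - s + 8 * inner ℝ x (b.1 - y)| ≤ h} :=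
    (isClosed_le (f := fun b : Spc m × ℝ => ‖b.1 - y‖) (by fun_prop) continuous_const).and
      (isClosed_le (f := fun b : Spc m × ℝ => |b.2 - s + 8 * inner ℝ x (b.1 - y)|) (by fun_prop)
        continuous_const)
  rw [Measure.volume_eq_prod, Measure.prod_apply hcl.measurableSet]
  calc _ ≤ ∫⁻ b : Spc m, (Metric.closedBall y r).indicator (fun _ => ENNReal.ofReal (2 * h)) b := by
        refine lintegral_mono fun b => ?_
        by_cases hb : b ∈ Metric.closedBall y r
        · rw [Set.indicator_of_mem hb]
          have : Prod.mk b ⁻¹' {b : Spc m × ℝ | ‖b.1 - y‖ ≤ r ∧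
              |b.2 - s + 8 * inner ℝ x (b.1 - y)| ≤ h}
              ⊆ Set.Icc (s - 8 * inner ℝ x (b - y) - h) (s - 8 * inner ℝ x (b - y) + h) := by
            rintro σ ⟨-, h2⟩
            have := abs_le.1 h2
            simp only at this
            exact ⟨by linarith, by linarith⟩
          refine (measure_mono this).trans (le_of_eq ?_)
          rw [Real.volume_Icc]
          congr 1; ring
        · rw [Set.indicator_of_notMem hb]
          have : Prod.mk b ⁻¹' {b : Spc m × ℝ | ‖b.1 - y‖ ≤ r ∧
              |b.2 - s + 8 * inner ℝ x (b.1 - y)| ≤ h} = ∅ := by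
            refine Set.eq_empty_of_forall_notMem fun σ hσ => hb ?_
            rw [Metric.mem_closedBall, dist_eq_norm]
            exact hσ.1
          rw [this, measure_empty]
    _ = _ := by
        rw [lintegral_indicator Metric.isClosed_closedBall.measurableSet, setLIntegral_const,
          Measure.addHaar_closedBall _ _ hr, finrank_euclideanSpace, Fintype.card_fin,
          ENNReal.ofReal_mul (p := r ^ (m + 1)) (by positivity)]
        ring

/-- A nonnegative solution that is small at the top of the unit cylinder is bounded on a set of
universally positive measure. -/
theorem exists_measure_le_of_le_one_unit (m : ℕ) {lam : ℝ} (hlam : 0 < lam) (Lam : ℝ) :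
    ∃ μ : ℝ, 0 < μ ∧ ∀ A : Spc m → Matrix (Fin (m + 1)) (Fin (m + 1)) ℝ, IsElliptic lam Lam A →
      ∀ u : Spc m × ℝ → ℝ, NonnegSol A u (boxCyl 0 1 (-1) 0) → u (0, 0) ≤ 1 →
      ENNReal.ofReal μ * volume (Metric.ball (0 : Spc m) 1)
        ≤ volume (boxCyl 0 1 (-1) 0 ∩ {p | u p ≤ 3}) := by
  by_cases hLam : 0 ≤ (m + 1) * Lam
  swap
  · exact ⟨1, one_pos, fun A hA => absurd ((hA.trace_nonneg hlam 0).trans (hA.trace_le 0)) hLam⟩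
  set C₁ := (4 + 8 * ((m + 1) * Lam)) / lam + 1 with hC₁
  set C₂ := 8 * ((m + 1) * Lam) + 5 with hC₂
  have hC₁0 : 0 < C₁ := by positivity
  have hC₂0 : 0 < C₂ := by positivity
  set c₁ := (4 * C₁ + C₂) / 8 with hc₁
  set c₂ := 5 * C₁ + 2 * C₂ with hc₂
  set C₅ := (3 * c₁) ^ (m + 1) * (9 * c₂) with hC₅
  have hC₅0 : 0 < C₅ := by positivity
  refine ⟨(1 / 8) ^ (m + 1) / C₅, by positivity, fun A hA u hu hu0 => ?_⟩
  set F := boxCyl (0 : Spc m) 1 (-1) 0 ∩ {p | u p ≤ 3} with hF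
  set ω := volume (Metric.ball (0 : Spc m) 1) with hω
  set Q : Set (Spc m × ℝ) := Metric.ball 0 (1 / 8) ×ˢ Set.Ioo 1 2 with hQ
  have hQmem : ∀ b ∈ Q, ‖b.1‖ ≤ 1 / 8 ∧ 1 < b.2 ∧ b.2 ≤ 2 := fun b hb => by
    rw [hQ, Set.mem_prod, mem_ball_zero_iff] at hb
    exact ⟨hb.1.le, hb.2.1, hb.2.2.le⟩
  have hex : ∀ b ∈ Q, ∃ (z : Spc m × ℝ) (ρ : ℝ), IsContact u b z ∧ 0 < ρ ∧
      ∀ v : Spc m, ‖v‖ ≤ ρ → ‖z.1 + v‖ ≤ 1 ∧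
        u (z.1 + v, z.2) ≤ parab b (z.1 + v, z.2) + C₁ * ‖v‖ ^ 2 := by
    intro b hb
    obtain ⟨h1, h2, h3⟩ := hQmem b hb
    obtain ⟨z, hz⟩ := exists_isContact hu.cont hu.nonneg hu0 h1 h2 h3
    obtain ⟨ρ, hρ, hv⟩ := hz.upper_bound hA hlam hu.solves
    exact ⟨z, ρ, hz, hρ, hv⟩
  choose! z ρ₁ hz hρ₁ hup using hex
  have hzF : ∀ b ∈ Q, z b ∈ F := fun b hb => by
    obtain ⟨h1, h2, h3, h4, -⟩ := hz b hb
    refine ⟨mem_boxCyl.2 ⟨by simpa using h1.le, h2.le, h3⟩, ?_⟩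
    have := parab_le (p := z b) (hQmem b hb).1 (hQmem b hb).2.2
    change u (z b) ≤ 3
    rw [h4]
    nlinarith [sq_nonneg (‖(z b).1‖ - 1 / 8)]
  set Qk : ℕ → Set (Spc m × ℝ) := fun k => {b | b ∈ Q ∧ 1 / ((k : ℝ) + 1) ≤ ρ₁ b} with hQk
  have hmono : Monotone Qk := fun k l hkl b hb => by
    refine ⟨hb.1, le_trans ?_ hb.2⟩
    have : (k : ℝ) ≤ l := by exact_mod_cast hkl
    gcongr
  have hunion : Q = ⋃ k, Qk k := by
    ext b
    simp only [hQk, Set.mem_iUnion]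
    refine ⟨fun hb => ?_, fun ⟨k, hk⟩ => hk.1⟩
    obtain ⟨k, hk⟩ := exists_nat_one_div_lt (hρ₁ b hb)
    exact ⟨k, hb, hk.le⟩
  have hstep : ∀ k, volume (Qk k) ≤ ENNReal.ofReal C₅ * volume F := by
    intro k
    have hO : ∀ O, F ⊆ O → IsOpen O → volume (Qk k) ≤ ENNReal.ofReal C₅ * volume O := by
      intro O hFO hO
      have hrad : ∀ b ∈ Qk k, ∃ ρ, 0 < ρ ∧ ρ ≤ 1 / (6 * ((k : ℝ) + 1)) ∧ pCyl (z b) ρ ⊆ O :=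
        fun b hb => exists_pCyl_subset (hO.mem_nhds (hFO (hzF b hb.1))) (by positivity)
      choose! ρ hρ0 hρk hρO using hrad
      refine measure_le_of_parabolic_vitali volume (t := Qk k) (z := z) (ρ := ρ)
        (B := fun b => pCyl (z b) (ρ b))
        (S := fun b => {b' : Spc m × ℝ | ‖b'.1 - b.1‖ ≤ c₁ * (3 * ρ b) ∧
          |b'.2 - b.2 + 8 * inner ℝ (z b).1 (b'.1 - b.1)| ≤ c₂ * (3 * ρ b) ^ 2})
        hρ0 hρk (fun b _ => subset_rfl) (fun b hb => ?_) (fun b _ => ?_) (fun b hb => ?_)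
        (fun b hb => ⟨b, hb, fun b' hb' hbb => ?_⟩)
      · exact ⟨z b, mem_interior_iff_mem_nhds.2 (pCyl_mem_nhds _ (hρ0 b hb))⟩
      · exact (measurableSet_boxCyl _ _ _ _).inter hO.measurableSet
      · have hρb := hρ0 b hb
        rw [Set.inter_eq_left.2 (hρO b hb), volume_pCyl _ hρb.le, ← mul_assoc (ENNReal.ofReal C₅),
          ← ENNReal.ofReal_mul hC₅0.le]
        refine (volume_slab_le b.1 (z b).1 b.2 (by positivity)).trans (le_of_eq ?_)
        congr 2
        rw [hC₅]
        ring_nf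
      · have hρb := hρ0 b' hb'
        have hρb' : 2 * (3 * ρ b') ≤ 1 / ((k : ℝ) + 1) := by
          have := hρk b' hb'
          have e : 1 / ((k : ℝ) + 1) = 6 * (1 / (6 * ((k : ℝ) + 1))) := by field_simp
          rw [e]; linarith
        have := IsContact.param_close hA hlam hu (hQmem b' hb'.1).1 (hQmem b' hb'.1).2.2
          (hQmem b hb.1).1 (hQmem b hb.1).2.2 (hz b' hb'.1) (hz b hb.1) hC₁0.le
          (by positivity : 0 < 3 * ρ b')
          (fun v hv => hup b' hb'.1 v (hv.trans (hρb'.trans hb'.2)))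
          (fun v hv => hup b hb.1 v (hv.trans (hρb'.trans hb.2))) hbb hC₂
        refine ⟨?_, this.2⟩
        rw [hc₁]
        linarith [this.1]
    have hFfin : volume F ≠ ⊤ :=
      ((measure_mono Set.inter_subset_left).trans_lt (isCompact_boxCyl _ _ _ _).measure_lt_top).ne
    refine ENNReal.le_of_forall_pos_le_add fun ε hε _ => ?_
    have hε' : (ε / C₅.toNNReal : NNReal) ≠ 0 := by
      have : 0 < C₅.toNNReal := Real.toNNReal_pos.2 hC₅0
      positivity
    obtain ⟨O, hFO, hOo, hOle⟩ := F.exists_isOpen_le_add volume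
      (ENNReal.coe_ne_zero.2 hε')
    refine (hO O hFO hOo).trans ?_
    calc _ ≤ ENNReal.ofReal C₅ * (volume F + (ε / C₅.toNNReal : NNReal)) := by gcongr
      _ = ENNReal.ofReal C₅ * volume F + ε := by
        rw [mul_add]
        congr 1
        rw [ENNReal.ofReal, ← ENNReal.coe_mul]
        congr 1
        have : C₅.toNNReal ≠ 0 := (Real.toNNReal_pos.2 hC₅0).ne'
        field_simp
  have hQle : volume Q ≤ ENNReal.ofReal C₅ * volume F := by
    rw [hunion, hmono.measure_iUnion]
    exact iSup_le hstep
  have hQvol : volume Q = ENNReal.ofReal ((1 / 8) ^ (m + 1)) * ω := by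
    rw [hQ, Measure.volume_eq_prod, Measure.prod_prod, Real.volume_Ioo,
      Measure.addHaar_ball _ _ (by norm_num), finrank_euclideanSpace, Fintype.card_fin, ← hω]
    norm_num
  rw [hQvol] at hQle
  rw [ENNReal.ofReal_div_of_pos hC₅0]
  rw [ENNReal.mul_comm_div, ← mul_div_assoc]
  refine ENNReal.div_le_of_le_mul ?_
  rw [mul_comm (volume F)]
  exact hQle

end ContactMeasure

section Scaling
open MeasureTheory
variable {m : ℕ} {lam Lam : ℝ} {A : Spc m → Matrix (Fin (m + 1)) (Fin (m + 1)) ℝ}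
  {u : Spc m × ℝ → ℝ}

/-- Parabolic rescaling centred at `(c, T)`. -/
def scaleMap (c : Spc m) (T r : ℝ) (p : Spc m × ℝ) : Spc m × ℝ := (c + r • p.1, T + r ^ 2 * p.2)

theorem fderiv_affine_comp_smul (F : Spc m → ℝ) (c : Spc m) (α k r : ℝ) (y : Spc m) :
    fderiv ℝ (fun x => α + k * F (c + r • x)) y = (k * r) • fderiv ℝ F (c + r • y) := by
  have h1 : fderiv ℝ (fun x => α + k * F (c + r • x)) y
      = fderiv ℝ (k • fun x => F (c + r • x)) y := by
    rw [fderiv_const_add]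
    rfl
  have h2 : fderiv ℝ (fun x => F (c + r • x)) y = r • fderiv ℝ F (c + r • y) := by
    rw [fderiv_comp_smul (f := fun x => F (c + x)) r, fderiv_comp_add_left]
  rw [h1, fderiv_const_smul_field, Pi.smul_apply, h2, smul_smul]

theorem sHess_scale (c : Spc m) (T r α k : ℝ) (p : Spc m × ℝ) (i j : Fin (m + 1)) :
    sHess (fun p => α + k * u (scaleMap c T r p)) p i j
      = k * r ^ 2 * sHess u (scaleMap c T r p) i j := by
  unfold sHess
  simp only [scaleMap]
  have : (fun y => fderiv ℝ (fun z => α + k * u (c + r • z, T + r ^ 2 * p.2)) y (eVec m j))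
      = fun y => 0 + (k * r) *
        (fun y => fderiv ℝ (fun z => u (z, T + r ^ 2 * p.2)) y (eVec m j)) (c + r • y) := by
    funext y
    rw [fderiv_affine_comp_smul (fun z => u (z, T + r ^ 2 * p.2))]
    simp
  rw [this, fderiv_affine_comp_smul
    (fun y => fderiv ℝ (fun z => u (z, T + r ^ 2 * p.2)) y (eVec m j))]
  simp only [FunLike.coe_smul, Pi.smul_apply, smul_eq_mul]
  ring

theorem Lop_scale (c : Spc m) (T r α k : ℝ) (p : Spc m × ℝ) :
    Lop (fun x => A (c + r • x)) (fun p => α + k * u (scaleMap c T r p)) p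
      = k * r ^ 2 * Lop A u (scaleMap c T r p) := by
  unfold Lop
  simp only [sHess_scale, Finset.mul_sum]
  refine Finset.sum_congr rfl fun i _ => Finset.sum_congr rfl fun j _ => ?_
  simp only [scaleMap]
  ring

theorem IsElliptic.scale (hA : IsElliptic lam Lam A) (c : Spc m) (r : ℝ) :
    IsElliptic lam Lam (fun x => A (c + r • x)) :=
  ⟨fun _ => hA.1 _, fun _ _ => hA.2 _ _⟩

theorem continuous_scaleMap (c : Spc m) (T r : ℝ) : Continuous (scaleMap c T r) := by
  unfold scaleMap
  fun_prop

theorem SolvesL.scale {D D' : Set (Spc m × ℝ)} (hu : SolvesL A u D') (c : Spc m) (T r α k : ℝ)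
    (hD : Set.MapsTo (scaleMap c T r) D D') :
    SolvesL (fun x => A (c + r • x)) (fun p => α + k * u (scaleMap c T r p)) D := by
  intro p hp
  obtain ⟨h1, h2⟩ := hu _ (hD hp)
  constructor
  · have : ContDiffAt ℝ 2 (fun y => c + r • y) p.1 := by fun_prop
    have := ContDiffAt.comp p.1 (f := fun y => c + r • y) h1 this
    exact contDiffAt_const.add (contDiffAt_const.mul this)
  · rw [Lop_scale]
    have h3 : HasDerivAt (fun s : ℝ => T + r ^ 2 * s) (r ^ 2) p.2 := by
      simpa using ((hasDerivAt_id p.2).const_mul (r ^ 2)).const_add T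
    have := ((HasDerivAt.comp p.2 (h := fun s : ℝ => T + r ^ 2 * s) h2 h3).const_mul k).const_add α
    refine this.congr_deriv ?_
    ring

theorem mapsTo_scaleMap_boxCyl (c : Spc m) (T : ℝ) {r : ℝ} (hr : 0 ≤ r) {y : Spc m}
    {R a b R' a' b' : ℝ} {c' : Spc m}
    (hc : ‖c + r • y - c'‖ + r * R ≤ R') (ha : a' ≤ T + r ^ 2 * a) (hb : T + r ^ 2 * b ≤ b') :
    Set.MapsTo (scaleMap c T r) (boxCyl y R a b) (boxCyl c' R' a' b') := by
  intro p hp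
  rw [mem_boxCyl] at hp ⊢
  obtain ⟨h1, h2, h3⟩ := hp
  refine ⟨?_, ?_, ?_⟩
  · have e : (scaleMap c T r p).1 - c' = (c + r • y - c') + r • (p.1 - y) := by
      simp only [scaleMap, smul_sub]; abel
    rw [e]
    refine (norm_add_le _ _).trans (le_trans ?_ hc)
    rw [norm_smul, Real.norm_eq_abs, abs_of_nonneg hr]
    gcongr
  · simp only [scaleMap]
    have : r ^ 2 * a ≤ r ^ 2 * p.2 := by gcongr
    linarith
  · simp only [scaleMap]
    have : r ^ 2 * p.2 ≤ r ^ 2 * b := by gcongr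
    linarith

theorem volume_preimage_scaleMap (c : Spc m) (T : ℝ) {r : ℝ} (hr : 0 < r)
    (S : Set (Spc m × ℝ)) :
    volume (scaleMap c T r ⁻¹' S) = ENNReal.ofReal (r ^ (m + 3))⁻¹ * volume S := by
  set f : (Spc m × ℝ) →ₗ[ℝ] (Spc m × ℝ) :=
    LinearMap.prodMap (r • LinearMap.id) (r ^ 2 • LinearMap.id) with hf
  have hdet : LinearMap.det f = r ^ (m + 3) := by
    rw [hf, LinearMap.det_prodMap, LinearMap.det_smul, LinearMap.det_smul]
    simp
    ring
  have e : scaleMap c T r ⁻¹' S = f ⁻¹' ((fun p => (c, T) + p) ⁻¹' S) := by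
    ext p
    simp [hf, scaleMap]
  rw [Measure.volume_eq_prod, e, Measure.addHaar_preimage_linearMap _ (by rw [hdet]; positivity),
    hdet, measure_preimage_add, abs_of_pos (by positivity)]

theorem exists_measure_le_of_le (m : ℕ) {lam : ℝ} (hlam : 0 < lam) (Lam : ℝ) :
    ∃ μ : ℝ, 0 < μ ∧ ∀ A : Spc m → Matrix (Fin (m + 1)) (Fin (m + 1)) ℝ, IsElliptic lam Lam A →
      ∀ (u : Spc m × ℝ → ℝ) (c : Spc m) (T r N : ℝ), 0 < r → 0 < N →
      NonnegSol A u (boxCyl c r (T - r ^ 2) T) → u (c, T) ≤ N →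
      ENNReal.ofReal (μ * r ^ (m + 3)) * volume (Metric.ball (0 : Spc m) 1)
        ≤ volume (boxCyl c r (T - r ^ 2) T ∩ {p | u p ≤ 3 * N}) := by
  obtain ⟨μ, hμ, h⟩ := exists_measure_le_of_le_one_unit m hlam Lam
  refine ⟨μ, hμ, fun A hA u c T r N hr hN hu huc => ?_⟩
  have hmaps : Set.MapsTo (scaleMap c T r) (boxCyl 0 1 (-1) 0) (boxCyl c r (T - r ^ 2) T) :=
    mapsTo_scaleMap_boxCyl c T hr.le (by simp) (by linarith) (by linarith)
  have hNi : 0 < N⁻¹ := inv_pos.2 hN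
  have key := h _ (hA.scale c r) (fun p => 0 + N⁻¹ * u (scaleMap c T r p))
    ⟨hu.solves.scale c T r 0 N⁻¹ hmaps, ?_, ?_⟩ ?_
  · have hsub : boxCyl 0 1 (-1) 0 ∩ {p | 0 + N⁻¹ * u (scaleMap c T r p) ≤ 3}
        ⊆ scaleMap c T r ⁻¹' (boxCyl c r (T - r ^ 2) T ∩ {p | u p ≤ 3 * N}) := by
      rintro p ⟨hp, hp2⟩
      refine ⟨hmaps hp, ?_⟩
      simp only [Set.mem_ofPred_eq, zero_add] at hp2 ⊢
      rwa [inv_mul_le_iff₀ hN, mul_comm] at hp2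
    have k2 := key.trans (measure_mono hsub)
    rw [volume_preimage_scaleMap _ _ hr] at k2
    have hp : 0 < r ^ (m + 3) := by positivity
    calc _ = ENNReal.ofReal (r ^ (m + 3)) *
          (ENNReal.ofReal μ * volume (Metric.ball (0 : Spc m) 1)) := by
          rw [mul_comm μ, ENNReal.ofReal_mul hp.le, mul_assoc]
      _ ≤ _ := by
          refine (mul_le_mul_right k2 _).trans (le_of_eq ?_)
          rw [← mul_assoc, ← ENNReal.ofReal_mul hp.le, mul_inv_cancel₀ hp.ne']
          simp
  · exact continuousOn_const.add (continuousOn_const.mul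
      (hu.cont.comp (continuous_scaleMap c T r).continuousOn hmaps))
  · intro p hp
    have := hu.nonneg _ (hmaps hp)
    positivity
  · simp only [scaleMap]
    simp only [smul_zero, add_zero, mul_zero, zero_add]
    rw [inv_mul_le_iff₀ hN]
    linarith

end Scaling

section LevelSets
open MeasureTheory
variable {m : ℕ} {lam Lam : ℝ} {A : Spc m → Matrix (Fin (m + 1)) (Fin (m + 1)) ℝ}
  {u : Spc m × ℝ → ℝ}

theorem exists_measure_cell_le (m : ℕ) {lam : ℝ} (hlam : 0 < lam) (Lam : ℝ) :
    ∃ μ M : ℝ, 0 < μ ∧ 1 ≤ M ∧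
      ∀ A : Spc m → Matrix (Fin (m + 1)) (Fin (m + 1)) ℝ, IsElliptic lam Lam A →
      ∀ (u : Spc m × ℝ → ℝ) (x₀ x₁ : Spc m) (t₀ t₁ r N : ℝ), 0 < r → 0 < N →
      NonnegSol A u (boxCyl x₀ (6 * r) t₀ (t₀ + 4 * r ^ 2)) →
      r ^ 2 ≤ t₁ - t₀ → t₁ - t₀ ≤ 4 * r ^ 2 → ‖x₁ - x₀‖ ^ 2 ≤ t₁ - t₀ → u (x₁, t₁) ≤ N →
      ENNReal.ofReal (μ * r ^ (m + 3)) * volume (Metric.ball (0 : Spc m) 1)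
        ≤ volume (boxCyl x₀ (r / 2) (t₀ + 7 / 16 * r ^ 2) (t₀ + r ^ 2 / 2) ∩
          {p | u p ≤ M * N}) := by
  obtain ⟨μ, hμ, hmeas⟩ := exists_measure_le_of_le m hlam Lam
  obtain ⟨q, hq⟩ := exists_expansion_of_positivity m hlam Lam (κ := 10) (by norm_num)
  refine ⟨μ * (1 / 4) ^ (m + 3), 3 * 576 ^ q, by positivity, ?_, ?_⟩
  · have : (1 : ℝ) ≤ 576 ^ q := one_le_pow₀ (by norm_num)
    linarith
  intro A hA u x₀ x₁ t₀ t₁ r N hr hN hu h1 h2 h3 huN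
  have hr2 : 0 < r ^ 2 := by positivity
  have hex : ∃ x₂, ‖x₂ - x₀‖ ≤ r / 4 ∧ u (x₂, t₀ + r ^ 2 / 2) ≤ 576 ^ q * N := by
    by_contra! hcon
    have key := hq A hA u x₀ (6 * r) (t₀ + r ^ 2 / 2) t₁ (r / 4) (576 ^ q * N)
      (hu.mono (boxCyl_subset (by simp) (by linarith) (by linarith))) (by positivity)
      (by positivity) (by linarith) (by positivity) (by nlinarith)
      (fun x hx => (hcon x hx).le) x₁ (by nlinarith)
    set s := t₁ - (t₀ + r ^ 2 / 2) with hs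
    have e1 : (4 * r ^ 2) ^ 2 ≤ ((r / 4) ^ 2 + 10 * s - ‖x₁ - x₀‖ ^ 2) ^ 2 := by
      gcongr
      nlinarith
    have e2 : ((r / 4) ^ 2 + 10 * s) ^ q ≤ (36 * r ^ 2) ^ q := by
      gcongr
      · nlinarith
      · nlinarith
    have hpos : 0 ≤ ((r / 4) ^ 2 + 10 * s) ^ q := by
      have : 0 ≤ (r / 4) ^ 2 + 10 * s := by nlinarith
      positivity
    have k1 : 576 ^ q * N * (r / 4) ^ (2 * q) * (4 * r ^ 2) ^ 2
        ≤ N * (36 * r ^ 2) ^ q * (r / 4) ^ 4 := by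
      calc _ ≤ 576 ^ q * N * (r / 4) ^ (2 * q) *
            ((r / 4) ^ 2 + 10 * s - ‖x₁ - x₀‖ ^ 2) ^ 2 := by gcongr
        _ ≤ u (x₁, t₁) * ((r / 4) ^ 2 + 10 * s) ^ q * (r / 4) ^ 4 := key
        _ ≤ _ := by gcongr
    have e3 : (576 : ℝ) ^ q * (r / 4) ^ (2 * q) = (36 * r ^ 2) ^ q := by
      rw [pow_mul, ← mul_pow]
      congr 1
      ring
    have e4 : N * (36 * r ^ 2) ^ q * (4 * r ^ 2) ^ 2 ≤ N * (36 * r ^ 2) ^ q * (r / 4) ^ 4 := by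
      rw [← e3]
      rw [← e3] at k1
      linarith
    have e5 : 0 < N * (36 * r ^ 2) ^ q := by positivity
    have e6 := le_of_mul_le_mul_left e4 e5
    have : 0 < r ^ 4 := by positivity
    nlinarith
  obtain ⟨x₂, hx₂, hux₂⟩ := hex
  have hsub : boxCyl x₂ (r / 4) (t₀ + r ^ 2 / 2 - (r / 4) ^ 2) (t₀ + r ^ 2 / 2)
      ⊆ boxCyl x₀ (r / 2) (t₀ + 7 / 16 * r ^ 2) (t₀ + r ^ 2 / 2) :=
    boxCyl_subset (by linarith) (by linarith) le_rfl
  have := hmeas A hA u x₂ (t₀ + r ^ 2 / 2) (r / 4) (576 ^ q * N) (by positivity) (by positivity)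
    (hu.mono (hsub.trans (boxCyl_subset (by simp; linarith) (by linarith) (by linarith)))) hux₂
  refine le_trans (le_of_eq ?_) (this.trans (measure_mono ?_))
  · congr 2
    ring
  · refine Set.inter_subset_inter hsub fun p hp => ?_
    simp only [Set.mem_ofPred_eq] at hp ⊢
    linarith

theorem boxCyl_cell_free {x₀ : Spc m} {t₀ r : ℝ} (hr : 0 < r) {p : Spc m × ℝ}
    (hp : p ∈ boxCyl x₀ (r / 2) (t₀ + 7 / 16 * r ^ 2) (t₀ + r ^ 2 / 2)) :
    ‖p.1 - x₀‖ ^ 2 < p.2 - t₀ ∧ p.2 - t₀ < r ^ 2 := by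
  rw [mem_boxCyl] at hp
  obtain ⟨h1, h2, h3⟩ := hp
  have : 0 < r ^ 2 := by positivity
  have : ‖p.1 - x₀‖ ^ 2 ≤ (r / 2) ^ 2 := by gcongr
  constructor <;> nlinarith

end LevelSets

section LevelDecay
open MeasureTheory
variable {m : ℕ} {lam Lam : ℝ} {A : Spc m → Matrix (Fin (m + 1)) (Fin (m + 1)) ℝ}
  {u : Spc m × ℝ → ℝ}

theorem exists_critical_radius {P : ℝ → Prop} {g : ℝ} (hg : 0 < g)
    (hsmall : ∃ δ > 0, ∀ r, 0 < r → r ≤ δ → P r) (hnot : ¬ P g) :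
    ∃ r, 0 < r ∧ r ≤ g ∧ P r ∧ ¬ P (2 * r) := by
  obtain ⟨δ, hδ, hP⟩ := hsmall
  have hex : ∃ k : ℕ, P (g / 2 ^ k) := by
    obtain ⟨k, hk⟩ := exists_pow_lt_of_lt_one (div_pos hδ hg) (by norm_num : (1 / 2 : ℝ) < 1)
    refine ⟨k, hP _ (by positivity) ?_⟩
    rw [lt_div_iff₀ hg] at hk
    refine le_trans (le_of_eq ?_) hk.le
    rw [one_div_pow]
    ring
  set k := Nat.find hex with hk
  have hk0 : k ≠ 0 := by
    intro h0
    have := Nat.find_spec hex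
    rw [← hk, h0] at this
    exact hnot (by simpa using this)
  obtain ⟨l, hl⟩ := Nat.exists_eq_succ_of_ne_zero hk0
  refine ⟨g / 2 ^ k, by positivity, div_le_self hg.le (one_le_pow₀ (by norm_num)),
    Nat.find_spec hex, ?_⟩
  have h2 : 2 * (g / 2 ^ k) = g / 2 ^ l := by
    rw [hl, Nat.succ_eq_add_one, pow_succ]
    field_simp
  rw [h2]
  exact Nat.find_min hex (by omega)

/-- A decreasing sequence of cylinders shrinking to the unit one. -/
def levelBox (m j : ℕ) : Set (Spc m × ℝ) :=
  Metric.ball 0 (1 + (1 / 2) ^ (j + 1)) ×ˢ Set.Ioo 0 (1 + (1 / 2) ^ (j + 1))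

theorem mem_levelBox {j : ℕ} {p : Spc m × ℝ} : p ∈ levelBox m j ↔
    ‖p.1‖ < 1 + (1 / 2) ^ (j + 1) ∧ 0 < p.2 ∧ p.2 < 1 + (1 / 2) ^ (j + 1) := by
  simp [levelBox]

theorem isOpen_levelBox (m j : ℕ) : IsOpen (levelBox m j) := Metric.isOpen_ball.prod isOpen_Ioo

theorem levelBox_subset (m j : ℕ) : levelBox m j ⊆ boxCyl 0 7 0 3 := by
  intro p hp
  rw [mem_levelBox] at hp
  rw [mem_boxCyl, sub_zero]
  have : ((1 : ℝ) / 2) ^ (j + 1) ≤ 1 := pow_le_one₀ (by norm_num) (by norm_num)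
  exact ⟨by linarith, by linarith, by linarith⟩

theorem levelBox_succ_subset (m j : ℕ) : levelBox m (j + 1) ⊆ levelBox m j := by
  intro p hp
  rw [mem_levelBox] at hp ⊢
  have : ((1 : ℝ) / 2) ^ (j + 1 + 1) ≤ (1 / 2) ^ (j + 1) :=
    pow_le_pow_of_le_one (by norm_num) (by norm_num) (by omega)
  exact ⟨by linarith, by linarith, by linarith⟩

theorem exists_not_free (m : ℕ) {lam : ℝ} (hlam : 0 < lam) (Lam : ℝ) :
    ∃ N₀ M : ℝ, 1 ≤ N₀ ∧ 1 ≤ M ∧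
      ∀ A : Spc m → Matrix (Fin (m + 1)) (Fin (m + 1)) ℝ, IsElliptic lam Lam A →
      ∀ u : Spc m × ℝ → ℝ, NonnegSol A u (boxCyl 0 7 0 3) → u (0, 3) ≤ 1 →
      ∀ (j : ℕ) (N : ℝ), N₀ * M ^ j ≤ N → ∀ z ∈ levelBox m (j + 1),
      ∃ p : Spc m × ℝ, ‖p.1 - z.1‖ ^ 2 < p.2 - z.2 ∧ p.2 - z.2 < ((1 / 2) ^ (j + 2)) ^ 2 ∧
        u p ≤ N := by
  obtain ⟨q, hq⟩ := exists_expansion_of_positivity m hlam Lam (κ := 6) (by norm_num)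
  refine ⟨2 * 1600 ^ q, 4 ^ q, ?_, one_le_pow₀ (by norm_num), ?_⟩
  · have : (1 : ℝ) ≤ 1600 ^ q := one_le_pow₀ (by norm_num)
    linarith
  intro A hA u hu h1 j N hN z hz
  by_contra! hcon
  obtain ⟨hz1, hz2, hz3⟩ := mem_levelBox.1 hz
  have hd : ((1 : ℝ) / 2) ^ (j + 1 + 1) ≤ 1 / 4 := by
    have : ((1 : ℝ) / 2) ^ (j + 1 + 1) ≤ (1 / 2) ^ 2 :=
      pow_le_pow_of_le_one (by norm_num) (by norm_num) (by omega)
    linarith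
  set r : ℝ := (1 / 2) ^ (j + 2) with hr
  have hr0 : 0 < r := by positivity
  have hr1 : r ≤ 1 / 4 := hd
  have hN0 : 0 < N := lt_of_lt_of_le (by positivity) hN
  have hr2 : r ^ 2 ≤ 1 / 16 := by nlinarith
  have key := hq A hA u z.1 5 (z.2 + r ^ 2 / 2) 3 (r / 2) N
    (hu.mono (boxCyl_subset (by rw [sub_zero]; linarith) (by positivity) le_rfl)) (by positivity)
    (by norm_num) (by linarith) hN0.le (by nlinarith)
    (fun x hx => (hcon (x, z.2 + r ^ 2 / 2) (by
      have : ‖x - z.1‖ ^ 2 ≤ (r / 2) ^ 2 := by gcongr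
      have : 0 < r ^ 2 := by positivity
      simp only
      nlinarith) (by
      have : 0 < r ^ 2 := by positivity
      simp only
      nlinarith)).le) 0 (by
      rw [zero_sub, norm_neg]
      nlinarith [norm_nonneg z.1])
  rw [zero_sub, norm_neg] at key
  set s := 3 - (z.2 + r ^ 2 / 2) with hs
  have hs1 : 1 ≤ s := by linarith
  have hs2 : s ≤ 3 := by linarith [sq_nonneg r]
  have e1 : 1 ≤ ((r / 2) ^ 2 + 6 * s - ‖z.1‖ ^ 2) ^ 2 := by
    apply one_le_pow₀
    nlinarith [norm_nonneg z.1]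
  have e2 : ((r / 2) ^ 2 + 6 * s) ^ q ≤ 25 ^ q := by
    gcongr
    nlinarith
  have e3 : (r / 2) ^ 4 ≤ 1 := pow_le_one₀ (by linarith) (by linarith)
  have k1 : N * (r / 2) ^ (2 * q) ≤ 25 ^ q := by
    calc _ = N * (r / 2) ^ (2 * q) * 1 := by ring
      _ ≤ N * (r / 2) ^ (2 * q) * ((r / 2) ^ 2 + 6 * s - ‖z.1‖ ^ 2) ^ 2 := by gcongr
      _ ≤ u (0, 3) * ((r / 2) ^ 2 + 6 * s) ^ q * (r / 2) ^ 4 := key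
      _ ≤ 1 * 25 ^ q * 1 := by gcongr
      _ = _ := by ring
  have e4 : (1600 : ℝ) ^ q * (4 ^ q) ^ j * (r / 2) ^ (2 * q) = 25 ^ q := by
    rw [pow_mul, ← pow_mul, mul_comm q j, pow_mul, ← mul_pow, ← mul_pow]
    congr 1
    rw [hr]
    have : ((1 : ℝ) / 2) ^ j * 2 ^ j = 1 := by rw [← mul_pow]; norm_num
    have h4 : (4 : ℝ) ^ j = 2 ^ j * 2 ^ j := by rw [← mul_pow]; norm_num
    rw [pow_add, h4]
    linear_combination 25 * (((1 : ℝ) / 2) ^ j * 2 ^ j + 1) * this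
  have e5 : 2 * (25 : ℝ) ^ q ≤ N * (r / 2) ^ (2 * q) := by
    rw [← e4]
    calc _ = 2 * 1600 ^ q * (4 ^ q) ^ j * (r / 2) ^ (2 * q) := by ring
      _ ≤ _ := by gcongr
  have : (0 : ℝ) < 25 ^ q := by positivity
  linarith

theorem isClosed_inter_preimage_Iic {D : Set (Spc m × ℝ)} (hu : ContinuousOn u D) (hD : IsClosed D)
    (N : ℝ) : IsClosed (D ∩ u ⁻¹' Set.Iic N) :=
  hu.preimage_isClosed_of_isClosed hD isClosed_Iic

theorem exists_level_step (m : ℕ) {lam : ℝ} (hlam : 0 < lam) (Lam : ℝ) :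
    ∃ N₀ M C : ℝ, 1 ≤ N₀ ∧ 1 < M ∧ 0 < C ∧
      ∀ A : Spc m → Matrix (Fin (m + 1)) (Fin (m + 1)) ℝ, IsElliptic lam Lam A →
      ∀ u : Spc m × ℝ → ℝ, NonnegSol A u (boxCyl 0 7 0 3) → u (0, 3) ≤ 1 →
      ∀ j : ℕ, volume (levelBox m (j + 1) \ {p | u p ≤ N₀ * M ^ j})
        ≤ ENNReal.ofReal C * volume (levelBox m j ∩
          {p | N₀ * M ^ j < u p ∧ u p ≤ N₀ * M ^ (j + 1)}) := by
  obtain ⟨N₀, M₁, hN₀, hM₁, hfree⟩ := exists_not_free m hlam Lam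
  obtain ⟨μ, M₀, hμ, hM₀, hcell⟩ := exists_measure_cell_le m hlam Lam
  have hM1 : M₁ ≤ 2 * M₀ * M₁ := by nlinarith
  have hM0 : M₀ ≤ 2 * M₀ * M₁ := by nlinarith
  refine ⟨N₀, 2 * M₀ * M₁, 2 * 3 ^ (m + 3) / μ, hN₀, by nlinarith, by positivity, ?_⟩
  intro A hA u hu h1 j
  set M := 2 * M₀ * M₁ with hM
  set N := N₀ * M ^ j with hN
  have hNpos : 0 < N := by positivity
  have hbox : IsClosed (boxCyl (0 : Spc m) 7 0 3) := (isCompact_boxCyl _ _ _ _).isClosed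
  set g : ℝ := (1 / 2) ^ (j + 2) with hg
  have hg0 : 0 < g := by positivity
  have hg1 : g ≤ 1 / 4 := by
    have : ((1 : ℝ) / 2) ^ (j + 2) ≤ (1 / 2) ^ 2 :=
      pow_le_pow_of_le_one (by norm_num) (by norm_num) (by omega)
    linarith
  have hgs : (1 : ℝ) + (1 / 2) ^ (j + 1) = 1 + (1 / 2) ^ (j + 1 + 1) + g := by
    rw [hg, pow_succ _ (j + 1)]
    ring
  set E := levelBox m (j + 1) \ {p | u p ≤ N} with hE
  have hsel : ∀ z : Spc m × ℝ, ∃ r : ℝ, z ∈ E → 0 < r ∧ r ≤ g ∧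
      (∀ p : Spc m × ℝ, ‖p.1 - z.1‖ ^ 2 < p.2 - z.2 → p.2 - z.2 < r ^ 2 → N < u p) ∧
      ENNReal.ofReal (μ * r ^ (m + 3)) * volume (Metric.ball (0 : Spc m) 1)
        ≤ volume (boxCyl z.1 (r / 2) (z.2 + 7 / 16 * r ^ 2) (z.2 + r ^ 2 / 2) ∩
          {p | u p ≤ M₀ * N}) := by
    intro z
    by_cases hz : z ∈ E
    · obtain ⟨hzQ, hzN⟩ := hz
      obtain ⟨hz1, hz2, hz3⟩ := mem_levelBox.1 hzQ
      have hO : levelBox m (j + 1) ∩ {p | u p ≤ N}ᶜ ∈ nhds z := by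
        have hnh : boxCyl (0 : Spc m) 7 0 3 ∈ nhds z :=
          Filter.mem_of_superset ((isOpen_levelBox m (j + 1)).mem_nhds hzQ) (levelBox_subset _ _)
        refine Filter.inter_mem ((isOpen_levelBox m (j + 1)).mem_nhds hzQ) ?_
        have := (hu.cont.continuousAt hnh).eventually (lt_mem_nhds (not_le.1 hzN))
        filter_upwards [this] with p hp
        simpa using hp
      obtain ⟨ρ, hρ0, -, hρ⟩ := exists_pCyl_subset hO one_pos
      obtain ⟨r, hr0, hrg, hPr, hnP⟩ := exists_critical_radius
        (P := fun r => ∀ p : Spc m × ℝ, ‖p.1 - z.1‖ ^ 2 < p.2 - z.2 → p.2 - z.2 < r ^ 2 → N < u p)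
        hg0 ⟨ρ, hρ0, fun r hr hrρ p hp1 hp2 => by
          have : r ^ 2 ≤ ρ ^ 2 := by gcongr
          have hp : p ∈ pCyl z ρ := by
            rw [mem_pCyl]
            constructor
            · refine le_of_sq_le_sq ?_ hρ0.le
              linarith
            · rw [abs_le]
              constructor <;> nlinarith [sq_nonneg ‖p.1 - z.1‖]
          simpa using (hρ hp).2⟩ (by
          push Not
          exact hfree A hA u hu h1 j N (by rw [hN]; gcongr) z hzQ)
      refine ⟨r, fun _ => ⟨hr0, hrg, hPr, ?_⟩⟩
      push Not at hnP
      obtain ⟨p, hp1, hp2, hp3⟩ := hnP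
      have hr2 : 0 < r ^ 2 := by positivity
      have hr2' : r ^ 2 ≤ 1 / 16 := by nlinarith
      have hp4 : r ^ 2 ≤ p.2 - z.2 := by
        by_contra hlt
        exact absurd (hPr p hp1 (not_le.1 hlt)) (not_lt.2 hp3)
      refine hcell A hA u z.1 p.1 z.2 p.2 r N hr0 hNpos (hu.mono (boxCyl_subset ?_ hz2.le ?_))
        hp4 (by linarith [mul_pow 2 r 2]) hp1.le hp3
      · rw [sub_zero]
        linarith
      · linarith
    · exact ⟨0, fun h => absurd h hz⟩
  choose ρ hρ using hsel
  have hcellsub : ∀ z ∈ E, boxCyl z.1 (ρ z / 2) (z.2 + 7 / 16 * ρ z ^ 2) (z.2 + ρ z ^ 2 / 2) ⊆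
      levelBox m j ∩ {p | N < u p} := by
    intro z hz p hp
    obtain ⟨h1, h2, h3, h4⟩ := hρ z hz
    have hfr := boxCyl_cell_free h1 hp
    obtain ⟨hz1, hz2, hz3⟩ := mem_levelBox.1 hz.1
    refine ⟨?_, h3 p hfr.1 hfr.2⟩
    rw [mem_boxCyl] at hp
    have : ‖p.1‖ ≤ ‖p.1 - z.1‖ + ‖z.1‖ := by
      simpa using norm_add_le (p.1 - z.1) z.1
    rw [mem_levelBox, hgs]
    exact ⟨by linarith, by nlinarith [sq_nonneg (ρ z)], by nlinarith⟩
  have hL : ∀ N', MeasurableSet (boxCyl (0 : Spc m) 7 0 3 ∩ u ⁻¹' Set.Iic N') := fun N' =>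
    (isClosed_inter_preimage_Iic hu.cont hbox N').measurableSet
  set G := levelBox m j ∩ {p | N < u p ∧ u p ≤ N₀ * M ^ (j + 1)} with hG
  have hGm : MeasurableSet G := by
    have e : G = (levelBox m j ∩ (boxCyl (0 : Spc m) 7 0 3 ∩ u ⁻¹' Set.Iic (N₀ * M ^ (j + 1)))) \
        (boxCyl (0 : Spc m) 7 0 3 ∩ u ⁻¹' Set.Iic N) := by
      ext p
      have hsub := @levelBox_subset m j p
      simp only [hG, Set.mem_inter_iff, Set.mem_ofPred_eq, Set.mem_sdiff, Set.mem_preimage,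
        Set.mem_Iic, ← not_le (a := u p)]
      tauto
    rw [e]
    exact ((isOpen_levelBox m j).measurableSet.inter (hL _)).diff (hL _)
  refine measure_le_of_parabolic_vitali volume (t := E) (z := fun z => z) (ρ := ρ) (Rmax := g)
    (B := fun z => boxCyl z.1 (ρ z / 2) (z.2 + 7 / 16 * ρ z ^ 2) (z.2 + ρ z ^ 2 / 2))
    (S := fun z => pCyl z (3 * ρ z))
    (fun z hz => (hρ z hz).1) (fun z hz => (hρ z hz).2.1) (fun z hz => ?_) (fun z hz => ?_)
    (fun z hz => (measurableSet_boxCyl _ _ _ _).inter hGm) (fun z hz => ?_)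
    (fun e he => ⟨e, he, fun b hb h => h⟩)
  · have h1 := (hρ z hz).1
    exact boxCyl_subset (by simp; linarith) (by nlinarith) (by nlinarith)
  · have h1 := (hρ z hz).1
    refine ⟨(z.1, z.2 + 15 / 32 * ρ z ^ 2), mem_interior_iff_mem_nhds.2 ?_⟩
    refine prod_mem_nhds (Metric.closedBall_mem_nhds _ (by positivity)) (Icc_mem_nhds ?_ ?_)
    · nlinarith
    · nlinarith
  · obtain ⟨h1, h2, h3, h4⟩ := hρ z hz
    have hle : ENNReal.ofReal (μ * ρ z ^ (m + 3)) * volume (Metric.ball (0 : Spc m) 1)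
        ≤ volume (boxCyl z.1 (ρ z / 2) (z.2 + 7 / 16 * ρ z ^ 2) (z.2 + ρ z ^ 2 / 2) ∩ G) := by
      refine h4.trans (measure_mono fun p hp => ⟨hp.1, (hcellsub z hz hp.1).1,
        (hcellsub z hz hp.1).2, ?_⟩)
      have h5 : u p ≤ M₀ * N := hp.2
      refine h5.trans ?_
      rw [hN, pow_succ]
      have : M₀ * (N₀ * M ^ j) ≤ M * (N₀ * M ^ j) := by gcongr
      linarith
    rw [volume_pCyl _ (by positivity)]
    calc _ = ENNReal.ofReal (2 * 3 ^ (m + 3) / μ) *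
          (ENNReal.ofReal (μ * ρ z ^ (m + 3)) * volume (Metric.ball (0 : Spc m) 1)) := by
          rw [← mul_assoc, ← ENNReal.ofReal_mul (by positivity)]
          congr 2
          rw [mul_pow]
          field_simp
      _ ≤ _ := by gcongr

end LevelDecay

section PowerDecay
open MeasureTheory

theorem le_rpow_of_geometric {d : ℕ → ℝ} {C M N₀ W : ℝ} (hC : 0 < C) (hM : 1 < M) (hN₀ : 0 < N₀)
    (hW : 0 < W) (h0 : d 0 ≤ W) (hd : ∀ j, (1 + C) * d (j + 1) ≤ C * d j) {s : ℝ} (hs : N₀ ≤ s) :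
    ∃ j, N₀ * M ^ j ≤ s ∧
      d j ≤ W * (N₀ * M) ^ (Real.log ((1 + C) / C) / Real.log M) *
        s ^ (-(Real.log ((1 + C) / C) / Real.log M)) := by
  set ε := Real.log ((1 + C) / C) / Real.log M with hε
  have hlogM : 0 < Real.log M := Real.log_pos hM
  have hM0 : 0 < M := by linarith
  have hε0 : 0 < ε := div_pos (Real.log_pos (by rw [lt_div_iff₀ hC]; linarith)) hlogM
  have hs0 : 0 < s := by linarith
  have hMε : M ^ (-ε) = C / (1 + C) := by
    rw [Real.rpow_def_of_pos hM0, hε, mul_neg, mul_div_cancel₀ _ hlogM.ne', ← Real.log_inv,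
      Real.exp_log (by positivity), inv_div]
  have hgeo : ∀ j, d j ≤ (C / (1 + C)) ^ j * W := by
    intro j
    induction j with
    | zero => simpa using h0
    | succ j ih =>
      have : d (j + 1) ≤ C / (1 + C) * d j := by
        rw [div_mul_eq_mul_div, le_div_iff₀ (by positivity)]
        linarith [hd j]
      calc _ ≤ _ := this
        _ ≤ C / (1 + C) * ((C / (1 + C)) ^ j * W) := by gcongr
        _ = _ := by ring
  obtain ⟨j, hj1, hj2⟩ := exists_nat_pow_near (x := s / N₀) (y := M)
    (by rw [le_div_iff₀ hN₀]; linarith) hM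
  rw [le_div_iff₀ hN₀] at hj1
  rw [div_lt_iff₀ hN₀] at hj2
  refine ⟨j, by linarith, (hgeo j).trans ?_⟩
  have h1 : s / (N₀ * M) ≤ M ^ j := by
    rw [div_le_iff₀ (by positivity)]
    rw [pow_succ] at hj2
    linarith
  calc (C / (1 + C)) ^ j * W = (M ^ j) ^ (-ε) * W := by
        rw [← hMε, ← Real.rpow_natCast, ← Real.rpow_mul hM0.le, ← Real.rpow_natCast,
          ← Real.rpow_mul hM0.le, mul_comm (-ε)]
    _ ≤ (s / (N₀ * M)) ^ (-ε) * W := by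
        gcongr ?_ * W
        exact Real.rpow_le_rpow_of_nonpos (by positivity) h1 (by linarith)
    _ = _ := by
        rw [Real.div_rpow hs0.le (by positivity), Real.rpow_neg (x := N₀ * M) (by positivity),
          div_inv_eq_mul]
        ring

theorem exists_power_decay (m : ℕ) {lam : ℝ} (hlam : 0 < lam) (Lam : ℝ) :
    ∃ ε V N₀ : ℝ, 0 < ε ∧ 0 < V ∧ 1 ≤ N₀ ∧
      ∀ A : Spc m → Matrix (Fin (m + 1)) (Fin (m + 1)) ℝ, IsElliptic lam Lam A →
      ∀ u : Spc m × ℝ → ℝ, NonnegSol A u (boxCyl 0 7 0 3) → u (0, 3) ≤ 1 →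
      ∀ s : ℝ, N₀ ≤ s → volume ((Metric.ball 0 1 ×ˢ Set.Ioo 0 1) \ {p | u p ≤ s})
        ≤ ENNReal.ofReal (V * s ^ (-ε)) := by
  obtain ⟨N₀, M, C, hN₀, hM, hC, hstep⟩ := exists_level_step m hlam Lam
  have hfin : volume (levelBox m 0) ≠ ⊤ :=
    ((measure_mono (levelBox_subset m 0)).trans_lt (isCompact_boxCyl _ _ _ _).measure_lt_top).ne
  have hN0 : 0 < N₀ := by linarith
  set W := (volume (levelBox m 0)).toReal + 1 with hW
  have hW0 : 0 < W := by positivity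
  refine ⟨Real.log ((1 + C) / C) / Real.log M,
    W * (N₀ * M) ^ (Real.log ((1 + C) / C) / Real.log M), N₀,
    div_pos (Real.log_pos (by rw [lt_div_iff₀ hC]; linarith)) (Real.log_pos hM), by positivity,
    hN₀, ?_⟩
  intro A hA u hu h1 s hs
  set d : ℕ → ENNReal := fun j => volume (levelBox m j \ {p | u p ≤ N₀ * M ^ j}) with hd
  have hanti : Antitone (levelBox m) := antitone_nat_of_succ_le (levelBox_succ_subset m)
  have hdfin : ∀ j, d j ≠ ⊤ := fun j =>
    ((measure_mono (Set.sdiff_subset.trans (hanti (Nat.zero_le j)))).trans_lt hfin.lt_top).ne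
  have hrec : ∀ j, (1 + ENNReal.ofReal C) * d (j + 1) ≤ ENNReal.ofReal C * d j := by
    intro j
    have hmono : N₀ * M ^ j ≤ N₀ * M ^ (j + 1) := by
      have : M ^ j ≤ M ^ (j + 1) := pow_le_pow_right₀ hM.le (by omega)
      gcongr
    have hcl := isClosed_inter_preimage_Iic hu.cont (isCompact_boxCyl _ _ _ _).isClosed
    have hmeas : MeasurableSet (levelBox m j \ {p | u p ≤ N₀ * M ^ (j + 1)}) := by
      have e : levelBox m j \ {p | u p ≤ N₀ * M ^ (j + 1)}
          = levelBox m j \ (boxCyl 0 7 0 3 ∩ u ⁻¹' Set.Iic (N₀ * M ^ (j + 1))) := by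
        ext p
        have hsub := @levelBox_subset m j p
        simp only [Set.mem_inter_iff, Set.mem_ofPred_eq, Set.mem_sdiff, Set.mem_preimage,
          Set.mem_Iic]
        tauto
      rw [e]
      exact (isOpen_levelBox m j).measurableSet.diff (hcl _).measurableSet
    have hsum : volume (levelBox m j ∩ {p | N₀ * M ^ j < u p ∧ u p ≤ N₀ * M ^ (j + 1)})
        + volume (levelBox m j \ {p | u p ≤ N₀ * M ^ (j + 1)}) ≤ d j := by
      rw [← measure_union _ hmeas]
      · refine measure_mono ?_
        rintro p (⟨hp1, hp2, -⟩ | ⟨hp1, hp2⟩)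
        · exact ⟨hp1, not_le.2 hp2⟩
        · exact ⟨hp1, fun h => hp2 (le_trans h hmono)⟩
      · rw [Set.disjoint_left]
        exact fun p hp hp' => hp'.2 hp.2.2
    have h2 : d (j + 1) ≤ volume (levelBox m j \ {p | u p ≤ N₀ * M ^ (j + 1)}) :=
      measure_mono (Set.sdiff_subset_sdiff_left (levelBox_succ_subset m j))
    have h3 : d (j + 1) ≤ volume (levelBox m (j + 1) \ {p | u p ≤ N₀ * M ^ j}) :=
      measure_mono (Set.sdiff_subset_sdiff_right fun p hp => le_trans hp hmono)
    calc (1 + ENNReal.ofReal C) * d (j + 1) = d (j + 1) + ENNReal.ofReal C * d (j + 1) := by ring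
      _ ≤ ENNReal.ofReal C *
            volume (levelBox m j ∩ {p | N₀ * M ^ j < u p ∧ u p ≤ N₀ * M ^ (j + 1)})
          + ENNReal.ofReal C * volume (levelBox m j \ {p | u p ≤ N₀ * M ^ (j + 1)}) := by
          gcongr
          exact h3.trans (hstep A hA u hu h1 j)
      _ ≤ _ := by
          rw [← mul_add]
          gcongr
  obtain ⟨j, hj1, hj2⟩ := le_rpow_of_geometric (d := fun j => (d j).toReal) hC hM hN0 hW0
    (by
      have : d 0 ≤ volume (levelBox m 0) := measure_mono Set.sdiff_subset
      have := ENNReal.toReal_mono hfin this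
      linarith) (fun j => by
      have := ENNReal.toReal_mono (ENNReal.mul_ne_top ENNReal.ofReal_ne_top (hdfin j)) (hrec j)
      rw [ENNReal.toReal_mul, ENNReal.toReal_mul, ENNReal.toReal_ofReal hC.le,
        ENNReal.toReal_add ENNReal.one_ne_top ENNReal.ofReal_ne_top, ENNReal.toReal_one,
        ENNReal.toReal_ofReal hC.le] at this
      exact this) hs
  refine le_trans (measure_mono ?_) ((ENNReal.le_ofReal_iff_toReal_le (hdfin j) ?_).2 hj2)
  · rintro p ⟨⟨hp1, hp2, hp3⟩, hp4⟩
    have hpos : (0 : ℝ) < (1 / 2) ^ (j + 1) := by positivity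
    refine ⟨?_, fun h => hp4 (le_trans h hj1)⟩
    rw [mem_levelBox]
    rw [mem_ball_zero_iff] at hp1
    exact ⟨by linarith, hp2, by linarith⟩
  · have : 0 < s := by linarith
    positivity

end PowerDecay

section LocalBound
open MeasureTheory
variable {m : ℕ} {lam Lam : ℝ} {A : Spc m → Matrix (Fin (m + 1)) (Fin (m + 1)) ℝ}
  {u : Spc m × ℝ → ℝ}

theorem scaleMap_zero_zero_one (p : Spc m × ℝ) : scaleMap 0 0 1 p = p := by
  simp [scaleMap]

theorem SolvesL.affine {D : Set (Spc m × ℝ)} (hu : SolvesL A u D) (α k : ℝ) :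
    SolvesL A (fun p => α + k * u p) D := by
  have := hu.scale 0 0 1 α k (D := D) (fun p hp => by rwa [scaleMap_zero_zero_one])
  simpa [scaleMap_zero_zero_one] using this

theorem exists_larger_value {μ N r : ℝ} {c : Spc m} {T : ℝ} (hN : 0 < N)
    (hmeas : ∀ w : Spc m × ℝ → ℝ, NonnegSol A w (boxCyl c r (T - r ^ 2) T) → w (c, T) ≤ 1 →
      ENNReal.ofReal (μ * r ^ (m + 3)) * volume (Metric.ball (0 : Spc m) 1)
        ≤ volume (boxCyl c r (T - r ^ 2) T ∩ {p | w p ≤ 3 * 1}))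
    (hu : SolvesL A u (boxCyl c r (T - r ^ 2) T)) (hc : ContinuousOn u (boxCyl c r (T - r ^ 2) T))
    (huN : N ≤ u (c, T))
    (hsmall : volume (boxCyl c r (T - r ^ 2) T \ {p | u p ≤ N / 3})
      < ENNReal.ofReal (μ * r ^ (m + 3)) * volume (Metric.ball (0 : Spc m) 1)) :
    ∃ p ∈ boxCyl c r (T - r ^ 2) T, 5 / 4 * N < u p := by
  by_contra! hcon
  refine absurd ((hmeas (fun p => 5 + (-(4 / N)) * u p) ⟨hu.affine _ _, by fun_prop, ?_⟩ ?_).trans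
    (measure_mono ?_)) (not_le.2 hsmall)
  · intro p hp
    have h1 := hcon p hp
    have : 4 / N * u p ≤ 5 := by
      rw [div_mul_eq_mul_div, div_le_iff₀ hN]
      linarith
    linarith
  · have : 4 ≤ 4 / N * u (c, T) := by
      rw [div_mul_eq_mul_div, le_div_iff₀ hN]
      linarith
    linarith
  · rintro p ⟨hp, hp2⟩
    refine ⟨hp, fun hp3 => ?_⟩
    simp only [Set.mem_ofPred_eq] at hp2 hp3
    have : 2 ≤ 4 / N * u p := by linarith
    rw [div_mul_eq_mul_div, le_div_iff₀ hN] at this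
    linarith

theorem exists_local_bound (m : ℕ) {lam : ℝ} (hlam : 0 < lam) (Lam : ℝ) :
    ∃ L : ℝ, 0 < L ∧
      ∀ A : Spc m → Matrix (Fin (m + 1)) (Fin (m + 1)) ℝ, IsElliptic lam Lam A →
      ∀ u : Spc m × ℝ → ℝ, NonnegSol A u (boxCyl 0 7 0 3) → u (0, 3) ≤ 1 →
      ∀ p ∈ boxCyl (0 : Spc m) (1 / 2) (1 / 2) (3 / 4), u p ≤ L := by
  obtain ⟨ε, V, N₀, hε, hV, hN₀, hdec⟩ := exists_power_decay m hlam Lam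
  obtain ⟨μ, hμ, hmeas⟩ := exists_measure_le_of_le m hlam Lam
  set ω := volume (Metric.ball (0 : Spc m) 1) with hω
  have hω0 : 0 < ω.toReal := ENNReal.toReal_pos
    (Metric.measure_ball_pos _ _ one_pos).ne' measure_ball_lt_top.ne
  have hωe : ω = ENNReal.ofReal ω.toReal := (ENNReal.ofReal_toReal measure_ball_lt_top.ne).symm
  set θ : ℝ := (5 / 4) ^ (-(ε / (m + 3))) with hθ
  have hθ0 : 0 < θ := by positivity
  have hθ1 : θ < 1 := Real.rpow_lt_one_of_one_lt_of_neg (by norm_num)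
    (by have : 0 < ε / (m + 3) := by positivity
        linarith)
  have hθm : θ ^ (m + 3) = (5 / 4) ^ (-ε) := by
    rw [hθ, ← Real.rpow_natCast, ← Real.rpow_mul (by norm_num)]
    congr 1
    push_cast
    field_simp
  have hθ2 : 0 < 1 - θ := by linarith
  have hlim : Filter.Tendsto (fun L : ℝ => V * (L / 3) ^ (-ε)) Filter.atTop (nhds (V * 0)) :=
    tendsto_const_nhds.mul ((tendsto_rpow_neg_atTop hε).comp
      (Filter.tendsto_id.atTop_div_const (by norm_num)))
  have hpos : V * 0 < μ * ((1 - θ) / 4) ^ (m + 3) * ω.toReal := by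
    rw [mul_zero]
    positivity
  obtain ⟨L, hLV, hL⟩ := ((hlim.eventually_lt_const hpos).and
    (Filter.eventually_ge_atTop (3 * N₀))).exists
  have hL0 : 0 < L := by linarith
  refine ⟨L, hL0, fun A hA u hu h1 p hp => ?_⟩
  by_contra! hLp
  have hiter : ∀ j : ℕ, ∃ z : Spc m × ℝ, ‖z.1‖ ≤ 1 / 2 + (1 - θ ^ j) / 4 ∧
      1 / 2 - (1 - θ ^ j) / 4 ≤ z.2 ∧ z.2 ≤ 3 / 4 ∧ L * (5 / 4) ^ j ≤ u z := by
    intro j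
    induction j with
    | zero =>
      rw [mem_boxCyl, sub_zero] at hp
      exact ⟨p, by simpa using hp.1, by simpa using hp.2.1, hp.2.2, by simpa using hLp.le⟩
    | succ j ih =>
      obtain ⟨z, hz1, hz2, hz3, hz4⟩ := ih
      have hθj : 0 < θ ^ j := by positivity
      have hθj1 : θ ^ j ≤ 1 := pow_le_one₀ hθ0.le hθ1.le
      set r : ℝ := (1 - θ) / 4 * θ ^ j with hr
      have hr0 : 0 < r := by positivity
      have hr1 : r ≤ 1 / 4 := by nlinarith
      have hr2 : r ^ 2 ≤ r / 4 := by nlinarith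
      have hre : (1 - θ ^ (j + 1)) / 4 = (1 - θ ^ j) / 4 + r := by
        rw [hr, pow_succ]
        ring
      have hθj' : 0 < θ ^ (j + 1) := by positivity
      have hsub : boxCyl z.1 r (z.2 - r ^ 2) z.2 ⊆ boxCyl 0 7 0 3 :=
        boxCyl_subset (by rw [sub_zero]; linarith) (by linarith) (by linarith)
      have hsub2 : boxCyl z.1 r (z.2 - r ^ 2) z.2 ⊆ Metric.ball 0 1 ×ˢ Set.Ioo 0 1 := by
        intro q hq
        rw [mem_boxCyl] at hq
        have : ‖q.1‖ ≤ ‖q.1 - z.1‖ + ‖z.1‖ := by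
          simpa using norm_add_le (q.1 - z.1) z.1
        refine ⟨?_, ?_, ?_⟩
        · rw [mem_ball_zero_iff]
          linarith
        · linarith
        · linarith
      have h54 : (1 : ℝ) ≤ (5 / 4) ^ j := one_le_pow₀ (by norm_num)
      set N := L * (5 / 4) ^ j with hN
      have hNL : L ≤ N := by nlinarith
      obtain ⟨q, hq, hqu⟩ := exists_larger_value (u := u) (μ := μ) (r := r) (c := z.1) (T := z.2)
        (N := N) (by positivity)
        (fun w hw hw1 => hmeas A hA w z.1 z.2 r 1 hr0 one_pos hw hw1)
        (hu.solves.mono hsub) (hu.cont.mono hsub) hz4 (by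
          refine (measure_mono (Set.sdiff_subset_sdiff_left hsub2)).trans_lt
            ((hdec A hA u hu h1 (N / 3) (by linarith)).trans_lt ?_)
          rw [← hω, hωe, ← ENNReal.ofReal_mul (by positivity),
            ENNReal.ofReal_lt_ofReal_iff (by positivity)]
          have e1 : (N / 3) ^ (-ε) = (L / 3) ^ (-ε) * (θ ^ (m + 3)) ^ j := by
            rw [hN, mul_div_right_comm, Real.mul_rpow (by positivity) (by positivity), hθm,
              ← Real.rpow_natCast, ← Real.rpow_natCast, ← Real.rpow_mul (by norm_num),
              ← Real.rpow_mul (by norm_num), mul_comm (j : ℝ)]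
          have e2 : r ^ (m + 3) = ((1 - θ) / 4) ^ (m + 3) * (θ ^ (m + 3)) ^ j := by
            rw [hr, mul_pow, ← pow_mul, ← pow_mul, mul_comm j]
          rw [e1, e2]
          have : 0 < (θ ^ (m + 3)) ^ j := by positivity
          calc _ = V * (L / 3) ^ (-ε) * (θ ^ (m + 3)) ^ j := by ring
            _ < μ * ((1 - θ) / 4) ^ (m + 3) * ω.toReal * (θ ^ (m + 3)) ^ j := by gcongr
            _ = _ := by ring)
      rw [mem_boxCyl] at hq
      refine ⟨q, ?_, ?_, by linarith, ?_⟩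
      · have : ‖q.1‖ ≤ ‖q.1 - z.1‖ + ‖z.1‖ := by
          simpa using norm_add_le (q.1 - z.1) z.1
        linarith
      · linarith
      · rw [pow_succ]
        linarith
  obtain ⟨B, hB⟩ := (isCompact_boxCyl (0 : Spc m) 7 0 3).exists_bound_of_continuousOn hu.cont
  obtain ⟨j, hj⟩ := pow_unbounded_of_one_lt (B / L) (by norm_num : (1 : ℝ) < 5 / 4)
  obtain ⟨z, hz1, hz2, hz3, hz4⟩ := hiter j
  have hθj : 0 < θ ^ j := by positivity
  have := hB z (by
    rw [mem_boxCyl, sub_zero]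
    exact ⟨by linarith, by linarith, by linarith⟩)
  rw [div_lt_iff₀ hL0] at hj
  have := le_abs_self (u z)
  rw [Real.norm_eq_abs] at *
  linarith

theorem exists_basic_harnack (m : ℕ) {lam : ℝ} (hlam : 0 < lam) (Lam : ℝ) :
    ∃ L : ℝ, 0 < L ∧
      ∀ A : Spc m → Matrix (Fin (m + 1)) (Fin (m + 1)) ℝ, IsElliptic lam Lam A →
      ∀ u : Spc m × ℝ → ℝ, NonnegSol A u (boxCyl 0 7 0 3) →
      ∀ p ∈ boxCyl (0 : Spc m) (1 / 2) (1 / 2) (3 / 4), u p ≤ L * u (0, 3) := by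
  obtain ⟨L, hL, h⟩ := exists_local_bound m hlam Lam
  refine ⟨L, hL, fun A hA u hu p hp => ?_⟩
  have h3 : 0 ≤ u (0, 3) := hu.nonneg _ (by rw [mem_boxCyl]; norm_num)
  refine le_of_forall_pos_le_add fun δ hδ => ?_
  have hk : 0 < u (0, 3) + δ / L := by positivity
  have := h A hA (fun p => 0 + (u (0, 3) + δ / L)⁻¹ * u p)
    ⟨hu.solves.affine _ _, by have := hu.cont; fun_prop, fun q hq => by
      have := hu.nonneg q hq
      positivity⟩ (by
      rw [zero_add, inv_mul_le_iff₀ hk]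
      have : 0 < δ / L := by positivity
      linarith) p hp
  rw [zero_add, inv_mul_le_iff₀ hk, add_mul, div_mul_cancel₀ _ hL.ne'] at this
  linarith

end LocalBound

section Harnack
variable {m : ℕ} {lam Lam : ℝ} {A : Spc m → Matrix (Fin (m + 1)) (Fin (m + 1)) ℝ}
  {u : Spc m × ℝ → ℝ}

theorem exists_scaled_harnack (m : ℕ) {lam : ℝ} (hlam : 0 < lam) (Lam : ℝ) :
    ∃ L : ℝ, 0 < L ∧
      ∀ A : Spc m → Matrix (Fin (m + 1)) (Fin (m + 1)) ℝ, IsElliptic lam Lam A →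
      ∀ (u : Spc m × ℝ → ℝ) (x₀ y : Spc m) (t₀ r : ℝ), 0 < r → ‖y - x₀‖ ≤ r / 2 →
      NonnegSol A u (boxCyl x₀ (8 * r) (t₀ - r ^ 2) (t₀ + 5 / 2 * r ^ 2)) →
      u (x₀, t₀) ≤ L * u (y, t₀ + 5 / 2 * r ^ 2) := by
  obtain ⟨L, hL, h⟩ := exists_basic_harnack m hlam Lam
  refine ⟨L, hL, fun A hA u x₀ y t₀ r hr hy hu => ?_⟩
  have hmaps : Set.MapsTo (scaleMap y (t₀ - r ^ 2 / 2) r) (boxCyl 0 7 0 3)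
      (boxCyl x₀ (8 * r) (t₀ - r ^ 2) (t₀ + 5 / 2 * r ^ 2)) :=
    mapsTo_scaleMap_boxCyl _ _ hr.le (by rw [smul_zero, add_zero]; linarith)
      (by linarith [sq_nonneg r]) (by linarith)
  have key := h _ (hA.scale y r) (fun p => 0 + 1 * u (scaleMap y (t₀ - r ^ 2 / 2) r p))
    ⟨hu.solves.scale _ _ _ 0 1 hmaps, continuousOn_const.add (continuousOn_const.mul
      (hu.cont.comp (continuous_scaleMap _ _ _).continuousOn hmaps)), fun p hp => by
      simpa using hu.nonneg _ (hmaps hp)⟩ (r⁻¹ • (x₀ - y), 1 / 2) (by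
      rw [mem_boxCyl, sub_zero, norm_smul, norm_inv, Real.norm_eq_abs, abs_of_pos hr,
        inv_mul_le_iff₀ hr, norm_sub_rev]
      norm_num
      linarith)
  simp only [scaleMap, smul_smul, mul_inv_cancel₀ hr.ne', one_smul, zero_add, one_mul, smul_zero,
    add_zero] at key
  have e1 : y + (x₀ - y) = x₀ := by abel
  have e2 : t₀ - r ^ 2 / 2 + r ^ 2 * (1 / 2) = t₀ := by ring
  have e3 : t₀ - r ^ 2 / 2 + r ^ 2 * 3 = t₀ + 5 / 2 * r ^ 2 := by ring
  rwa [e1, e2, e3] at key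

/-- The parabolic Harnack inequality for nonnegative continuous solutions. -/
theorem exists_harnack (m : ℕ) {lam : ℝ} (hlam : 0 < lam) (Lam : ℝ) {κ : ℝ} (hκ : 0 < κ) :
    ∃ C R : ℝ, 1 ≤ C ∧ 0 < R ∧
      ∀ A : Spc m → Matrix (Fin (m + 1)) (Fin (m + 1)) ℝ, IsElliptic lam Lam A →
      ∀ (u : Spc m × ℝ → ℝ) (x₀ x₁ : Spc m) (t₀ T : ℝ), 0 < T →
      NonnegSol A u (boxCyl x₀ (R * √T) (t₀ - T) (t₀ + T)) → ‖x₁ - x₀‖ ^ 2 ≤ κ * T →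
      u (x₀, t₀) ≤ C * u (x₁, t₀ + T) := by
  obtain ⟨L, hL, hharn⟩ := exists_scaled_harnack m hlam Lam
  obtain ⟨q, hq⟩ := exists_expansion_of_positivity m hlam Lam (κ := 2 * κ + 2) (by linarith)
  have hs2 : √(κ + 2) ^ 2 = κ + 2 := Real.sq_sqrt (by linarith)
  refine ⟨L * (20 * (κ + 2)) ^ q + 1, 4 + √(κ + 2), ?_, by positivity, ?_⟩
  · have : 0 ≤ L * (20 * (κ + 2)) ^ q := by positivity
    linarith
  intro A hA u x₀ x₁ t₀ T hT hu hx
  have hsT : 0 < √T := Real.sqrt_pos.2 hT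
  have hsT2 : √T ^ 2 = T := Real.sq_sqrt hT.le
  set r := √(T / 5) with hr
  have hr0 : 0 < r := Real.sqrt_pos.2 (by positivity)
  have hr2 : r ^ 2 = T / 5 := Real.sq_sqrt (by positivity)
  have h8 : 8 * r ≤ (4 + √(κ + 2)) * √T := by
    have : 2 * r ≤ √T := le_of_sq_le_sq (by rw [mul_pow, hsT2, hr2]; linarith) hsT.le
    have : 0 ≤ √(κ + 2) * √T := by positivity
    linarith
  have hux0 : 0 ≤ u (x₀, t₀) := hu.nonneg _ (by
    rw [mem_boxCyl, sub_self, norm_zero]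
    exact ⟨by positivity, by linarith, by linarith⟩)
  have hx1R : ‖x₁ - x₀‖ ≤ √(κ + 2) * √T :=
    le_of_sq_le_sq (by rw [mul_pow, hsT2, hs2]; nlinarith) (by positivity)
  have hux1 : 0 ≤ u (x₁, t₀ + T) := hu.nonneg _ (by
    rw [mem_boxCyl]
    exact ⟨by linarith, by linarith, by linarith⟩)
  have key := hq A hA u x₀ (√(κ + 2) * √T) (t₀ + T / 2) (t₀ + T) (r / 2) (u (x₀, t₀) / L)
    (hu.mono (boxCyl_subset (by rw [sub_self, norm_zero]; linarith) (by linarith) le_rfl))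
    (by positivity) (by positivity) (by linarith) (by positivity)
    (by rw [mul_pow, hs2, hsT2, div_pow, hr2]; nlinarith) (fun x hx => by
      rw [div_le_iff₀ hL]
      have := hharn A hA u x₀ x t₀ r hr0 hx (hu.mono (boxCyl_subset
        (by rw [sub_self, norm_zero]; linarith) (by linarith) (by linarith)))
      have e : t₀ + 5 / 2 * r ^ 2 = t₀ + T / 2 := by rw [hr2]; ring
      rw [e] at this
      linarith) x₁ (by nlinarith [sq_nonneg (r / 2)])
  have hT2 : t₀ + T - (t₀ + T / 2) = T / 2 := by ring
  have hρ2 : (r / 2) ^ 2 = T / 20 := by rw [div_pow, hr2]; ring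
  have hρ4 : (r / 2) ^ 4 = T ^ 2 / 400 := by
    rw [show (r / 2) ^ 4 = ((r / 2) ^ 2) ^ 2 by ring, hρ2]
    ring
  rw [hT2, pow_mul, hρ4, hρ2] at key
  have hF : (T / 20 + (2 * κ + 2) * (T / 2)) ≤ (κ + 2) * T := by nlinarith
  have hF0 : 0 ≤ T / 20 + (2 * κ + 2) * (T / 2) := by positivity
  have e1 : T ^ 2 ≤ (T / 20 + (2 * κ + 2) * (T / 2) - ‖x₁ - x₀‖ ^ 2) ^ 2 := by
    gcongr
    nlinarith
  have k1 : u (x₀, t₀) / L * (T / 20) ^ q * T ^ 2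
      ≤ u (x₁, t₀ + T) * ((κ + 2) * T) ^ q * (T ^ 2 / 400) := by
    calc _ ≤ u (x₀, t₀) / L * (T / 20) ^ q *
          (T / 20 + (2 * κ + 2) * (T / 2) - ‖x₁ - x₀‖ ^ 2) ^ 2 := by gcongr
      _ ≤ _ := key
      _ ≤ _ := by gcongr
  have e2 : ((κ + 2) * T) ^ q = (20 * (κ + 2)) ^ q * (T / 20) ^ q := by
    rw [← mul_pow]
    congr 1
    ring
  have hD : 0 < (T / 20) ^ q * T ^ 2 := by positivity
  have k2 : u (x₀, t₀) / L ≤ u (x₁, t₀ + T) * (20 * (κ + 2)) ^ q := by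
    refine le_of_mul_le_mul_right ?_ hD
    rw [e2] at k1
    have : 0 ≤ u (x₁, t₀ + T) * ((20 * (κ + 2)) ^ q * (T / 20) ^ q) * T ^ 2 := by positivity
    linarith
  rw [div_le_iff₀ hL] at k2
  linarith

end Harnack

section Continuity
variable {m : ℕ} {lam Lam : ℝ} {A : Spc m → Matrix (Fin (m + 1)) (Fin (m + 1)) ℝ}
  {u : Spc m × ℝ → ℝ}

/-- Two-sided Harnack comparison, in a box whose half-size is comparable with the parabolic
distance to an exceptional set `S`, with the values on the coordinate crosses of `S`. -/
theorem exists_cross_harnack (m : ℕ) {lam : ℝ} (hlam : 0 < lam) (Lam : ℝ) :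
    ∃ C R B : ℝ, 1 ≤ C ∧ 0 < R ∧ 0 < B ∧
      ∀ A : Spc m → Matrix (Fin (m + 1)) (Fin (m + 1)) ℝ, IsElliptic lam Lam A →
      ∀ (v : Spc m × ℝ → ℝ) (S : Set (Spc m × ℝ)) (y : Spc m) (s r a b : ℝ), 0 < r →
      SolvesL A v (boxCyl y (B * r) (s - 4 * r ^ 2) (s + 4 * r ^ 2)) →
      (∀ p ∈ boxCyl y (B * r) (s - 4 * r ^ 2) (s + 4 * r ^ 2), p ∉ S → ContinuousAt v p) →
      (∀ p ∈ boxCyl y (B * r) (s - 4 * r ^ 2) (s + 4 * r ^ 2), 0 ≤ v p) →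
      (∀ p ∈ boxCyl y (R * r) (s - r ^ 2) (s + r ^ 2), p ∉ S) →
      (∃ p ∈ boxCyl y (R * (2 * r)) (s - (2 * r) ^ 2) (s + (2 * r) ^ 2), p ∈ S) →
      (∀ p ∈ boxCyl y (B * r) (s - 4 * r ^ 2) (s + 4 * r ^ 2), p ∈ S →
        (a ≤ v (y, p.2) ∧ v (y, p.2) ≤ b) ∧
        ∀ t, s - 4 * r ^ 2 ≤ t → t ≤ s + 4 * r ^ 2 → a ≤ v (p.1, t) ∧ v (p.1, t) ≤ b) →
      a ≤ C * v (y, s) ∧ v (y, s) ≤ C * b := by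
  obtain ⟨C₁, R, hC₁, hR, h₁⟩ := exists_harnack m hlam Lam (κ := 1) one_pos
  obtain ⟨C₂, R₂, hC₂, hR₂, h₂⟩ := exists_harnack m hlam Lam (κ := 64 * R ^ 2) (by positivity)
  refine ⟨C₁ * C₂, R, 2 * R + R₂ / 4, by nlinarith, hR, by positivity, ?_⟩
  intro A hA v S y s r a b hr hsol hcont hnn hfree ⟨p', hp', hp'S⟩ hcross
  set B := 2 * R + R₂ / 4 with hB
  have hr2 : 0 < r ^ 2 := by positivity
  have hRB : R * r ≤ B * r := by
    gcongr
    linarith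
  have hBr : B * r = 2 * (R * r) + R₂ * r / 4 := by rw [hB]; ring
  have hR2r : 0 < R₂ * r := by positivity
  have hRr : 0 < R * r := by positivity
  have hC1p : 0 < C₁ := by linarith
  have hC2p : 0 < C₂ := by linarith
  have sub : ∀ D : Set (Spc m × ℝ), D ⊆ boxCyl y (B * r) (s - 4 * r ^ 2) (s + 4 * r ^ 2) →
      (∀ p ∈ D, p ∉ S) → NonnegSol A v D := fun D hD hDS =>
    ⟨hsol.mono hD, fun p hp => (hcont p (hD hp) (hDS p hp)).continuousWithinAt,
      fun p hp => hnn p (hD hp)⟩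
  have hfreeSol : NonnegSol A v (boxCyl y (R * r) (s - r ^ 2) (s + r ^ 2)) :=
    sub _ (boxCyl_subset (by rw [sub_self, norm_zero]; linarith) (by linarith) (by linarith)) hfree
  have hsq : ∀ T, T ≤ r ^ 2 → R * √T ≤ R * r := fun T hT => by
    gcongr
    exact Real.sqrt_le_iff.2 ⟨hr.le, hT⟩
  have step : ∀ t T, 0 < T → s - r ^ 2 ≤ t - T → t + T ≤ s + r ^ 2 →
      v (y, t) ≤ C₁ * v (y, t + T) := fun t T hT h1 h2 =>
    h₁ A hA v y y t T hT (hfreeSol.mono (boxCyl_subset (by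
      rw [sub_self, norm_zero, zero_add]; exact hsq T (by linarith)) h1 h2))
      (by rw [sub_self, norm_zero]; linarith)
  obtain ⟨hp'1, hp'2, hp'3⟩ := mem_boxCyl.1 hp'
  have hp'B : p' ∈ boxCyl y (B * r) (s - 4 * r ^ 2) (s + 4 * r ^ 2) := by
    rw [mem_boxCyl]
    exact ⟨by linarith, by linarith, by linarith⟩
  have hline := (hcross p' hp'B hp'S).2
  have hs16 : √(r ^ 2 / 16) = r / 4 := by
    rw [show r ^ 2 / 16 = (r / 4) ^ 2 by ring]
    exact Real.sqrt_sq (by positivity)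
  have hdist : ‖p'.1 - y‖ ^ 2 ≤ 64 * R ^ 2 * (r ^ 2 / 16) := by
    calc ‖p'.1 - y‖ ^ 2 ≤ (R * (2 * r)) ^ 2 := by gcongr
      _ = _ := by ring
  have hmemD : ∀ t, s - 4 * r ^ 2 ≤ t → t ≤ s + 4 * r ^ 2 →
      (y, t) ∈ boxCyl y (B * r) (s - 4 * r ^ 2) (s + 4 * r ^ 2) := fun t h1 h2 => by
    rw [mem_boxCyl, sub_self, norm_zero]
    exact ⟨by linarith, h1, h2⟩
  have hv0 := hnn _ (hmemD s (by linarith) (by linarith))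
  constructor
  · by_cases hslab : ∃ p ∈ boxCyl y (B * r) (s - r ^ 2 / 2) (s - r ^ 2 / 4), p ∈ S
    · obtain ⟨p, hp, hpS⟩ := hslab
      have hpD : p ∈ boxCyl y (B * r) (s - 4 * r ^ 2) (s + 4 * r ^ 2) :=
        boxCyl_subset (by simp) (by linarith) (by linarith) hp
      obtain ⟨-, hp2, hp3⟩ := mem_boxCyl.1 hp
      have := step p.2 (s - p.2) (by linarith) (by linarith) (by linarith)
      rw [add_sub_cancel] at this
      calc a ≤ C₁ * v (y, s) := (hcross p hpD hpS).1.1.trans this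
        _ ≤ C₁ * C₂ * v (y, s) := by nlinarith [mul_nonneg hC1p.le hv0]
    · push Not at hslab
      have k1 := h₂ A hA v p'.1 y (s - 7 / 16 * r ^ 2) (r ^ 2 / 16) (by positivity)
        (sub _ (boxCyl_subset (by rw [hs16]; linarith) (by linarith) (by linarith)) fun p hp =>
          hslab p (boxCyl_subset (by rw [hs16]; linarith) (by linarith) (by linarith) hp))
        (by rwa [norm_sub_rev])
      have k2 := step (s - 3 / 8 * r ^ 2) (3 / 8 * r ^ 2) (by positivity) (by linarith)
        (by linarith)
      rw [show s - 7 / 16 * r ^ 2 + r ^ 2 / 16 = s - 3 / 8 * r ^ 2 by ring] at k1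
      rw [sub_add_cancel] at k2
      have := (hline (s - 7 / 16 * r ^ 2) (by linarith) (by linarith)).1
      calc a ≤ C₂ * v (y, s - 3 / 8 * r ^ 2) := this.trans k1
        _ ≤ C₂ * (C₁ * v (y, s)) := by gcongr
        _ = _ := by ring
  · by_cases hslab : ∃ p ∈ boxCyl y (B * r) (s + r ^ 2 / 4) (s + r ^ 2 / 2), p ∈ S
    · obtain ⟨p, hp, hpS⟩ := hslab
      have hpD : p ∈ boxCyl y (B * r) (s - 4 * r ^ 2) (s + 4 * r ^ 2) :=
        boxCyl_subset (by simp) (by linarith) (by linarith) hp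
      obtain ⟨-, hp2, hp3⟩ := mem_boxCyl.1 hp
      have h1 := step s (p.2 - s) (by linarith) (by linarith) (by linarith)
      rw [add_sub_cancel] at h1
      have h2 := (hcross p hpD hpS).1.2
      have h3 := hnn _ (hmemD p.2 (by linarith) (by linarith))
      calc v (y, s) ≤ C₁ * v (y, p.2) := h1
        _ ≤ C₁ * C₂ * v (y, p.2) := by nlinarith [mul_nonneg hC1p.le h3]
        _ ≤ _ := by gcongr
    · push Not at hslab
      have k1 := h₂ A hA v y p'.1 (s + 3 / 8 * r ^ 2) (r ^ 2 / 16) (by positivity)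
        (sub _ (boxCyl_subset (by rw [hs16, sub_self, norm_zero]; linarith) (by linarith)
          (by linarith)) fun p hp => hslab p (boxCyl_subset
            (by rw [hs16, sub_self, norm_zero]; linarith) (by linarith) (by linarith) hp))
        hdist
      have k2 := step s (3 / 8 * r ^ 2) (by positivity) (by linarith) (by linarith)
      rw [show s + 3 / 8 * r ^ 2 + r ^ 2 / 16 = s + 7 / 16 * r ^ 2 by ring] at k1
      have := (hline (s + 7 / 16 * r ^ 2) (by linarith) (by linarith)).2
      calc v (y, s) ≤ C₁ * v (y, s + 3 / 8 * r ^ 2) := k2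
        _ ≤ C₁ * (C₂ * v (p'.1, s + 7 / 16 * r ^ 2)) := by gcongr
        _ ≤ C₁ * (C₂ * b) := by gcongr
        _ = _ := by ring

end Continuity

section CrossLip
variable {m : ℕ} {lam Lam : ℝ} {A : Spc m → Matrix (Fin (m + 1)) (Fin (m + 1)) ℝ}
  {u : Spc m × ℝ → ℝ}

/-- `u` is Lipschitz at `p` along the time line and the spatial slice through `p`. -/
def CrossLip (N δ : ℝ) (u : Spc m × ℝ → ℝ) (p : Spc m × ℝ) : Prop :=
  (∀ t, |t - p.2| < δ → |u (p.1, t) - u p| ≤ N * |t - p.2|) ∧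
    ∀ x, ‖x - p.1‖ < δ → |u (x, p.2) - u p| ≤ N * ‖x - p.1‖

theorem exists_boxCyl_subset {O : Set (Spc m × ℝ)} {p : Spc m × ℝ} (hO : O ∈ nhds p) :
    ∃ d, 0 < d ∧ ∀ e ≤ d, boxCyl p.1 e (p.2 - e) (p.2 + e) ⊆ O := by
  obtain ⟨d, hd, h⟩ := Metric.nhds_basis_closedBall.mem_iff.1 hO
  refine ⟨d, hd, fun e he q hq => h ?_⟩
  obtain ⟨h1, h2, h3⟩ := mem_boxCyl.1 hq
  rw [Metric.mem_closedBall, Prod.dist_eq, dist_eq_norm, Real.dist_eq]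
  exact max_le (by linarith) (abs_le.2 ⟨by linarith, by linarith⟩)

theorem CrossLip.bound {N δ d : ℝ} (hN : 0 ≤ N) (hd : 2 * d < δ) {p q : Spc m × ℝ}
    (hp : CrossLip N δ u p) (hq : CrossLip N δ u q)
    (h1 : ‖q.1 - p.1‖ ≤ d) (h2 : |q.2 - p.2| ≤ d) :
    (∀ x, ‖x - p.1‖ ≤ d → |u (x, q.2) - u p| ≤ 4 * N * d) ∧
      ∀ t, |t - p.2| ≤ d → |u (q.1, t) - u p| ≤ 4 * N * d := by
  have hd0 : 0 ≤ d := (norm_nonneg _).trans h1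
  have h2' : |p.2 - q.2| ≤ d := by rwa [abs_sub_comm]
  have a1 := hq.1 p.2 (by linarith)
  have a2 := hp.2 q.1 (by linarith)
  have b1 : N * |p.2 - q.2| ≤ N * d := by gcongr
  have b2 : N * ‖q.1 - p.1‖ ≤ N * d := by gcongr
  rw [abs_le] at a1 a2
  constructor
  · intro x hx
    have hxq : ‖x - q.1‖ ≤ 2 * d := by
      have := norm_sub_le (x - p.1) (q.1 - p.1)
      rw [sub_sub_sub_cancel_right] at this
      linarith
    have a3 := hq.2 x (by linarith)
    have b3 : N * ‖x - q.1‖ ≤ N * (2 * d) := by gcongr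
    rw [abs_le] at a3 ⊢
    constructor <;> linarith
  · intro t ht
    have htq : |t - q.2| ≤ 2 * d := by
      have := abs_sub (t - p.2) (q.2 - p.2)
      rw [sub_sub_sub_cancel_right] at this
      linarith
    have a3 := hq.1 t (by linarith)
    have b3 : N * |t - q.2| ≤ N * (2 * d) := by gcongr
    rw [abs_le] at a3 ⊢
    constructor <;> linarith

theorem eventually_harnack_of_crossLip (m : ℕ) {lam : ℝ} (hlam : 0 < lam) (Lam : ℝ) :
    ∃ C : ℝ, 1 ≤ C ∧
      ∀ A : Spc m → Matrix (Fin (m + 1)) (Fin (m + 1)) ℝ, IsElliptic lam Lam A →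
      ∀ (u : Spc m × ℝ → ℝ) (Ω S : Set (Spc m × ℝ)) (p : Spc m × ℝ) (N δ : ℝ),
      0 ≤ N → 0 < δ → Ω ∈ nhds p → SolvesL A u Ω →
      (∀ q ∈ Ω, q ∉ S → Sᶜ ∈ nhds q) → (∀ q ∈ Ω, q ∉ S → ContinuousAt u q) →
      p ∈ S → (∀ q ∈ Ω, q ∈ S → CrossLip N δ u q) →
      ∀ k η : ℝ, 0 < η → (∀ᶠ q in nhds p, k ≤ u q) →
        ∀ᶠ q in nhds p, u p - k - η ≤ C * (u q - k) ∧ u q - k ≤ C * (u p - k + η) := by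
  obtain ⟨C, R, B, hC, hR, hB, h⟩ := exists_cross_harnack m hlam Lam
  refine ⟨C, hC, ?_⟩
  intro A hA u Ω S p N δ hN hδ hΩ hsol hSc hcont hpS hcross k η hη hk
  obtain ⟨d₀, hd₀, hsub⟩ := exists_boxCyl_subset (Filter.inter_mem hΩ hk)
  obtain ⟨d, hd, hdd₀, hdδ, hdη⟩ : ∃ d, 0 < d ∧ d ≤ d₀ ∧ 2 * d < δ ∧ 4 * N * d ≤ η := by
    refine ⟨min d₀ (min (δ / 3) (η / (4 * N + 1))), by positivity, min_le_left _ _, ?_, ?_⟩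
    · have := (min_le_right d₀ _).trans (min_le_left (δ / 3) (η / (4 * N + 1)))
      linarith
    · have h1 := (min_le_right d₀ _).trans (min_le_right (δ / 3) (η / (4 * N + 1)))
      calc 4 * N * _ ≤ 4 * N * (η / (4 * N + 1)) := by gcongr
        _ ≤ (4 * N + 1) * (η / (4 * N + 1)) := by gcongr; linarith
        _ = η := by field_simp
  have hpΩ : p ∈ Ω := mem_of_mem_nhds hΩ
  have hbox : ∀ q ∈ boxCyl p.1 d (p.2 - d) (p.2 + d), q ∈ Ω ∧ k ≤ u q := fun q hq =>
    hsub d hdd₀ hq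
  have hbd : ∀ q ∈ boxCyl p.1 d (p.2 - d) (p.2 + d), q ∈ S →
      (∀ x, ‖x - p.1‖ ≤ d → |u (x, q.2) - u p| ≤ η) ∧
        ∀ t, |t - p.2| ≤ d → |u (q.1, t) - u p| ≤ η := fun q hq hqS => by
    obtain ⟨q1, q2, q3⟩ := mem_boxCyl.1 hq
    obtain ⟨b1, b2⟩ := (hcross p hpΩ hpS).bound hN hdδ (hcross q (hbox q hq).1 hqS) q1
      (abs_le.2 ⟨by linarith, by linarith⟩)
    exact ⟨fun x hx => (b1 x hx).trans hdη, fun t ht => (b2 t ht).trans hdη⟩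
  obtain ⟨ρ, hρ, hρ1, hBρ, hρd⟩ : ∃ ρ, 0 < ρ ∧ ρ ≤ 1 ∧ B * ρ ≤ d / 2 ∧ 4 * ρ ^ 2 ≤ d / 2 := by
    refine ⟨min 1 (min (d / (2 * B)) (d / 8)), by positivity, min_le_left _ _, ?_, ?_⟩
    · calc B * _ ≤ B * (d / (2 * B)) := by
            gcongr
            exact (min_le_right _ _).trans (min_le_left _ _)
        _ = d / 2 := by field_simp
    · have h1 := min_le_left 1 (min (d / (2 * B)) (d / 8))
      have h2 := (min_le_right 1 _).trans (min_le_right (d / (2 * B)) (d / 8))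
      have h3 : 0 ≤ min 1 (min (d / (2 * B)) (d / 8)) := by positivity
      nlinarith
  set e := min (min (R * ρ) (ρ ^ 2)) (d / 2) with he
  have he0 : 0 < e := by positivity
  have heR : e ≤ R * ρ := (min_le_left _ _).trans (min_le_left _ _)
  have heρ : e ≤ ρ ^ 2 := (min_le_left _ _).trans (min_le_right _ _)
  have hed : e ≤ d / 2 := min_le_right _ _
  filter_upwards [Metric.closedBall_mem_nhds p he0] with q hq
  rw [Metric.mem_closedBall, Prod.dist_eq, dist_eq_norm, Real.dist_eq, max_le_iff, abs_le] at hq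
  obtain ⟨hq1, hq2, hq3⟩ := hq
  have hqbox : q ∈ boxCyl p.1 d (p.2 - d) (p.2 + d) :=
    mem_boxCyl.2 ⟨by linarith, by linarith, by linarith⟩
  obtain ⟨hqΩ, hkq⟩ := hbox q hqbox
  by_cases hqS : q ∈ S
  · have := abs_le.1 ((hbd q hqbox hqS).2 q.2 (abs_le.2 ⟨by linarith, by linarith⟩))
    rw [Prod.mk.eta] at this
    constructor <;> nlinarith
  obtain ⟨d₁, hd₁, hsub₁⟩ := exists_boxCyl_subset (hSc q hqΩ hqS)
  let P : ℕ → Prop := fun j => ∀ z ∈ boxCyl q.1 (R * (ρ * (1 / 2) ^ j))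
    (q.2 - (ρ * (1 / 2) ^ j) ^ 2) (q.2 + (ρ * (1 / 2) ^ j) ^ 2), z ∉ S
  have hP0 : ¬ P 0 := fun hP => hP p (mem_boxCyl.2 ⟨by
    rw [norm_sub_rev, pow_zero, mul_one]; linarith, by rw [pow_zero, mul_one]; linarith,
    by rw [pow_zero, mul_one]; linarith⟩) hpS
  have hPex : ∃ j, P j := by
    obtain ⟨j, hj⟩ := exists_pow_lt_of_lt_one (show 0 < d₁ / (R + 1) by positivity)
      (show (1 / 2 : ℝ) < 1 by norm_num)
    have hj1 : (1 / 2 : ℝ) ^ j ≤ 1 := pow_le_one₀ (by norm_num) (by norm_num)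
    have hj0 : (0 : ℝ) < (1 / 2) ^ j := by positivity
    rw [lt_div_iff₀ (by positivity)] at hj
    have hr1 : ρ * (1 / 2) ^ j ≤ (1 / 2) ^ j := by nlinarith
    have hr0 : 0 < ρ * (1 / 2) ^ j := by positivity
    refine ⟨j, fun z hz => hsub₁ d₁ le_rfl (boxCyl_subset ?_ ?_ ?_ hz)⟩
    · rw [sub_self, norm_zero]
      nlinarith
    · nlinarith
    · nlinarith
  obtain ⟨j, hj⟩ := Nat.exists_eq_succ_of_ne_zero (n := Nat.find hPex) fun h0 =>
    hP0 (h0 ▸ Nat.find_spec hPex)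
  have hPj : P (j + 1) := by
    have := Nat.find_spec hPex
    rwa [hj] at this
  have hnP : ¬ P j := Nat.find_min hPex (by omega)
  set r := ρ * (1 / 2) ^ (j + 1) with hr
  have h2r : ρ * (1 / 2) ^ j = 2 * r := by rw [hr, pow_succ]; ring
  have hr0 : 0 < r := by positivity
  have hrρ : r ≤ ρ := by
    rw [hr]
    exact mul_le_of_le_one_right hρ.le (pow_le_one₀ (by norm_num) (by norm_num))
  have hBr : B * r ≤ d / 2 := le_trans (by gcongr) hBρ
  have hrd : 4 * r ^ 2 ≤ d / 2 := le_trans (by gcongr) hρd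
  have hD : boxCyl q.1 (B * r) (q.2 - 4 * r ^ 2) (q.2 + 4 * r ^ 2) ⊆
      boxCyl p.1 d (p.2 - d) (p.2 + d) :=
    boxCyl_subset (by linarith) (by linarith) (by linarith)
  have hnP' : ∃ z ∈ boxCyl q.1 (R * (2 * r)) (q.2 - (2 * r) ^ 2) (q.2 + (2 * r) ^ 2), z ∈ S := by
    simp only [P, h2r] at hnP
    push Not at hnP
    exact hnP
  have key := h A hA (fun z => -k + 1 * u z) S q.1 q.2 r (u p - k - η) (u p - k + η) hr0
    ((hsol.mono fun z hz => (hbox z (hD hz)).1).affine _ _)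
    (fun z hz hzS => continuousAt_const.add (continuousAt_const.mul
      (hcont z (hbox z (hD hz)).1 hzS)))
    (fun z hz => by linarith [(hbox z (hD hz)).2]) hPj hnP' (fun z hz hzS => by
      obtain ⟨b1, b2⟩ := hbd z (hD hz) hzS
      refine ⟨?_, fun t h1 h2 => ?_⟩
      · have := abs_le.1 (b1 q.1 (by linarith))
        constructor <;> linarith
      · have := abs_le.1 (b2 t (abs_le.2 ⟨by linarith, by linarith⟩))
        constructor <;> linarith)
  rw [Prod.mk.eta, one_mul, neg_add_eq_sub] at key
  exact key

theorem continuousAt_of_crossLip (hlam : 0 < lam) (hA : IsElliptic lam Lam A)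
    {Ω S : Set (Spc m × ℝ)} {p : Spc m × ℝ} {N δ : ℝ} (hN : 0 ≤ N) (hδ : 0 < δ)
    (hΩ : Ω ∈ nhds p) (hsol : SolvesL A u Ω) (hnn : ∀ q ∈ Ω, 0 ≤ u q)
    (hSc : ∀ q ∈ Ω, q ∉ S → Sᶜ ∈ nhds q) (hcont : ∀ q ∈ Ω, q ∉ S → ContinuousAt u q)
    (hpS : p ∈ S) (hcross : ∀ q ∈ Ω, q ∈ S → CrossLip N δ u q) : ContinuousAt u p := by
  obtain ⟨C, hC, h⟩ := eventually_harnack_of_crossLip m hlam Lam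
  replace h := h A hA u Ω S p N δ hN hδ hΩ hsol hSc hcont hpS hcross
  have hC0 : 0 < C := by linarith
  set M := {k : ℝ | ∀ᶠ q in nhds p, k ≤ u q} with hM
  have hne : M.Nonempty := ⟨0, Filter.mem_of_superset hΩ hnn⟩
  have hub : ∀ k ∈ M, k ≤ u p := fun k hk =>
    Filter.Eventually.self_of_nhds (p := fun q => k ≤ u q) hk
  have hbdd : BddAbove M := ⟨u p, hub⟩
  have hsup : sSup M = u p := by
    refine le_antisymm (csSup_le hne hub) (not_lt.1 fun hlt => ?_)
    set ε := (u p - sSup M) / (4 * C) with hε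
    have hε0 : 0 < ε := div_pos (by linarith) (by positivity)
    have hCε : 4 * (C * ε) = u p - sSup M := by rw [hε]; field_simp
    obtain ⟨k, hkM, hk⟩ := exists_lt_of_lt_csSup hne (show sSup M - ε < sSup M by linarith)
    have hkle := le_csSup hbdd hkM
    have : sSup M + ε / 2 ∈ M := by
      filter_upwards [h k (C * ε) (by positivity) hkM] with q hq
      have : C * (3 * ε) ≤ C * (u q - k) := by linarith [hq.1]
      have := le_of_mul_le_mul_left this hC0
      linarith
    linarith [le_csSup hbdd this]
  rw [Metric.continuousAt_iff']
  intro ε hε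
  set ε' := ε / (4 * C) with hε'
  have hε0 : 0 < ε' := by positivity
  have hCε : 4 * (C * ε') = ε := by rw [hε']; field_simp
  have hεε : ε' ≤ C * ε' := by nlinarith
  obtain ⟨k, hkM, hk⟩ := exists_lt_of_lt_csSup hne (show sSup M - ε' < sSup M by linarith)
  rw [hsup] at hk
  filter_upwards [hkM, h k ε' hε0 hkM] with q hq1 hq2
  have h3 : C * (u p - k + ε') ≤ C * (2 * ε') := by gcongr; linarith
  rw [Real.dist_eq, abs_lt]
  have := hub k hkM
  constructor <;> linarith [hq2.2]

end CrossLip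

section ContinuousOn
variable {m : ℕ} {lam Lam : ℝ} {A : Spc m → Matrix (Fin (m + 1)) (Fin (m + 1)) ℝ}
  {u : Spc m × ℝ → ℝ}

theorem CrossLip.mono {N N' δ δ' : ℝ} {p : Spc m × ℝ} (h : CrossLip N δ u p) (hN : N ≤ N')
    (hδ : δ' ≤ δ) : CrossLip N' δ' u p :=
  ⟨fun t ht => (h.1 t (by linarith)).trans (by gcongr),
    fun x hx => (h.2 x (by linarith)).trans (by gcongr)⟩

theorem CrossLip.of_tendsto {N δ : ℝ} (hδ : 0 < δ) {q : ℕ → Spc m × ℝ} {p : Spc m × ℝ}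
    (hq : Filter.Tendsto q Filter.atTop (nhds p)) (hk : ∀ k, CrossLip N δ u (q k))
    (hx : ∀ t, |t - p.2| < δ → ContinuousAt (fun x => u (x, t)) p.1)
    (ht : ∀ x, ‖x - p.1‖ < δ → ContinuousAt (fun t => u (x, t)) p.2) : CrossLip N δ u p := by
  have hq1 : Filter.Tendsto (fun k => (q k).1) Filter.atTop (nhds p.1) := hq.fst_nhds
  have hq2 : Filter.Tendsto (fun k => (q k).2) Filter.atTop (nhds p.2) := hq.snd_nhds
  have evt : ∀ t, |t - p.2| < δ →
      ∀ᶠ k in Filter.atTop, |u ((q k).1, t) - u (q k)| ≤ N * |t - (q k).2| := fun t h => by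
    filter_upwards [((tendsto_const_nhds (x := t)).sub hq2).abs.eventually_lt_const h] with k hk'
    exact (hk k).1 t hk'
  have evx : ∀ x, ‖x - p.1‖ < δ →
      ∀ᶠ k in Filter.atTop, |u (x, (q k).2) - u (q k)| ≤ N * ‖x - (q k).1‖ := fun x h => by
    filter_upwards [((tendsto_const_nhds (x := x)).sub hq1).norm.eventually_lt_const h] with k hk'
    exact (hk k).2 x hk'
  have hp0 : |p.2 - p.2| < δ := by simpa using hδ
  have hu : Filter.Tendsto (fun k => u (q k)) Filter.atTop (nhds (u p)) := by
    have h1 : Filter.Tendsto (fun k => u ((q k).1, p.2)) Filter.atTop (nhds (u p)) :=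
      (hx p.2 hp0).tendsto.comp hq1
    have h2 : Filter.Tendsto (fun k => u ((q k).1, p.2) - u (q k)) Filter.atTop (nhds 0) := by
      refine squeeze_zero_norm' (evt p.2 hp0) ?_
      have := ((tendsto_const_nhds (x := p.2)).sub hq2).abs.const_mul N
      simpa using this
    simpa using h1.sub h2
  refine ⟨fun t h => ?_, fun x h => ?_⟩
  · exact le_of_tendsto_of_tendsto (((hx t h).tendsto.comp hq1).sub hu).abs
      (((tendsto_const_nhds (x := t)).sub hq2).abs.const_mul N) (evt t h)
  · exact le_of_tendsto_of_tendsto (((ht x h).tendsto.comp hq2).sub hu).abs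
      (((tendsto_const_nhds (x := x)).sub hq1).norm.const_mul N) (evx x h)

theorem exists_crossLip {p : Spc m × ℝ} (hx : DifferentiableAt ℝ (fun x => u (x, p.2)) p.1)
    (ht : DifferentiableAt ℝ (fun t => u (p.1, t)) p.2) :
    ∃ N δ : ℝ, 0 < δ ∧ CrossLip N δ u p := by
  obtain ⟨a, ha⟩ := hx.hasFDerivAt.isBigO_sub.bound
  obtain ⟨b, hb⟩ := ht.hasFDerivAt.isBigO_sub.bound
  obtain ⟨δ₁, hδ₁, h₁⟩ := Metric.eventually_nhds_iff.1 ha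
  obtain ⟨δ₂, hδ₂, h₂⟩ := Metric.eventually_nhds_iff.1 hb
  refine ⟨max a b, min δ₁ δ₂, lt_min hδ₁ hδ₂, fun t h => ?_, fun x h => ?_⟩
  · have := h₂ (y := t) (by rw [Real.dist_eq]; exact h.trans_le (min_le_right _ _))
    exact this.trans (by rw [Real.norm_eq_abs]; gcongr; exact le_max_right _ _)
  · have := h₁ (y := x) (by rw [dist_eq_norm]; exact h.trans_le (min_le_left _ _))
    exact this.trans (by gcongr; exact le_max_left _ _)

/-- Nonnegative pointwise solutions are jointly continuous. -/
theorem SolvesL.continuousAt (hlam : 0 < lam) (hA : IsElliptic lam Lam A) {Ω : Set (Spc m × ℝ)}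
    (hΩ : IsOpen Ω) (hsol : SolvesL A u Ω) (hnn : ∀ q ∈ Ω, 0 ≤ u q) {p : Spc m × ℝ} (hp : p ∈ Ω) :
    ContinuousAt u p := by
  set G := {q | q ∈ Ω ∧ ∀ᶠ z in nhds q, ContinuousAt u z} with hG
  have hGo : IsOpen G := hΩ.inter isOpen_setOfPred_eventually_nhds
  by_contra hpc
  have hpG : p ∉ G := fun h => hpc h.2.self_of_nhds
  set S := Ω ∩ Gᶜ with hS
  have hSl : IsLocallyClosed S := hΩ.isLocallyClosed.inter hGo.isClosed_compl.isLocallyClosed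
  have : LocallyCompactSpace S := hSl.locallyCompactSpace
  have : Nonempty S := ⟨⟨p, hp, hpG⟩⟩
  let r : ℕ → ℝ := fun n => 1 / ((n : ℝ) + 1)
  have hr : ∀ n, 0 < r n := fun n => Nat.one_div_pos_of_nat
  let F : ℕ → Set S := fun n =>
    {q | Metric.ball (q : Spc m × ℝ) (r n) ⊆ Ω ∧ CrossLip n (r n) u q}
  have hFc : ∀ n, IsClosed (F n) := fun n => by
    refine IsSeqClosed.isClosed fun q z hq hqz => ?_
    have hqz' : Filter.Tendsto (fun k => (q k : Spc m × ℝ)) Filter.atTop (nhds z) :=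
      (continuous_subtype_val.tendsto z).comp hqz
    have hball : Metric.ball (z : Spc m × ℝ) (r n) ⊆ Ω := fun w hw => by
      obtain ⟨k, hk⟩ := (((tendsto_const_nhds (x := w)).dist hqz').eventually_lt_const hw).exists
      exact (hq k).1 hk
    refine ⟨hball, CrossLip.of_tendsto (hr n) hqz' (fun k => (hq k).2) (fun t h => ?_)
      fun x h => ?_⟩
    · refine (hsol (z.1.1, t) (hball ?_)).1.continuousAt
      rw [Metric.mem_ball, Prod.dist_eq, dist_self, Real.dist_eq]
      exact max_lt (hr n) h
    · refine (hsol (x, z.1.2) (hball ?_)).2.continuousAt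
      rw [Metric.mem_ball, Prod.dist_eq, dist_self, dist_eq_norm]
      exact max_lt h (hr n)
  have hFU : ⋃ n, F n = Set.univ := by
    refine Set.eq_univ_of_forall fun q => ?_
    obtain ⟨δ₀, hδ₀, hb⟩ := Metric.isOpen_iff.1 hΩ q q.2.1
    obtain ⟨hqx, hqt⟩ := hsol q q.2.1
    obtain ⟨N, δ, hδ, hc⟩ := exists_crossLip (hqx.differentiableAt (by norm_num))
      hqt.differentiableAt
    obtain ⟨n₁, hn₁⟩ := exists_nat_ge N
    obtain ⟨n₂, hn₂⟩ := exists_nat_one_div_lt (lt_min hδ₀ hδ)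
    have hrn : r (max n₁ n₂) ≤ min δ₀ δ :=
      (Nat.one_div_le_one_div (le_max_right n₁ n₂)).trans hn₂.le
    refine Set.mem_iUnion.2 ⟨max n₁ n₂,
      (Metric.ball_subset_ball (hrn.trans (min_le_left _ _))).trans hb,
      hc.mono (hn₁.trans ?_) (hrn.trans (min_le_right _ _))⟩
    exact_mod_cast le_max_left n₁ n₂
  obtain ⟨n, z, hz⟩ := nonempty_interior_of_iUnion_of_closed hFc hFU
  obtain ⟨O, hO, hOF⟩ := mem_nhds_subtype S z _ |>.1 (mem_interior_iff_mem_nhds.1 hz)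
  obtain ⟨V, hVO, hV, hzV⟩ := mem_nhds_iff.1 hO
  have hSc : ∀ q ∈ V ∩ Ω, q ∉ S → q ∈ G := fun q hq hqS => by
    by_contra h
    exact hqS ⟨hq.2, h⟩
  refine z.2.2 ⟨z.2.1, Filter.mem_of_superset ((hV.inter hΩ).mem_nhds ⟨hzV, z.2.1⟩) fun q hq => ?_⟩
  by_cases hqS : q ∈ S
  · exact continuousAt_of_crossLip hlam hA (Nat.cast_nonneg n) (hr n)
      ((hV.inter hΩ).mem_nhds hq) (hsol.mono Set.inter_subset_right) (fun w hw => hnn w hw.2)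
      (fun w hw hwS => Filter.mem_of_superset (hGo.mem_nhds (hSc w hw hwS)) fun v hv hvS =>
        hvS.2 hv) (fun w hw hwS => (hSc w hw hwS).2.self_of_nhds) hqS
      (fun w hw hwS => (hOF (a := ⟨w, hwS⟩) (hVO hw.1)).2)
  · exact (hSc q hq hqS).2.self_of_nhds

end ContinuousOn

section Coordinates
variable {m : ℕ}

@[simp]
theorem xprime_mkPt (x' : Spc' m) (a : ℝ) : xprime (mkPt x' a) = x' := by
  ext i
  simp [xprime, mkPt]

@[simp]
theorem xlast_mkPt (x' : Spc' m) (a : ℝ) : xlast (mkPt x' a) = a := by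
  simp [xlast, mkPt]

theorem mkPt_xprime_xlast (x : Spc m) : mkPt (xprime x) (xlast x) = x := by
  ext i
  by_cases h : i = Fin.last m
  · simp [mkPt, xlast, h]
  · simp [mkPt, xprime, h]

theorem norm_sub_sq_eq_xprime_add_xlast (x y : Spc m) :
    ‖x - y‖ ^ 2 = ‖xprime x - xprime y‖ ^ 2 + (xlast x - xlast y) ^ 2 := by
  rw [EuclideanSpace.norm_sq_eq, EuclideanSpace.norm_sq_eq, Fin.sum_univ_castSucc]
  simp [xprime, xlast]

theorem norm_xprime_sub_le (x y : Spc m) : ‖xprime x - xprime y‖ ≤ ‖x - y‖ :=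
  le_of_sq_le_sq (by
    rw [norm_sub_sq_eq_xprime_add_xlast x y]; linarith [sq_nonneg (xlast x - xlast y)])
    (norm_nonneg _)

theorem abs_xlast_sub_le (x y : Spc m) : |xlast x - xlast y| ≤ ‖x - y‖ :=
  le_of_sq_le_sq (by
    rw [norm_sub_sq_eq_xprime_add_xlast x y, sq_abs]
    linarith [sq_nonneg ‖xprime x - xprime y‖]) (norm_nonneg _)

theorem norm_sub_le_xprime_add_xlast (x y : Spc m) :
    ‖x - y‖ ≤ ‖xprime x - xprime y‖ + |xlast x - xlast y| :=
  le_of_sq_le_sq (by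
    rw [norm_sub_sq_eq_xprime_add_xlast x y, add_sq, sq_abs]
    have : 0 ≤ ‖xprime x - xprime y‖ * |xlast x - xlast y| := by positivity
    linarith) (by positivity)

theorem continuous_xprime : Continuous (xprime : Spc m → Spc' m) :=
  LipschitzWith.continuous (K := 1) <| LipschitzWith.of_dist_le_mul fun x y => by
    rw [dist_eq_norm, dist_eq_norm, NNReal.coe_one, one_mul]
    exact norm_xprime_sub_le x y

theorem continuous_xlast : Continuous (xlast : Spc m → ℝ) :=
  LipschitzWith.continuous (K := 1) <| LipschitzWith.of_dist_le_mul fun x y => by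
    rw [Real.dist_eq, dist_eq_norm, NNReal.coe_one, one_mul]
    exact abs_xlast_sub_le x y

end Coordinates

section Graph
variable {m : ℕ} {K : ℝ} {g : Spc' m → ℝ → ℝ}

theorem isOpen_Cyl (hg : Continuous fun q : Spc' m × ℝ => g q.1 q.2) (r : ℝ) :
    IsOpen (Cyl g r) := by
  have h1 : Continuous fun p : Spc m × ℝ => xprime p.1 := continuous_xprime.comp continuous_fst
  have h2 : Continuous fun p : Spc m × ℝ => xlast p.1 := continuous_xlast.comp continuous_fst
  have h3 : Continuous fun p : Spc m × ℝ => g (xprime p.1) p.2 :=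
    hg.comp (h1.prodMk continuous_snd)
  exact (isOpen_lt h1.norm continuous_const).inter <|
    (isOpen_lt continuous_const continuous_snd).inter <|
    (isOpen_lt continuous_snd continuous_const).inter <|
    (isOpen_lt h3 h2).inter (isOpen_lt h2 (h3.add continuous_const))

theorem HolderSemi.abs_sub_le (h : HolderSemi 1 (1 / 2) K g) (x' y' : Spc' m) (t s : ℝ) :
    |g x' t - g y' s| ≤ K * (‖x' - y'‖ + √|t - s|) := by
  have := h x' y' t s
  rwa [Real.rpow_one, ← Real.sqrt_eq_rpow] at this

theorem HolderSemi.abs_hGamma_sub_le (hK : 0 ≤ K) (h : HolderSemi 1 (1 / 2) K g)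
    (p q : Spc m × ℝ) :
    |hGamma g p - hGamma g q| ≤ (1 + K) * ‖p.1 - q.1‖ + K * √|p.2 - q.2| := by
  have h1 := abs_xlast_sub_le p.1 q.1
  have h2 := h.abs_sub_le (xprime p.1) (xprime q.1) p.2 q.2
  have h3 : K * ‖xprime p.1 - xprime q.1‖ ≤ K * ‖p.1 - q.1‖ := by
    gcongr
    exact norm_xprime_sub_le _ _
  have e : hGamma g p - hGamma g q = (xlast p.1 - xlast q.1) -
      (g (xprime p.1) p.2 - g (xprime q.1) q.2) := by
    simp only [hGamma]
    ring
  rw [e]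
  linarith [abs_sub (xlast p.1 - xlast q.1) (g (xprime p.1) p.2 - g (xprime q.1) q.2)]

theorem bddBelow_pdist_image (p : Spc m × ℝ) (Γ : Set (Spc m × ℝ)) :
    BddBelow ((fun q => pdist p q) '' Γ) :=
  ⟨0, by
    rintro _ ⟨q, -, rfl⟩
    simp only [pdist]
    positivity⟩

theorem mem_graphSet_vertical (p : Spc m × ℝ) :
    (mkPt (xprime p.1) (g (xprime p.1) p.2), p.2) ∈ graphSet g := by
  simp [graphSet]

theorem sInf_pdist_graphSet_le {p : Spc m × ℝ} (hp : 0 ≤ hGamma g p) :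
    sInf ((fun q => pdist p q) '' graphSet g) ≤ hGamma g p := by
  refine (csInf_le (bddBelow_pdist_image _ _)
    (Set.mem_image_of_mem _ (mem_graphSet_vertical p))).trans ?_
  have h1 := norm_sub_le_xprime_add_xlast p.1 (mkPt (xprime p.1) (g (xprime p.1) p.2))
  rw [xprime_mkPt, xlast_mkPt, sub_self, norm_zero, zero_add] at h1
  rw [← abs_of_nonneg hp]
  simpa [pdist, hGamma] using h1

theorem HolderSemi.hGamma_le_sInf (hK : 0 ≤ K) (h : HolderSemi 1 (1 / 2) K g) (p : Spc m × ℝ) :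
    hGamma g p / (1 + K) ≤ sInf ((fun q => pdist p q) '' graphSet g) := by
  refine le_csInf ⟨_, Set.mem_image_of_mem _ (mem_graphSet_vertical p)⟩ ?_
  rintro _ ⟨q, hq, rfl⟩
  have hq0 : hGamma g q = 0 := sub_eq_zero.2 hq
  have h1 := le_of_abs_le (h.abs_hGamma_sub_le hK p q)
  rw [hq0, sub_zero] at h1
  rw [div_le_iff₀ (by positivity)]
  simp only [pdist, ← Real.sqrt_eq_rpow]
  linarith [Real.sqrt_nonneg |p.2 - q.2|]

theorem boxCyl_subset_Cyl (hK : 0 ≤ K) (h : HolderSemi 1 (1 / 2) K g) {x : Spc m} {t R T : ℝ}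
    (hx : ‖xprime x‖ + R < 1) (ht : |t| + T < 1) (h0 : (1 + K) * R + K * √T < hGamma g (x, t))
    (h1 : (1 + K) * R + K * √T < 1 - hGamma g (x, t)) :
    boxCyl x R (t - T) (t + T) ⊆ Cyl g 1 := by
  intro p hp
  obtain ⟨p1, p2, p3⟩ := mem_boxCyl.1 hp
  have hT : |p.2 - t| ≤ T := abs_le.2 ⟨by linarith, by linarith⟩
  have h2 := h.abs_hGamma_sub_le hK p (x, t)
  have h3 : (1 + K) * ‖p.1 - x‖ ≤ (1 + K) * R := by gcongr
  have h4 : K * √|p.2 - t| ≤ K * √T := by gcongr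
  have h5 := norm_xprime_sub_le p.1 x
  have h6 := norm_sub_norm_le (xprime p.1) (xprime x)
  obtain ⟨h7, h8⟩ := abs_le.1 h2
  have h9 := neg_abs_le t
  have h10 := le_abs_self t
  have h11 : hGamma g p = xlast p.1 - g (xprime p.1) p.2 := rfl
  refine ⟨by linarith, by linarith, by linarith, by linarith, by linarith⟩

end Graph

section Chain
variable {m : ℕ} {lam Lam K : ℝ}

/-- The point at height `h` above the graph of `g`, over `x'` at time `t`. -/
def abovePt (g : Spc' m → ℝ → ℝ) (x' : Spc' m) (h t : ℝ) : Spc m × ℝ := (mkPt x' (g x' t + h), t)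

theorem abovePt_hGamma (g : Spc' m → ℝ → ℝ) (p : Spc m × ℝ) :
    abovePt g (xprime p.1) (hGamma g p) p.2 = p := by
  rw [abovePt, hGamma, add_sub_cancel, mkPt_xprime_xlast]

theorem hGamma_abovePt (g : Spc' m → ℝ → ℝ) (x' : Spc' m) (h t : ℝ) :
    hGamma g (abovePt g x' h t) = h := by
  simp [abovePt, hGamma]

/-- A positive solution above a parabolically Lipschitz graph with `u Ē = 1`. -/
structure NormalizedSol (K : ℝ) (A : Spc m → Matrix (Fin (m + 1)) (Fin (m + 1)) ℝ)
    (g : Spc' m → ℝ → ℝ) (u : Spc m × ℝ → ℝ) : Prop where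
  cont : Continuous fun q : Spc' m × ℝ => g q.1 q.2
  holder : HolderSemi 1 (1 / 2) K g
  solves : SolvesL A u (Cyl g 1)
  pos : ∀ p ∈ Cyl g 1, 0 < u p
  norm : u (Ebar g) = 1

/-- One Harnack step between two points above the graph. -/
theorem exists_harnack_step (m : ℕ) {lam : ℝ} (hlam : 0 < lam) (Lam : ℝ) {K M : ℝ} (hK : 0 ≤ K)
    (hM : 0 < M) :
    ∃ C L : ℝ, 2 ≤ C ∧ 2 ≤ L ∧
      ∀ A : Spc m → Matrix (Fin (m + 1)) (Fin (m + 1)) ℝ, IsElliptic lam Lam A →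
      ∀ g u, NormalizedSol K A g u → ∀ (x' y' : Spc' m) (h h' t T : ℝ),
      ‖x'‖ ≤ 7 / 8 → |t| ≤ 1 / 2 → 0 < T → L * √T ≤ h → L * √T ≤ 1 - h →
      (1 + K) * ‖y' - x'‖ + |h' - h| + K * √T ≤ M * √T →
      u (abovePt g x' h t) ≤ C * u (abovePt g y' h' (t + T)) := by
  obtain ⟨C, R, hC, hR, hharn⟩ := exists_harnack m hlam Lam (κ := M ^ 2) (by positivity)
  refine ⟨C + 1, 2 * ((1 + K) * R + K) + 5 * R + 2, by linarith, by
    have : 0 ≤ (1 + K) * R := by positivity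
    linarith, ?_⟩
  intro A hA g u hu x' y' h h' t T hx ht hT hLh hLh' hdisp
  have hs : 0 < √T := Real.sqrt_pos.2 hT
  have hs2 : √T ^ 2 = T := Real.sq_sqrt hT.le
  have hKs : 0 ≤ K * √T := by positivity
  have hRs : 0 < R * √T := by positivity
  have hKRs : 0 < (1 + K) * (R * √T) := by positivity
  have hexp : (2 * ((1 + K) * R + K) + 5 * R + 2) * √T =
    2 * ((1 + K) * (R * √T) + K * √T) + 5 * (R * √T) + 2 * √T := by ring
  rw [hexp] at hLh hLh'
  have hT1 : T ≤ 1 / 16 := by nlinarith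
  have hbox : boxCyl (mkPt x' (g x' t + h)) (R * √T) (t - T) (t + T) ⊆ Cyl g 1 := by
    have hh : hGamma g (mkPt x' (g x' t + h), t) = h := hGamma_abovePt g x' h t
    refine boxCyl_subset_Cyl hK hu.holder ?_ (by linarith) (by rw [hh]; linarith)
      (by rw [hh]; linarith)
    rw [xprime_mkPt]
    linarith
  have hnn : NonnegSol A u (boxCyl (mkPt x' (g x' t + h)) (R * √T) (t - T) (t + T)) :=
    ⟨hu.solves.mono hbox, fun p hp => (hu.solves.continuousAt hlam hA (isOpen_Cyl hu.cont 1)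
      (fun q hq => (hu.pos q hq).le) (hbox hp)).continuousWithinAt,
      fun p hp => (hu.pos p (hbox hp)).le⟩
  have hd : ‖mkPt y' (g y' (t + T) + h') - mkPt x' (g x' t + h)‖ ≤ M * √T := by
    refine (norm_sub_le_xprime_add_xlast _ _).trans ?_
    rw [xprime_mkPt, xprime_mkPt, xlast_mkPt, xlast_mkPt, add_sub_add_comm]
    have h1 := hu.holder.abs_sub_le y' x' (t + T) t
    rw [add_sub_cancel_left, abs_of_pos hT] at h1
    linarith [abs_add_le (g y' (t + T) - g x' t) (h' - h)]
  have hx0 : 0 < u (abovePt g x' h t) := hu.pos _ (hbox (by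
    rw [mem_boxCyl]
    simp only [abovePt, sub_self, norm_zero]
    exact ⟨hRs.le, by linarith, by linarith⟩))
  have key := hharn A hA u _ (mkPt y' (g y' (t + T) + h')) t T hT hnn (by
    calc _ ≤ (M * √T) ^ 2 := by gcongr
      _ = _ := by rw [mul_pow, hs2])
  have h2 : 0 < u (abovePt g y' h' (t + T)) := by
    refine pos_of_mul_pos_right ?_ (show 0 ≤ C by linarith)
    exact hx0.trans_le key
  have e : u (abovePt g x' h t) ≤ C * u (abovePt g y' h' (t + T)) := key
  linarith

/-- Fixed-length Harnack chain from points at height comparable with one to `Ē`. -/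
theorem exists_bound_of_quarter_le (m : ℕ) {lam : ℝ} (hlam : 0 < lam) (Lam : ℝ) {K : ℝ}
    (hK : 0 ≤ K) :
    ∃ C : ℝ, 0 < C ∧
      ∀ A : Spc m → Matrix (Fin (m + 1)) (Fin (m + 1)) ℝ, IsElliptic lam Lam A →
      ∀ g u, NormalizedSol K A g u → ∀ (x' : Spc' m) (h t : ℝ),
      ‖x'‖ ≤ 7 / 8 → 1 / 4 ≤ h → h ≤ 3 / 4 → -(1 / 2) ≤ t → t ≤ 1 / 2 - 1 / 1156 →
      u (abovePt g x' h t) ≤ C := by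
  obtain ⟨C, L, hC, hL, hstep⟩ := exists_harnack_step m hlam Lam (M := 43 + 35 * K) hK
    (by positivity)
  obtain ⟨N, hN⟩ := exists_nat_ge (16 * L ^ 2)
  refine ⟨C ^ N, by positivity, ?_⟩
  intro A hA g u hu x' h t hx hh1 hh2 ht1 ht2
  have hN1 : 1 ≤ (N : ℝ) := by nlinarith
  have hN0 : 0 < (N : ℝ) := by linarith
  set T := (1 / 2 - t) / N with hT
  have hNT : N * T = 1 / 2 - t := by rw [hT]; field_simp
  have hT0 : 0 < T := div_pos (by linarith) hN0
  have hs : 0 < √T := Real.sqrt_pos.2 hT0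
  have hs2 : √T ^ 2 = T := Real.sq_sqrt hT0.le
  have hLs : L * √T ≤ 1 / 4 := by
    refine le_of_sq_le_sq ?_ (by norm_num)
    rw [mul_pow, hs2]
    have : 16 * L ^ 2 * T ≤ N * T := by gcongr
    linarith
  set ν := 1 / (N : ℝ) with hν
  have hν0 : 0 < ν := by positivity
  have hNν : N * ν = 1 := by rw [hν]; field_simp
  have hν1 : ν ≤ 1 := by rw [hν, div_le_one hN0]; exact hN1
  have hνs : ν ≤ 34 * √T := by
    refine le_of_sq_le_sq ?_ (by positivity)
    rw [mul_pow, hs2]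
    have : T = ν * (1 / 2 - t) := by rw [hT, hν]; ring
    nlinarith
  have chain : ∀ j : ℕ, j ≤ N → u (abovePt g x' h t) ≤ C ^ j *
      u (abovePt g ((1 - j * ν) • x') (h + j * ν * (1 / 2 - h)) (t + j * T)) := by
    intro j
    induction j with
    | zero => simp
    | succ j ih =>
      intro hj
      have hj' : (j : ℝ) + 1 ≤ N := by exact_mod_cast hj
      have hj0 : 0 ≤ (j : ℝ) := Nat.cast_nonneg j
      have hjν0 : 0 ≤ j * ν := by positivity
      have hjν : j * ν + ν ≤ 1 := by nlinarith
      have hjT : j * T + T ≤ 1 / 2 - t := by nlinarith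
      have hjT0 : 0 ≤ j * T := by positivity
      have hx1 : ‖(1 - j * ν) • x'‖ ≤ ‖x'‖ := by
        rw [norm_smul, Real.norm_eq_abs, abs_of_nonneg (by linarith)]
        exact mul_le_of_le_one_left (norm_nonneg _) (by linarith)
      have hd1 : ‖(1 - ((j + 1 : ℕ) : ℝ) * ν) • x' - (1 - j * ν) • x'‖ ≤ ν := by
        rw [← sub_smul, norm_smul, Real.norm_eq_abs]
        push_cast
        rw [show 1 - ((j : ℝ) + 1) * ν - (1 - j * ν) = -ν by ring, abs_neg, abs_of_pos hν0]
        exact mul_le_of_le_one_right hν0.le (by linarith)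
      have hd2 : |h + ((j + 1 : ℕ) : ℝ) * ν * (1 / 2 - h) - (h + j * ν * (1 / 2 - h))| ≤
          ν / 4 := by
        push_cast
        rw [show h + ((j : ℝ) + 1) * ν * (1 / 2 - h) - (h + j * ν * (1 / 2 - h)) =
          ν * (1 / 2 - h) by ring, abs_le]
        constructor <;> nlinarith
      have key := hstep A hA g u hu ((1 - j * ν) • x') ((1 - ((j + 1 : ℕ) : ℝ) * ν) • x')
        (h + j * ν * (1 / 2 - h)) (h + ((j + 1 : ℕ) : ℝ) * ν * (1 / 2 - h)) (t + j * T) T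
        (hx1.trans hx) (abs_le.2 ⟨by linarith, by linarith⟩) hT0 (by nlinarith) (by nlinarith) (by
          have : (1 + K) * ‖(1 - ((j + 1 : ℕ) : ℝ) * ν) • x' - (1 - j * ν) • x'‖ ≤
            (1 + K) * (34 * √T) := by
            gcongr
            exact hd1.trans hνs
          have : 0 ≤ K * √T := by positivity
          linarith)
      have e : t + ((j + 1 : ℕ) : ℝ) * T = t + j * T + T := by push_cast; ring
      rw [e]
      calc _ ≤ C ^ j * _ := ih (by omega)
        _ ≤ C ^ j * (C * _) := by gcongr
        _ = _ := by ring
  have := chain N le_rfl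
  rw [hNν, hNT, sub_self, zero_smul, one_mul, add_sub_cancel, add_sub_cancel] at this
  have hE : u (abovePt g 0 (1 / 2) (1 / 2)) = 1 := hu.norm
  rwa [hE, mul_one] at this

/-- Harnack chain along which the height above the graph grows geometrically. -/
theorem exists_bound_of_pow (m : ℕ) {lam : ℝ} (hlam : 0 < lam) (Lam : ℝ) {K : ℝ} (hK : 0 ≤ K) :
    ∃ C D σ : ℝ, 2 ≤ C ∧ 0 < D ∧ 0 < σ ∧
      ∀ A : Spc m → Matrix (Fin (m + 1)) (Fin (m + 1)) ℝ, IsElliptic lam Lam A →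
      ∀ g u, NormalizedSol K A g u → ∀ (k : ℕ) (x' : Spc' m) (h t : ℝ),
      ‖x'‖ ≤ 7 / 8 → 0 < h → h ≤ 3 / 4 → -(1 / 2) ≤ t → t ≤ 1 / 2 - 1 / 578 →
      1 / 4 ≤ (1 + σ) ^ k * h → u (abovePt g x' h t) ≤ C ^ k * D := by
  obtain ⟨C, L, hC, hL, hstep⟩ := exists_harnack_step m hlam Lam (M := 1 + K) hK (by positivity)
  obtain ⟨D, hD, hquarter⟩ := exists_bound_of_quarter_le m hlam Lam hK
  set σ := min (1 / L) (1 / 1156) with hσ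
  have hσ0 : 0 < σ := by positivity
  have hσL : L * σ ≤ 1 := by
    calc L * σ ≤ L * (1 / L) := by
          gcongr
          exact min_le_left _ _
      _ = 1 := by field_simp
  have hσ1 : σ ≤ 1 / 1156 := min_le_right _ _
  refine ⟨C, D, σ, hC, hD, hσ0, ?_⟩
  intro A hA g u hu k x' h t hx hh0 hh1 ht1 ht2
  have aux : ∀ (k : ℕ) (h t : ℝ), 0 < h → h ≤ 3 / 4 → -(1 / 2) ≤ t →
      t + σ * (3 / 4 - h) ≤ 1 / 2 - 1 / 1156 → 1 / 4 ≤ (1 + σ) ^ k * h →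
      u (abovePt g x' h t) ≤ C ^ k * D := by
    intro k
    induction k with
    | zero =>
      intro h t hh0 hh1 ht1 ht2 hk
      rw [pow_zero, one_mul] at hk ⊢
      have : 0 ≤ σ * (3 / 4 - h) := mul_nonneg hσ0.le (by linarith)
      exact hquarter A hA g u hu x' h t hx hk hh1 ht1 (by linarith)
    | succ k ih =>
      intro h t hh0 hh1 ht1 ht2 hk
      have h0 : 0 ≤ σ * (3 / 4 - h) := mul_nonneg hσ0.le (by linarith)
      rcases le_or_gt (1 / 4) h with hq | hq
      · refine (hquarter A hA g u hu x' h t hx hq hh1 ht1 (by linarith)).trans ?_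
        exact le_mul_of_one_le_left hD.le (one_le_pow₀ (by linarith))
      have hσh : 0 < σ * h := by positivity
      have hsq : √((σ * h) ^ 2) = σ * h := Real.sqrt_sq hσh.le
      have hLh : L * (σ * h) ≤ h := by nlinarith
      have key := hstep A hA g u hu x' x' h ((1 + σ) * h) t ((σ * h) ^ 2) hx
        (abs_le.2 ⟨ht1, by linarith⟩) (by positivity) (by rwa [hsq]) (by rw [hsq]; linarith) (by
          rw [hsq, sub_self, norm_zero, show (1 + σ) * h - h = σ * h by ring, abs_of_pos hσh]
          linarith)
      have hT : (σ * h) ^ 2 ≤ σ * (σ * h) := by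
        rw [show (σ * h) ^ 2 = h * (σ * (σ * h)) by ring]
        exact mul_le_of_le_one_left (by positivity) (by linarith)
      have hnext := ih ((1 + σ) * h) (t + (σ * h) ^ 2) (by positivity) (by nlinarith)
        (by nlinarith [sq_nonneg (σ * h)]) (by linarith) (by
          rw [← mul_assoc, ← pow_succ]; exact hk)
      calc _ ≤ C * u (abovePt g x' ((1 + σ) * h) (t + (σ * h) ^ 2)) := key
        _ ≤ C * (C ^ k * D) := by gcongr
        _ = _ := by rw [pow_succ]; ring
  exact aux k h t hh0 hh1 ht1 (by nlinarith)

theorem exists_growth_bound (m : ℕ) {lam : ℝ} (hlam : 0 < lam) (Lam : ℝ) {K : ℝ} (hK : 0 ≤ K) :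
    ∃ C C' : ℝ, 0 < C ∧ 0 < C' ∧
      ∀ A : Spc m → Matrix (Fin (m + 1)) (Fin (m + 1)) ℝ, IsElliptic lam Lam A →
      ∀ g u, NormalizedSol K A g u → ∀ p ∈ Cyl g (12 / 17),
        u p ≤ C * hGamma g p ^ (-C') := by
  obtain ⟨C, D, σ, hC, hD, hσ, hbd⟩ := exists_bound_of_pow m hlam Lam hK
  have hC0 : 0 < C := by linarith
  have hlogC : 0 < Real.log C := Real.log_pos (by linarith)
  have hlogσ : 0 < Real.log (1 + σ) := Real.log_pos (by linarith)
  refine ⟨C * D, Real.log C / Real.log (1 + σ), by positivity, by positivity, ?_⟩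
  intro A hA g u hu p hp
  obtain ⟨p1, p2, p3, p4, p5⟩ := hp
  set h := hGamma g p with hh
  have hdef : h = xlast p.1 - g (xprime p.1) p.2 := rfl
  have h0 : 0 < h := by linarith
  have h1 : h < 12 / 17 := by linarith
  set k := ⌈-Real.log h / Real.log (1 + σ)⌉₊ with hk
  have hk1 : -Real.log h ≤ k * Real.log (1 + σ) := (div_le_iff₀ hlogσ).1 (Nat.le_ceil _)
  have hk2 : (k : ℝ) ≤ -Real.log h / Real.log (1 + σ) + 1 :=
    (Nat.ceil_lt_add_one (div_nonneg (by linarith [Real.log_nonpos h0.le (by linarith)])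
      hlogσ.le)).le
  have hpow : 1 ≤ (1 + σ) ^ k * h := by
    rw [← Real.log_le_log_iff one_pos (by positivity), Real.log_one,
      Real.log_mul (by positivity) h0.ne', Real.log_pow]
    linarith
  have key := hbd A hA g u hu k (xprime p.1) h p.2 (by linarith) h0 (by linarith) (by linarith)
    (by linarith) (by linarith)
  rw [hh, abovePt_hGamma] at key
  have hCk : C ^ k ≤ C * h ^ (-(Real.log C / Real.log (1 + σ))) := by
    rw [← Real.log_le_log_iff (by positivity) (by positivity), Real.log_pow,
      Real.log_mul hC0.ne' (by positivity), Real.log_rpow h0]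
    calc (k : ℝ) * Real.log C ≤ (-Real.log h / Real.log (1 + σ) + 1) * Real.log C := by gcongr
      _ = _ := by ring
  calc u p ≤ C ^ k * D := key
    _ ≤ C * h ^ (-(Real.log C / Real.log (1 + σ))) * D := by gcongr
    _ = _ := by ring

end Chain

/-- **Polynomial interior growth bound via chains of Harnack cubes** (claim in the
proof of Lemma 2.6). -/
theorem interior_growth_bound (m : ℕ) (hm : 1 ≤ m) (lam Lam K : ℝ)
    (hlam : 0 < lam) (hlamLam : lam ≤ Lam) (hK : 0 < K) :
    ∃ C C' : ℝ, 0 < C ∧ 0 < C' ∧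
      ∀ (A : Spc m → Matrix (Fin (m + 1)) (Fin (m + 1)) ℝ), IsElliptic lam Lam A →
      ∀ g : Spc' m → ℝ → ℝ,
        Continuous (fun q : Spc' m × ℝ => g q.1 q.2) → g 0 0 = 0 →
        HolderSemi 1 (1 / 2) K g →
      ∀ u : Spc m × ℝ → ℝ,
        SolvesL A u (Cyl g 1) →
        (∀ p ∈ Cyl g 1, 0 < u p) →
        u (Ebar g) = 1 →
        ∀ p ∈ Cyl g (12 / 17),
          u p ≤ C * (sInf ((fun q => pdist p q) '' graphSet g)) ^ (-C') := by
  obtain ⟨C, C', hC, hC', h⟩ := exists_growth_bound m hlam Lam hK.le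
  refine ⟨C, C', hC, hC', fun A hA g hg _ hgK u hsol hpos hE p hp => ?_⟩
  refine (h A hA g u ⟨hg, hgK, hsol, hpos, hE⟩ p hp).trans ?_
  have h0 : 0 < hGamma g p := sub_pos.2 hp.2.2.2.1
  have hd : 0 < sInf ((fun q => pdist p q) '' graphSet g) :=
    (div_pos h0 (show 0 < 1 + K by linarith)).trans_le
      (hgK.hGamma_le_sInf hK.le p)
  exact mul_le_mul_of_nonneg_left
    (Real.rpow_le_rpow_of_nonpos hd (sInf_pdist_graphSet_le h0.le) (neg_nonpos.2 hC'.le)) hC.le
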